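/- arXiv:math/9811035 — 2 statements merged into one kernel-verified Lean document; each statement's English description precedes it below -/
import Mathlib

section
/- Let B be a Brown algebra over a field F of characteristic not 2 or 3, with associated triple system (b,t) for a choice of spanning skew-symmetric element s0. Then: (i) a vector subspace I ⊆ B is an inner ideal if and only if t(u,v,z) ∈ I for all u,v ∈ I and all z ∈ B; (ii) a vector subspace I ⊆ B has every nonzero element singular if and only if t(u,v,z) = b(z,v)·u + b(z,u)·v for all u,v ∈ I and all z ∈ B. -/
set_option synthInstance.maxHeartbeats 1000000
set_option maxHeartbeats 1000000

noncomputable section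

open scoped TensorProduct

universe u v

structure OctonionAlgebra (F : Type u) [Field F] : Type (max u (v + 1)) where
  C : Type v
  [ringC : NonAssocRing C]
  [modC : Module F C]
  [sccC : SMulCommClass F C C]
  [istC : IsScalarTower F C C]
  n : QuadraticForm F C
  finrank_eq : Module.finrank F C = 8
  nondeg : ∀ x : C, (∀ y : C, QuadraticMap.polar (⇑n) x y = 0) → x = 0
  n_one : n 1 = 1
  n_mul : ∀ x y : C, n (x * y) = n x * n y

attribute [instance] OctonionAlgebra.ringC OctonionAlgebra.modC OctonionAlgebra.sccC
  OctonionAlgebra.istC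

namespace OctonionAlgebra

variable {F : Type u} [Field F] (O : OctonionAlgebra.{u, v} F)

/-- Conjugation `x̄ := n(x,1)•1 - x` (bundled as a linear map; `polarBilin n x 1 = n(x,1)`). -/
def conj : O.C →ₗ[F] O.C :=
  (LinearMap.toSpanSingleton F O.C (1 : O.C)).comp ((QuadraticMap.polarBilin O.n).flip 1)
    - LinearMap.id

lemma conj_apply (x : O.C) :
    O.conj x = QuadraticMap.polar (⇑O.n) x 1 • (1 : O.C) - x := rfl

/-- A split octonion algebra: the norm form is isotropic. -/
def IsSplit : Prop := ∃ x : O.C, x ≠ 0 ∧ O.n x = 0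

end OctonionAlgebra

/-- A reduced Albert algebra `H₃(C,γ)`. -/
structure ReducedAlbert (F : Type u) [Field F] : Type (max u (v + 1)) where
  O : OctonionAlgebra.{u, v} F
  γ : Fin 3 → Fˣ

namespace ReducedAlbert

variable {F : Type u} [Field F] (A : ReducedAlbert.{u, v} F)

/-- The ambient space of 3×3 matrices over the octonion algebra. -/
abbrev M : Type v := Matrix (Fin 3) (Fin 3) A.O.C

/-- The 27-dimensional space `H₃(C,γ)` of `γ`-hermitian matrices:
`x = γ⁻¹ ⬝ (x̄)ᵀ ⬝ γ`, i.e. entrywise `x i j = γᵢ⁻¹ γⱼ • conj (x j i)`. -/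
def J : Submodule F A.M where
  carrier := {x | ∀ i j, x i j = ((A.γ i : F)⁻¹ * (A.γ j : F)) • A.O.conj (x j i)}
  add_mem' := by
    intro a b ha hb i j
    show a i j + b i j = ((A.γ i : F)⁻¹ * (A.γ j : F)) • A.O.conj (a j i + b j i)
    rw [map_add, smul_add, ← ha i j, ← hb i j]
  zero_mem' := by
    intro i j
    show (0 : A.O.C) = ((A.γ i : F)⁻¹ * (A.γ j : F)) • A.O.conj (0 : A.O.C)
    rw [map_zero, smul_zero]
  smul_mem' := by
    intro c a ha i j
    show c • a i j = ((A.γ i : F)⁻¹ * (A.γ j : F)) • A.O.conj (c • a j i)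
    rw [map_smul, smul_comm, ← ha i j]

/-- The Jordan product `x·y := (xy + yx)/2`. -/
def jmul (x y : A.M) : A.M := (2 : F)⁻¹ • (x * y + y * x)

/-- The trace `T(x)`: the sum of the diagonal entries, which for hermitian matrices are
scalars `ε•1`; the scalar `ε` is recovered as `n(ε•1, 1)/2`. -/
def trace (x : A.M) : F := (2 : F)⁻¹ * ∑ i, QuadraticMap.polar (⇑A.O.n) (x i i) 1

/-- The trace bilinear form `T(x,y) := T(x·y)`. -/
def tb (x y : A.M) : F := A.trace (A.jmul x y)

/-- The adjoint `x ^ # = x·x − T(x)·x + ½(T(x)² − T(x,x))·1`, the unique quadratic map such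
that `T(x^#, y)` is the coefficient of `s` in `N(x + s y)`. -/
def sharp (x : A.M) : A.M :=
  A.jmul x x - A.trace x • x + ((2 : F)⁻¹ * (A.trace x ^ 2 - A.tb x x)) • (1 : A.M)

/-- The Freudenthal cross product `x × y := (x+y)^# − x^# − y^#`. -/
def cross (x y : A.M) : A.M := A.sharp (x + y) - A.sharp x - A.sharp y

/-- The cubic norm `N`, defined pointwise on `J` by
`N(x)·1 = x·(x·x) − T(x)·(x·x) + ½(T(x)² − T(x,x))·x`; the scalar is recovered by
applying the trace (which takes value `3` on `1`). -/
def norm (x : A.M) : F :=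
  (3 : F)⁻¹ * A.trace (A.jmul x (A.jmul x x) - A.trace x • A.jmul x x
    + ((2 : F)⁻¹ * (A.trace x ^ 2 - A.tb x x)) • x)

/-- The operator `⟨x,y⟩(j) := ½ (y × (x × j) − T(j,y)·x − ⅓·T(x,y)·j)`. -/
def brok (x y j : A.M) : A.M :=
  (2 : F)⁻¹ • (A.cross y (A.cross x j) - A.tb j y • x - ((3 : F)⁻¹ * A.tb x y) • j)

/-- `A` is the split Albert algebra `H₃(Cᵈ, 1)`. -/
def IsSplitAlbert : Prop := A.O.IsSplit ∧ ∀ i, A.γ i = 1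

/-- A point of `H₃(C,γ)` with coordinates `(ε₀,ε₁,ε₂; a,b,c)`. -/
def elt (ε : Fin 3 → F) (a b c : A.O.C) : A.M :=
  Matrix.of
    ![![ε 0 • (1 : A.O.C), c, ((A.γ 0 : F)⁻¹ * (A.γ 2 : F)) • A.O.conj b],
      ![((A.γ 1 : F)⁻¹ * (A.γ 0 : F)) • A.O.conj c, ε 1 • (1 : A.O.C), a],
      ![b, ((A.γ 2 : F)⁻¹ * (A.γ 1 : F)) • A.O.conj a, ε 2 • (1 : A.O.C)]]

/-! ### The Brown algebra `B(J, F×F, ζ)` -/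

/-- Ambient space of the Brown algebra `B(J, F×F, ζ)`: elements `(α, j; j', β)`. -/
abbrev Bam : Type (max u v) := F × A.M × A.M × F

/-- The underlying 56-dimensional space of `B(J, F×F, ζ)`: both middle components lie in `J`. -/
def Bsub : Submodule F A.Bam where
  carrier := {p | p.2.1 ∈ A.J ∧ p.2.2.1 ∈ A.J}
  add_mem' := fun ha hb => ⟨A.J.add_mem ha.1 hb.1, A.J.add_mem ha.2 hb.2⟩
  zero_mem' := ⟨A.J.zero_mem, A.J.zero_mem⟩
  smul_mem' := fun c _ h => ⟨A.J.smul_mem c h.1, A.J.smul_mem c h.2⟩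

/-- The product of `B(J, F×F, ζ)`. -/
def bmul (ζ : F) (x y : A.Bam) : A.Bam :=
  (x.1 * y.1 + ζ * A.tb x.2.1 y.2.2.1,
   x.1 • y.2.1 + y.2.2.2 • x.2.1 + ζ • A.cross x.2.2.1 y.2.2.1,
   y.1 • x.2.2.1 + x.2.2.2 • y.2.2.1 + A.cross x.2.1 y.2.1,
   x.2.2.2 * y.2.2.2 + ζ * A.tb y.2.1 x.2.2.1)

/-- The involution `(α,j;j',β)‾ = (β,j;j',α)` of `B(J, F×F, ζ)`. -/
def binv (x : A.Bam) : A.Bam := (x.2.2.2, x.2.1, x.2.2.1, x.1)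

/-- The skew-symmetric element `s₀ = (1,0;0,−1)`. -/
def s0 : A.Bam := (1, 0, 0, -1)

/-- The triple product `{x,y,z} := (x·ȳ)·z + (z·ȳ)·x − (z·x̄)·y` in `B(J, F×F, ζ)`. -/
def brace (ζ : F) (x y z : A.Bam) : A.Bam :=
  A.bmul ζ (A.bmul ζ x (A.binv y)) z + A.bmul ζ (A.bmul ζ z (A.binv y)) x
    - A.bmul ζ (A.bmul ζ z (A.binv x)) y

/-- The bilinear form of the triple system associated to `B(J, F×F, ζ)` and a skew element
`s`: `b(x,y)` is the unique scalar with `b(x,y)•1 = (x·ȳ − y·x̄)·s`; since the unit of the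
algebra is `(1,0;0,1)`, it is the first component of the right-hand side. -/
def bformS (ζ : F) (s x y : A.Bam) : F :=
  (A.bmul ζ (A.bmul ζ x (A.binv y) - A.bmul ζ y (A.binv x)) s).1

/-- The trilinear product of the triple system associated to `B(J, F×F, ζ)` and `s`:
`t(y,z,w) := 2{y, s·z, w} − b(z,w)·y − b(z,y)·w − b(y,w)·z`. -/
def tformS (ζ : F) (s y z w : A.Bam) : A.Bam :=
  (2 : F) • A.brace ζ y (A.bmul ζ s z) w - A.bformS ζ s z w • y - A.bformS ζ s z y • w
    - A.bformS ζ s y w • z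

/-- The bilinear form of the triple system associated to `B(J, F×F, ζ)` and `s₀`. -/
def bform (ζ : F) (x y : A.Bam) : F := A.bformS ζ A.s0 x y

/-- The trilinear product of the triple system associated to `B(J, F×F, ζ)` and `s₀`. -/
def tform (ζ : F) (y z w : A.Bam) : A.Bam := A.tformS ζ A.s0 y z w

/-- `e` is a singular element of `B(J, F×F, ζ)`: `e ≠ 0` and `U_e(B) ⊆ F·e`
where `U_e(x) := {e,x,e}`. -/
def IsSingular (ζ : F) (e : A.Bam) : Prop :=
  e ≠ 0 ∧ ∀ x ∈ A.Bsub, ∃ c : F, A.brace ζ e x e = c • e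

/-- `I` is an inner ideal of `B(J, F×F, ζ)`: a subspace of `B` with `U_e(B) ⊆ I`
for all `e ∈ I`. -/
def IsInnerIdeal (ζ : F) (I : Submodule F A.Bam) : Prop :=
  I ≤ A.Bsub ∧ ∀ e ∈ I, ∀ x ∈ A.Bsub, A.brace ζ e x e ∈ I

end ReducedAlbert

/-- The separable closure of `F` (inside an algebraic closure). -/
abbrev Fsep (F : Type u) [Field F] : Type u :=
  ↥(separableClosure F (AlgebraicClosure F))

/-- A Brown algebra over `F`: a 56-dimensional `F`-algebra with `F`-linear involution which
becomes isomorphic to the split Brown algebra `B(Jᵈ, K×K)` after base change to the separable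
closure `K` of `F`. -/
structure BrownAlgebra (F : Type u) [Field F] : Type (u + 1) where
  B : Type u
  [ringB : NonAssocRing B]
  [modB : Module F B]
  [sccB : SMulCommClass F B B]
  [istB : IsScalarTower F B B]
  ι : B →ₗ[F] B
  ι_invol : ∀ x, ι (ι x) = x
  ι_antimul : ∀ x y : B, ι (x * y) = ι y * ι x
  finrank56 : Module.finrank F B = 56
  /-- After base change to the separable closure `K = Fsep F`, the algebra with involution is
  isomorphic to the split Brown algebra `B(Jᵈ, K×K)` (for `Jᵈ` the split Albert algebra over
  `K`), via a `K`-linear bijection onto the 56-dimensional subspace `Bsub` of the ambient model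
  which intertwines the multiplications and involutions. -/
  split : ∃ A : ReducedAlbert.{u, u} (Fsep F), A.IsSplitAlbert ∧
    ∃ f : (Fsep F) ⊗[F] B →ₗ[Fsep F] A.Bam,
      Function.Injective f ∧ LinearMap.range f = A.Bsub ∧
      (∀ x y : B, f ((1 : Fsep F) ⊗ₜ[F] (x * y))
          = A.bmul 1 (f ((1 : Fsep F) ⊗ₜ[F] x)) (f ((1 : Fsep F) ⊗ₜ[F] y))) ∧
      (∀ x : B, f ((1 : Fsep F) ⊗ₜ[F] (ι x)) = A.binv (f ((1 : Fsep F) ⊗ₜ[F] x)))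

attribute [instance] BrownAlgebra.ringB BrownAlgebra.modB BrownAlgebra.sccB BrownAlgebra.istB

namespace BrownAlgebra

variable {F : Type u} [Field F] (Br : BrownAlgebra F)

/-- The triple product `{x,y,z} := (x·ȳ)·z + (z·ȳ)·x − (z·x̄)·y`. -/
def braceA (x y z : Br.B) : Br.B :=
  (x * Br.ι y) * z + (z * Br.ι y) * x - (z * Br.ι x) * y

/-- `s₀` spans the (1-dimensional) space of skew-symmetric elements. -/
def IsSkewGen (s0 : Br.B) : Prop := s0 ≠ 0 ∧ Br.ι s0 = -s0

/-- `bB` is the skew-symmetric bilinear form of the triple system associated to `Br` and the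
skew element `s₀`: `b(x,y)` is the unique scalar with `b(x,y)•1 = (x·ȳ − y·x̄)·s₀`. -/
def IsBForm (s0 : Br.B) (bB : Br.B → Br.B → F) : Prop :=
  ∀ x y : Br.B, bB x y • (1 : Br.B) = (x * Br.ι y - y * Br.ι x) * s0

/-- The trilinear product of the triple system associated to `Br`, `s₀` and `bB`:
`t(y,z,w) := 2{y, s₀·z, w} − b(z,w)·y − b(z,y)·w − b(y,w)·z`. -/
def tripleT (s0 : Br.B) (bB : Br.B → Br.B → F) (y z w : Br.B) : Br.B :=
  (2 : F) • Br.braceA y (s0 * z) w - bB z w • y - bB z y • w - bB y w • z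

/-- An element `e` is singular: `e ≠ 0` and `U_e(B) ⊆ F·e` where `U_e x := {e,x,e}`. -/
def IsSingularA (e : Br.B) : Prop :=
  e ≠ 0 ∧ ∀ x : Br.B, ∃ c : F, Br.braceA e x e = c • e

/-- `I` is an inner ideal: `U_e(B) ⊆ I` for all `e ∈ I`. -/
def IsInnerIdealA (I : Submodule F Br.B) : Prop :=
  ∀ e ∈ I, ∀ x : Br.B, Br.braceA e x e ∈ I

end BrownAlgebra

namespace OctonionAlgebra

variable {F : Type u} [Field F] (O : OctonionAlgebra.{u, v} F)

lemma polar_mul_mul_left (x y z : O.C) :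
    QuadraticMap.polar O.n (x * y) (x * z) = O.n x * QuadraticMap.polar O.n y z := by
  simp only [QuadraticMap.polar, ← mul_add, O.n_mul]
  ring

lemma polar_mul_mul_right (x y z : O.C) :
    QuadraticMap.polar O.n (y * x) (z * x) = QuadraticMap.polar O.n y z * O.n x := by
  simp only [QuadraticMap.polar, ← add_mul, O.n_mul]
  ring

/-- Left multiplication by `x̄` is adjoint to left multiplication by `x`. -/
lemma polar_mul_left (x y z : O.C) :
    QuadraticMap.polar O.n (x * y) z = QuadraticMap.polar O.n y (O.conj x * z) := by
  have h := O.polar_mul_mul_left (x + 1) y z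
  have hx := QuadraticMap.map_add O.n x 1
  simp only [add_mul, one_mul, QuadraticMap.polar_add_left, QuadraticMap.polar_add_right,
    O.polar_mul_mul_left, hx, O.n_one] at h
  simp only [conj_apply, sub_mul, smul_mul_assoc, one_mul, QuadraticMap.polar_sub_right,
    QuadraticMap.polar_smul_right, smul_eq_mul]
  linear_combination h

/-- Right multiplication by `ȳ` is adjoint to right multiplication by `y`. -/
lemma polar_mul_right (x y z : O.C) :
    QuadraticMap.polar O.n (x * y) z = QuadraticMap.polar O.n x (z * O.conj y) := by
  have h := O.polar_mul_mul_right (y + 1) x z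
  have hx := QuadraticMap.map_add O.n y 1
  simp only [mul_add, mul_one, QuadraticMap.polar_add_left, QuadraticMap.polar_add_right,
    O.polar_mul_mul_right, hx, O.n_one] at h
  simp only [conj_apply, mul_sub, mul_smul_comm, mul_one, QuadraticMap.polar_sub_right,
    QuadraticMap.polar_smul_right, smul_eq_mul]
  linear_combination h

lemma polar_one_one : QuadraticMap.polar O.n 1 1 = 2 := by
  have h : O.n ((2 : F) • (1 : O.C)) = 4 := by
    rw [QuadraticMap.map_smul, O.n_one]; norm_num
  rw [QuadraticMap.polar, ← two_smul F (1 : O.C), h, O.n_one]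
  norm_num

lemma conj_conj (x : O.C) : O.conj (O.conj x) = x := by
  simp only [conj_apply, QuadraticMap.polar_sub_left, QuadraticMap.polar_smul_left,
    polar_one_one, smul_eq_mul]
  module

/-- The trace `n(x,1)` of `x`. -/
def tr (x : O.C) : F := QuadraticMap.polar O.n x 1

lemma tr_add (x y : O.C) : O.tr (x + y) = O.tr x + O.tr y :=
  QuadraticMap.polar_add_left O.n x y 1

lemma tr_smul (c : F) (x : O.C) : O.tr (c • x) = c * O.tr x :=
  QuadraticMap.polar_smul_left O.n c x 1

lemma tr_sum {ι : Type*} (s : Finset ι) (f : ι → O.C) :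
    O.tr (∑ i ∈ s, f i) = ∑ i ∈ s, O.tr (f i) :=
  map_sum ((QuadraticMap.polarBilin O.n).flip 1) f s

lemma tr_mul (x y : O.C) : O.tr (x * y) = QuadraticMap.polar O.n x (O.conj y) := by
  rw [tr, polar_mul_right, one_mul]

lemma tr_mul_comm (x y : O.C) : O.tr (x * y) = O.tr (y * x) := by
  rw [O.tr_mul y x, tr, polar_mul_left, mul_one]

lemma tr_mul_assoc (x y z : O.C) : O.tr (x * y * z) = O.tr (x * (y * z)) := by
  rw [tr_mul_comm O x, tr_mul, tr_mul, polar_mul_left, polar_mul_right]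

lemma polar_conj_conj (x y : O.C) :
    QuadraticMap.polar O.n (O.conj x) (O.conj y) = QuadraticMap.polar O.n x y := by
  rw [← tr_mul, tr_mul_comm, tr_mul, conj_conj, QuadraticMap.polar_comm]

end OctonionAlgebra

namespace ReducedAlbert

variable {F : Type u} [Field F] (A : ReducedAlbert.{u, v} F)

/-- The sum of the traces of the diagonal entries, i.e. twice the trace. -/
def diagTr (x : A.M) : F := ∑ i, A.O.tr (x i i)

lemma diagTr_add (x y : A.M) : A.diagTr (x + y) = A.diagTr x + A.diagTr y := by
  simp [diagTr, OctonionAlgebra.tr_add, Finset.sum_add_distrib]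

lemma diagTr_smul (c : F) (x : A.M) : A.diagTr (c • x) = c * A.diagTr x := by
  simp [diagTr, OctonionAlgebra.tr_smul, Finset.mul_sum]

lemma diagTr_mul (x y : A.M) : A.diagTr (x * y) = ∑ i, ∑ j, A.O.tr (x i j * y j i) := by
  simp only [diagTr, Matrix.mul_apply, OctonionAlgebra.tr_sum]

lemma diagTr_mul_comm (x y : A.M) : A.diagTr (x * y) = A.diagTr (y * x) := by
  rw [diagTr_mul, diagTr_mul, Finset.sum_comm]
  simp only [A.O.tr_mul_comm (x _ _)]

lemma diagTr_mul_assoc (x y z : A.M) :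
    A.diagTr (x * y * z) = A.diagTr (x * (y * z)) := by
  simp only [diagTr_mul, Matrix.mul_apply, Finset.sum_mul, Finset.mul_sum,
    OctonionAlgebra.tr_sum, OctonionAlgebra.tr_mul_assoc]
  exact Finset.sum_congr rfl fun i _ => Finset.sum_comm

lemma trace_eq (x : A.M) : A.trace x = (2 : F)⁻¹ * A.diagTr x := rfl

lemma trace_add (x y : A.M) : A.trace (x + y) = A.trace x + A.trace y := by
  simp only [trace_eq, diagTr_add, mul_add]

lemma trace_smul (c : F) (x : A.M) : A.trace (c • x) = c * A.trace x := by
  simp only [trace_eq, diagTr_smul]; ring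

lemma jmul_comm (x y : A.M) : A.jmul x y = A.jmul y x := by
  rw [jmul, jmul, add_comm]

lemma jmul_add_left (x y z : A.M) : A.jmul (x + y) z = A.jmul x z + A.jmul y z := by
  simp only [jmul, add_mul, mul_add]; module

lemma jmul_smul_left (c : F) (x y : A.M) : A.jmul (c • x) y = c • A.jmul x y := by
  simp only [jmul, smul_mul_assoc, mul_smul_comm]; module

lemma jmul_one (h2 : (2 : F) ≠ 0) (x : A.M) : A.jmul x 1 = x := by
  rw [jmul, mul_one, one_mul, ← two_smul F x, inv_smul_smul₀ h2]

lemma tb_comm (x y : A.M) : A.tb x y = A.tb y x := by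
  rw [tb, tb, jmul_comm]

lemma tb_add_left (x y z : A.M) : A.tb (x + y) z = A.tb x z + A.tb y z := by
  simp only [tb, jmul_add_left, trace_add]

lemma tb_smul_left (c : F) (x y : A.M) : A.tb (c • x) y = c * A.tb x y := by
  simp only [tb, jmul_smul_left, trace_smul]

lemma tb_add_right (x y z : A.M) : A.tb x (y + z) = A.tb x y + A.tb x z := by
  simp only [A.tb_comm x, tb_add_left]

lemma tb_smul_right (c : F) (x y : A.M) : A.tb x (c • y) = c * A.tb x y := by
  simp only [A.tb_comm x, tb_smul_left]

lemma tb_zero_left (x : A.M) : A.tb 0 x = 0 := by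
  simpa using A.tb_smul_left 0 0 x

lemma tb_zero_right (x : A.M) : A.tb x 0 = 0 := by
  rw [tb_comm, tb_zero_left]

lemma tb_neg_left (x y : A.M) : A.tb (-x) y = -A.tb x y := by
  simpa using A.tb_smul_left (-1) x y

lemma tb_neg_right (x y : A.M) : A.tb x (-y) = -A.tb x y := by
  rw [tb_comm, tb_neg_left, tb_comm]

lemma tb_sub_left (x y z : A.M) : A.tb (x - y) z = A.tb x z - A.tb y z := by
  rw [sub_eq_add_neg, tb_add_left, tb_neg_left, sub_eq_add_neg]

lemma tb_one (h2 : (2 : F) ≠ 0) (x : A.M) : A.tb x 1 = A.trace x := by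
  rw [tb, A.jmul_one h2]

lemma tb_jmul_left (x y z : A.M) : A.tb (A.jmul x y) z = A.tb x (A.jmul y z) := by
  have hyxz : A.diagTr (y * x * z) = A.diagTr (z * y * x) := by
    rw [diagTr_mul_comm, diagTr_mul_assoc]
  have hzxy : A.diagTr (z * x * y) = A.diagTr (x * y * z) := by
    rw [diagTr_mul_assoc, diagTr_mul_comm]
  have hyzx : A.diagTr (y * z * x) = A.diagTr (x * y * z) := by
    rw [diagTr_mul_comm, diagTr_mul_assoc]
  have hxzy : A.diagTr (x * z * y) = A.diagTr (z * y * x) := by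
    rw [diagTr_mul_assoc, diagTr_mul_comm]
  simp only [tb, jmul, trace_eq, diagTr_smul, diagTr_add, smul_mul_assoc, mul_smul_comm,
    smul_add, add_mul, mul_add, ← diagTr_mul_assoc, hyxz, hzxy, hyzx, hxzy]

lemma cross_eq (x y : A.M) :
    A.cross x y = (2 : F) • A.jmul x y - A.trace x • y - A.trace y • x
      + ((2 : F)⁻¹ * 2 * (A.trace x * A.trace y - A.tb x y)) • (1 : A.M) := by
  simp only [cross, sharp, jmul_add_left, A.jmul_comm _ (x + y), trace_add, tb_add_left,
    A.tb_comm _ (x + y), A.jmul_comm y x, A.tb_comm y x]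
  module

lemma cross_comm (x y : A.M) : A.cross x y = A.cross y x := by
  rw [cross_eq, cross_eq, A.jmul_comm y x, A.tb_comm y x]
  module

lemma cross_add_left (x y z : A.M) : A.cross (x + y) z = A.cross x z + A.cross y z := by
  simp only [cross_eq, jmul_add_left, trace_add, tb_add_left]
  module

lemma cross_smul_left (c : F) (x y : A.M) : A.cross (c • x) y = c • A.cross x y := by
  simp only [cross_eq, jmul_smul_left, trace_smul, tb_smul_left]
  module

lemma cross_add_right (x y z : A.M) : A.cross x (y + z) = A.cross x y + A.cross x z := by
  simp only [A.cross_comm x, cross_add_left]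

lemma cross_smul_right (c : F) (x y : A.M) : A.cross x (c • y) = c • A.cross x y := by
  simp only [A.cross_comm x, cross_smul_left]

lemma cross_zero_left (x : A.M) : A.cross 0 x = 0 := by
  simpa using A.cross_smul_left 0 0 x

lemma cross_zero_right (x : A.M) : A.cross x 0 = 0 := by
  rw [cross_comm, cross_zero_left]

lemma cross_neg_left (x y : A.M) : A.cross (-x) y = -A.cross x y := by
  simpa using A.cross_smul_left (-1) x y

lemma cross_neg_right (x y : A.M) : A.cross x (-y) = -A.cross x y := by
  rw [cross_comm, cross_neg_left, cross_comm]

/-- The trilinear form `T(x × y, z)` is symmetric. -/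
lemma tb_cross_left (h2 : (2 : F) ≠ 0) (x y z : A.M) :
    A.tb (A.cross x y) z = A.tb x (A.cross y z) := by
  have h : A.tb y (A.jmul x z) = A.tb x (A.jmul y z) := by
    rw [← tb_jmul_left, A.jmul_comm y x, tb_jmul_left]
  rw [A.tb_comm x]
  simp only [cross_eq, tb_sub_left, tb_add_left, tb_smul_left, A.tb_comm 1, A.tb_one h2,
    tb_jmul_left, A.tb_comm y x, A.tb_comm z x, A.jmul_comm z x, h, inv_mul_cancel₀ h2]
  ring

/-- The trace bilinear form is nondegenerate on the split Albert algebra. -/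
lemma exists_tb_ne_zero (h2 : (2 : F) ≠ 0) (hγ : ∀ i, A.γ i = 1) {x : A.M} (hx : x ∈ A.J)
    (hx0 : x ≠ 0) : ∃ y ∈ A.J, A.tb x y ≠ 0 := by
  have hJ : ∀ z : A.M, z ∈ A.J ↔ ∀ i j, z i j = A.O.conj (z j i) := by
    intro z
    show (∀ i j, z i j = ((A.γ i : F)⁻¹ * (A.γ j : F)) • A.O.conj (z j i)) ↔ _
    simp [hγ]
  rw [hJ] at hx
  have hx1 : ∃ i j, x i j ≠ 0 := by
    by_contra! h
    exact hx0 (Matrix.ext h)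
  obtain ⟨i, j, hij⟩ := hx1
  have hc : ∃ c, QuadraticMap.polar A.O.n (x i j) c ≠ 0 := by
    by_contra! h
    exact hij (A.O.nondeg _ h)
  obtain ⟨c, hc⟩ := hc
  have key : ∀ w : A.M, A.tb x w = (2 : F)⁻¹ * 2 * (2 : F)⁻¹ * A.diagTr (x * w) := by
    intro w
    rw [tb, trace_eq, jmul, diagTr_smul, diagTr_add, A.diagTr_mul_comm w x]
    ring
  have hs : A.diagTr (x * Matrix.single j i (A.O.conj c)) = QuadraticMap.polar A.O.n (x i j) c := by
    rw [diagTr_mul, Finset.sum_eq_single i, Finset.sum_eq_single j]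
    · simp [OctonionAlgebra.tr_mul, OctonionAlgebra.conj_conj]
    · intro b _ hb
      simp [hb.symm, OctonionAlgebra.tr]
    · simp
    · intro b _ hb
      simp [hb.symm, OctonionAlgebra.tr]
    · simp
  have hs' : A.diagTr (x * Matrix.single i j c) = QuadraticMap.polar A.O.n (x i j) c := by
    rw [diagTr_mul, Finset.sum_eq_single j, Finset.sum_eq_single i]
    · rw [hx j i]
      simp [OctonionAlgebra.tr_mul, OctonionAlgebra.polar_conj_conj]
    · intro b _ hb
      simp [hb.symm, OctonionAlgebra.tr]
    · simp
    · intro b _ hb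
      simp [hb.symm, OctonionAlgebra.tr]
    · simp
  refine ⟨Matrix.single j i (A.O.conj c) + Matrix.single i j c, ?_, ?_⟩
  · rw [hJ]
    intro k l
    simp only [Matrix.add_apply, Matrix.single_apply, map_add]
    rw [add_comm]
    congr 1
    · by_cases h : i = k ∧ j = l
      · rw [if_pos h, if_pos h.symm, OctonionAlgebra.conj_conj]
      · rw [if_neg h, if_neg (fun h' => h h'.symm), map_zero]
    · by_cases h : j = k ∧ i = l
      · rw [if_pos h, if_pos h.symm]
      · rw [if_neg h, if_neg (fun h' => h h'.symm), map_zero]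
  · rw [key, mul_add, diagTr_add, hs, hs']
    rw [inv_mul_cancel₀ h2, one_mul, ← two_mul, inv_mul_cancel_left₀ h2]
    exact hc

/-- The symmetric bilinear form with `b(x, y) = pair y (s₀x)`. -/
def pair (x y : A.Bam) : F :=
  x.1 * y.2.2.2 + x.2.2.2 * y.1 + A.tb x.2.1 y.2.2.1 + A.tb x.2.2.1 y.2.1

lemma pair_smul_left (c : F) (x y : A.Bam) : A.pair (c • x) y = c * A.pair x y := by
  simp only [pair, Prod.smul_fst, Prod.smul_snd, tb_smul_left, smul_eq_mul]
  ring

lemma pair_smul_right (c : F) (x y : A.Bam) : A.pair x (c • y) = c * A.pair x y := by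
  simp only [pair, Prod.smul_fst, Prod.smul_snd, tb_smul_right, smul_eq_mul]
  ring

lemma bmul_add_left (x y z : A.Bam) : A.bmul 1 (x + y) z = A.bmul 1 x z + A.bmul 1 y z := by
  simp only [bmul, Prod.fst_add, Prod.snd_add, tb_add_left, tb_add_right, cross_add_left, Prod.mk_add_mk, Prod.mk.injEq]
  refine ⟨by ring, by module, by module, by ring⟩

lemma bmul_smul_left (c : F) (x y : A.Bam) : A.bmul 1 (c • x) y = c • A.bmul 1 x y := by
  simp only [bmul, Prod.smul_fst, Prod.smul_snd, tb_smul_left, tb_smul_right, cross_smul_left,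
    Prod.smul_mk, Prod.mk.injEq, smul_eq_mul]
  refine ⟨by ring, by module, by module, by ring⟩

lemma bmul_add_right (x y z : A.Bam) : A.bmul 1 x (y + z) = A.bmul 1 x y + A.bmul 1 x z := by
  simp only [bmul, Prod.fst_add, Prod.snd_add, tb_add_left, tb_add_right, cross_add_right, Prod.mk_add_mk, Prod.mk.injEq]
  refine ⟨by ring, by module, by module, by ring⟩

lemma bmul_smul_right (c : F) (x y : A.Bam) : A.bmul 1 x (c • y) = c • A.bmul 1 x y := by
  simp only [bmul, Prod.smul_fst, Prod.smul_snd, tb_smul_left, tb_smul_right, cross_smul_right,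
    Prod.smul_mk, Prod.mk.injEq, smul_eq_mul]
  refine ⟨by ring, by module, by module, by ring⟩

lemma binv_add (x y : A.Bam) : A.binv (x + y) = A.binv x + A.binv y := rfl

lemma binv_smul (c : F) (x : A.Bam) : A.binv (c • x) = c • A.binv x := rfl

lemma brace_add_middle (x y z w : A.Bam) :
    A.brace 1 x (y + z) w = A.brace 1 x y w + A.brace 1 x z w := by
  simp only [brace, binv_add, bmul_add_left, bmul_add_right]
  abel

lemma brace_smul_middle (c : F) (x y w : A.Bam) :
    A.brace 1 x (c • y) w = c • A.brace 1 x y w := by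
  simp only [brace, binv_smul, bmul_smul_left, bmul_smul_right]
  module

lemma bmul_s0 (x : A.Bam) : A.bmul 1 A.s0 x = (x.1, x.2.1, -x.2.2.1, -x.2.2.2) := by
  simp [bmul, s0, tb_zero_left, tb_zero_right, cross_zero_left]

lemma bform_eq_pair (x y : A.Bam) : A.bform 1 x y = A.pair y (A.bmul 1 A.s0 x) := by
  rw [bmul_s0]
  simp only [bform, bformS, bmul, binv, s0, pair, Prod.fst_sub, Prod.snd_sub, tb_zero_right,
    tb_neg_right, A.tb_comm _ x.2.1, A.tb_comm _ x.2.2.1]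
  ring

/-- The triple product `t` is symmetric in its last two arguments. -/
lemma tform_eq (h2 : (2 : F) ≠ 0) (u w z : A.Bam) :
    A.tform 1 u w z = A.brace 1 u (A.bmul 1 A.s0 z) w + A.brace 1 w (A.bmul 1 A.s0 z) u
      - A.bform 1 z w • u - A.bform 1 z u • w := by
  obtain ⟨α₁, j₁, k₁, β₁⟩ := u
  obtain ⟨α₂, j₂, k₂, β₂⟩ := w
  obtain ⟨α₃, j₃, k₃, β₃⟩ := z
  have e : ∀ x y, A.bformS 1 A.s0 x y = A.pair y (A.bmul 1 A.s0 x) := A.bform_eq_pair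
  simp only [tform, tformS, bform, e, bmul_s0]
  simp only [pair, brace, bmul, binv, Prod.mk_add_mk, Prod.mk_sub_mk, Prod.smul_mk,
    Prod.mk.injEq, smul_eq_mul, one_mul, one_smul, cross_neg_left, cross_neg_right, tb_neg_left,
    tb_neg_right, tb_add_left, tb_add_right, cross_add_left, tb_smul_left,
    tb_smul_right, cross_smul_left, smul_add, smul_neg, smul_smul]
  have tri : ∀ x y z, A.tb (A.cross x y) z = A.tb z (A.cross x y) := fun _ _ _ => A.tb_comm _ _
  have tri₂ : ∀ x y z, A.tb y (A.cross x z) = A.tb x (A.cross y z) := fun x y z => by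
    rw [← A.tb_cross_left h2, A.cross_comm y x, A.tb_cross_left h2]
  have tri₃ : ∀ x y z, A.tb z (A.cross x y) = A.tb x (A.cross y z) := fun x y z => by
    rw [A.tb_comm, A.tb_cross_left h2]
  simp only [tri, A.cross_comm j₂ j₁, A.cross_comm j₃ j₁, A.cross_comm j₃ j₂,
    A.cross_comm k₂ k₁, A.cross_comm k₃ k₁, A.cross_comm k₃ k₂, tri₂ j₁ j₂, tri₃ j₁ j₂ j₃,
    tri₂ k₁ k₂, tri₃ k₁ k₂ k₃, A.tb_comm k₁ j₂,
    A.tb_comm k₁ j₃, A.tb_comm k₂ j₃, A.tb_comm k₃ j₁,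
    A.tb_comm k₃ j₂]
  refine ⟨by ring, by module, by module, by ring⟩

/-- The operators `U_e` are self-adjoint for `pair`. -/
lemma pair_brace (h2 : (2 : F) ≠ 0) (e x y : A.Bam) :
    A.pair (A.brace 1 e x e) y = A.pair (A.brace 1 e y e) x := by
  obtain ⟨α, j, k, β⟩ := e
  obtain ⟨γ, w, w', δ⟩ := x
  obtain ⟨γ', v, v', δ'⟩ := y
  simp only [pair, brace, bmul, binv, Prod.mk_add_mk, Prod.mk_sub_mk, one_mul, one_smul,
    tb_add_left, cross_add_left, tb_smul_left, cross_smul_left, tb_sub_left, tb_add_right,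
    tb_smul_right]
  have swap : ∀ a b c, A.tb (A.cross a b) c = A.tb (A.cross a c) b := fun a b c => by
    rw [A.tb_cross_left h2, A.cross_comm b c, A.tb_cross_left h2]
  have quart : ∀ a b c d, A.tb (A.cross (A.cross a b) c) d = A.tb (A.cross (A.cross c d) a) b :=
    fun a b c d => by
      rw [A.tb_cross_left h2, A.tb_comm, A.tb_cross_left h2 (A.cross c d)]
  rw [quart j w k v', quart j v k w', swap (A.cross j j) w' v', swap (A.cross k k) w v,
    A.cross_comm w j, A.cross_comm v j, A.cross_comm w' k, A.cross_comm v' k, swap j w v,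
    swap k w' v', swap k w' k, swap k v' k, ← A.tb_cross_left h2 j j w,
    ← A.tb_cross_left h2 j j v, A.tb_comm w k, A.tb_comm v k,
    A.tb_comm w (A.cross j j), A.tb_comm v (A.cross j j), A.tb_comm w v', A.tb_comm v w']
  ring

/-- If `U_e` maps `B` into the line spanned by `e`, it is determined by `b`. -/
lemma brace_eq_of_singular (h2 : (2 : F) ≠ 0) (hγ : ∀ i, A.γ i = 1) {e : A.Bam}
    (he : e ∈ A.Bsub) (hs : ∀ x ∈ A.Bsub, ∃ c : F, A.brace 1 e x e = c • e)
    {x : A.Bam} (hx : x ∈ A.Bsub) :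
    A.brace 1 e x e = (2 * A.pair e x) • e := by
  -- It suffices to determine the factor on a single element not orthogonal to `e`.
  have hcomm : ∀ y c z d, A.brace 1 e y e = c • e → A.brace 1 e z e = d • e →
      c * A.pair e z = d * A.pair e y := by
    intro y c z d hy hz
    have h := A.pair_brace h2 e y z
    rwa [hy, hz, pair_smul_left, pair_smul_left] at h
  have key : ∀ y ∈ A.Bsub, A.pair e y ≠ 0 →
      (∀ c, A.brace 1 e y e = c • e → c = 2 * A.pair e y) →
      A.brace 1 e x e = (2 * A.pair e x) • e := by
    intro y hy hy0 h
    obtain ⟨c, hc⟩ := hs x hx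
    obtain ⟨d, hd⟩ := hs y hy
    have hcd := hcomm x c y d hc hd
    rw [hc, show c = 2 * A.pair e x from mul_right_cancel₀ hy0 (by rw [hcd, h d hd]; ring)]
  have hvanish : ∀ y ∈ A.Bsub, A.pair e y = 0 → ∀ z ∈ A.Bsub, A.pair e z ≠ 0 →
      A.brace 1 e y e = 0 := by
    intro y hy hy0 z hz hz0
    obtain ⟨c, hc⟩ := hs y hy
    obtain ⟨d, hd⟩ := hs z hz
    have h := hcomm y c z d hc hd
    rw [hy0, mul_zero, mul_eq_zero, or_iff_left hz0] at h
    rw [hc, h, zero_smul]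
  obtain ⟨α, j, k, β⟩ := e
  obtain ⟨hj, hk⟩ : j ∈ A.J ∧ k ∈ A.J := he
  have h0 : (0 : A.M) ∈ A.J := A.J.zero_mem
  by_cases hα : α = 0
  swap
  · refine key (0, 0, 0, 1) ⟨h0, h0⟩ (by simpa [pair, tb_zero_right] using hα) fun c hc => ?_
    have h := congrArg Prod.fst hc
    simp [brace, bmul, binv, pair, tb_zero_right, tb_zero_left, cross_zero_left,
      cross_zero_right] at h ⊢
    exact mul_right_cancel₀ hα (by rw [← h]; ring)
  by_cases hβ : β = 0
  swap
  · refine key (1, 0, 0, 0) ⟨h0, h0⟩ (by simpa [pair, tb_zero_right] using hβ) fun c hc => ?_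
    have h := congrArg (fun p => p.2.2.2) hc
    simp [brace, bmul, binv, pair, tb_zero_right, tb_zero_left, cross_zero_left,
      cross_zero_right] at h ⊢
    exact mul_right_cancel₀ hβ (by rw [← h]; ring)
  subst hα hβ
  by_cases hj0 : j = 0
  swap
  · obtain ⟨w, hw, hw0⟩ := A.exists_tb_ne_zero h2 hγ hj hj0
    have hy : A.pair (0, j, k, 0) (0, 0, w, 0) = A.tb j w := by simp [pair, tb_zero_right]
    have hjj := congrArg (fun p => p.2.2.1) (hvanish (1, 0, 0, 0) ⟨h0, h0⟩
      (by simp [pair, tb_zero_right]) _ ⟨h0, hw⟩ (by rwa [hy]))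
    refine key (0, 0, w, 0) ⟨h0, hw⟩ (by rwa [hy]) fun c hc => ?_
    have h := congrArg (fun p => p.2.1) hc
    simp [brace, bmul, binv, tb_zero_right, tb_zero_left, cross_zero_left,
      cross_zero_right] at h hjj
    rw [hjj, cross_zero_left, sub_zero, ← add_smul] at h
    rw [hy, ← smul_left_injective F hj0 h, two_mul]
  by_cases hk0 : k = 0
  swap
  · obtain ⟨w, hw, hw0⟩ := A.exists_tb_ne_zero h2 hγ hk hk0
    have hy : A.pair (0, j, k, 0) (0, w, 0, 0) = A.tb k w := by simp [pair, tb_zero_right]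
    have hkk := congrArg (fun p => p.2.1) (hvanish (0, 0, 0, 1) ⟨h0, h0⟩
      (by simp [pair, tb_zero_right]) _ ⟨hw, h0⟩ (by rwa [hy]))
    refine key (0, w, 0, 0) ⟨hw, h0⟩ (by rwa [hy]) fun c hc => ?_
    have h := congrArg (fun p => p.2.2.1) hc
    simp [brace, bmul, binv, tb_zero_right, tb_zero_left, cross_zero_left,
      cross_zero_right] at h hkk
    rw [hkk, cross_zero_left, sub_zero, ← add_smul] at h
    rw [hy, ← smul_left_injective F hk0 h, two_mul, A.tb_comm k w]
  obtain ⟨c, hc⟩ := hs x hx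
  subst hj0 hk0
  rw [hc]
  have : ((0, 0, 0, 0) : A.Bam) = 0 := rfl
  rw [this, smul_zero, smul_zero]

end ReducedAlbert

lemma two_ne_zero_Fsep {F : Type u} [Field F] (h2 : (2 : F) ≠ 0) : (2 : Fsep F) ≠ 0 := by
  simpa only [map_ofNat] using (map_ne_zero (algebraMap F (Fsep F))).mpr h2

namespace BrownAlgebra

variable {F : Type u} [Field F] (Br : BrownAlgebra F)

/-- An embedding of a Brown algebra over `F` as an `F`-form of a split Brown algebra over the
separable closure. -/
structure Model where
  A : ReducedAlbert.{u, u} (Fsep F)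
  γ_eq_one : ∀ i, A.γ i = 1
  toFun : Br.B →+ A.Bam
  injective : Function.Injective toFun
  map_smul : ∀ (c : F) (x : Br.B), toFun (c • x) = algebraMap F (Fsep F) c • toFun x
  map_mul : ∀ x y, toFun (x * y) = A.bmul 1 (toFun x) (toFun y)
  map_inv : ∀ x, toFun (Br.ι x) = A.binv (toFun x)
  mem_Bsub : ∀ x, toFun x ∈ A.Bsub
  Bsub_le_span : A.Bsub ≤ Submodule.span (Fsep F) (Set.range toFun)

lemma nonempty_model : Nonempty Br.Model := by
  obtain ⟨A, hA, f, hf, hr, hm, hi⟩ := Br.split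
  refine ⟨⟨A, hA.2, f.toAddMonoidHom.comp (TensorProduct.mk F (Fsep F) Br.B 1).toAddMonoidHom,
    ?_, ?_, hm, hi, fun x => hr ▸ LinearMap.mem_range_self f _, ?_⟩⟩
  · exact hf.comp (Module.FaithfullyFlat.tensorProduct_mk_injective (B := Fsep F) Br.B)
  · intro c x
    show f (1 ⊗ₜ (c • x)) = algebraMap F (Fsep F) c • f (1 ⊗ₜ x)
    rw [← f.map_smul, TensorProduct.tmul_smul, algebraMap_smul]
  · rw [← hr]
    rintro _ ⟨t, rfl⟩
    induction t with
    | zero => rw [map_zero]; exact Submodule.zero_mem _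
    | add a b ha hb => rw [map_add]; exact Submodule.add_mem _ ha hb
    | tmul k x =>
      have : f (k ⊗ₜ x) = k • f (1 ⊗ₜ x) := by
        rw [← f.map_smul, TensorProduct.smul_tmul', smul_eq_mul, mul_one]
      rw [this]
      exact Submodule.smul_mem _ _ (Submodule.subset_span ⟨x, rfl⟩)

namespace Model

variable {Br} (m : Br.Model)

lemma map_brace (x y z : Br.B) :
    m.toFun (Br.braceA x y z) = m.A.brace 1 (m.toFun x) (m.toFun y) (m.toFun z) := by
  simp only [braceA, ReducedAlbert.brace, map_add, map_sub, m.map_mul, m.map_inv]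

lemma exists_map_skew (h2 : (2 : F) ≠ 0) {s0 : Br.B} (hs0 : Br.IsSkewGen s0) :
    ∃ l : Fsep F, l ≠ 0 ∧ m.toFun s0 = l • m.A.s0 := by
  have h2' := two_ne_zero_Fsep h2
  have hne : m.toFun s0 ≠ 0 := fun h => hs0.1 (m.injective (h.trans (map_zero _).symm))
  have hskew := m.map_inv s0
  rw [hs0.2, map_neg] at hskew
  generalize m.toFun s0 = p at hne hskew
  obtain ⟨α, j, k, β⟩ := p
  have hzero : ∀ w : m.A.M, -w = w → w = 0 := fun w hw => by
    have h : (2 : Fsep F) • w = 0 := by rw [two_smul]; nth_rw 1 [← hw]; exact neg_add_cancel w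
    exact (smul_eq_zero.mp h).resolve_left h2'
  simp only [ReducedAlbert.binv, Prod.neg_mk, Prod.mk.injEq] at hskew
  obtain ⟨h₁, hj, hk, -⟩ := hskew
  have hp : ((α, j, k, β) : m.A.Bam) = α • m.A.s0 := by
    simp [ReducedAlbert.s0, ← h₁, hzero j hj, hzero k hk]
  refine ⟨α, ?_, hp⟩
  rintro rfl
  exact hne (hp.trans (zero_smul _ _))

variable {s0 : Br.B} {l : Fsep F}

lemma map_s0_mul (hl : m.toFun s0 = l • m.A.s0) (x : Br.B) :
    m.toFun (s0 * x) = l • m.A.bmul 1 m.A.s0 (m.toFun x) := by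
  rw [m.map_mul, hl, ReducedAlbert.bmul_smul_left]

lemma map_one_fst (hl0 : l ≠ 0) (hl : m.toFun s0 = l • m.A.s0) : (m.toFun 1).1 = 1 := by
  have h := m.map_s0_mul hl 1
  rw [mul_one, hl] at h
  have h' := congrArg Prod.fst (smul_right_injective _ hl0 h)
  rw [ReducedAlbert.bmul_s0] at h'
  exact h'.symm

lemma algebraMap_bform (hl0 : l ≠ 0) (hl : m.toFun s0 = l • m.A.s0) {bB : Br.B → Br.B → F}
    (hbB : Br.IsBForm s0 bB) (x y : Br.B) :
    algebraMap F (Fsep F) (bB x y) = l * m.A.bform 1 (m.toFun x) (m.toFun y) := by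
  have h := congrArg (fun z => (m.toFun z).1) (hbB x y)
  simp only [m.map_smul, m.map_mul, map_sub, m.map_inv, hl, ReducedAlbert.bmul_smul_right,
    Prod.smul_fst, smul_eq_mul, m.map_one_fst hl0 hl, mul_one] at h
  exact h

end Model

variable {Br} {s0 : Br.B} {bB : Br.B → Br.B → F}

/-- The triple product `t` is symmetric in its last two arguments. -/
lemma tripleT_eq (h2 : (2 : F) ≠ 0) (hs0 : Br.IsSkewGen s0) (hbB : Br.IsBForm s0 bB)
    (u v z : Br.B) :
    Br.tripleT s0 bB u v z = Br.braceA u (s0 * z) v + Br.braceA v (s0 * z) u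
      - bB z v • u - bB z u • v := by
  obtain ⟨m⟩ := Br.nonempty_model
  obtain ⟨l, hl0, hl⟩ := m.exists_map_skew h2 hs0
  have h2' := two_ne_zero_Fsep h2
  apply m.injective
  have h := congrArg (l • ·) (m.A.tform_eq h2' (m.toFun u) (m.toFun v) (m.toFun z))
  simp only [tripleT, ReducedAlbert.tform, ReducedAlbert.tformS, map_sub, map_add, m.map_smul,
    m.map_brace, m.map_s0_mul hl, m.algebraMap_bform hl0 hl hbB,
    ReducedAlbert.brace_smul_middle, map_ofNat, ReducedAlbert.bform] at h ⊢
  convert h using 1 <;> module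

lemma braceA_eq_of_singular (h2 : (2 : F) ≠ 0) (hs0 : Br.IsSkewGen s0)
    (hbB : Br.IsBForm s0 bB) {e : Br.B} (he : Br.IsSingularA e) (z : Br.B) :
    Br.braceA e (s0 * z) e = (2 * bB z e) • e := by
  obtain ⟨m⟩ := Br.nonempty_model
  obtain ⟨l, hl0, hl⟩ := m.exists_map_skew h2 hs0
  have h2' := two_ne_zero_Fsep h2
  have hs : ∀ x ∈ m.A.Bsub, ∃ c : Fsep F,
      m.A.brace 1 (m.toFun e) x (m.toFun e) = c • m.toFun e := by
    intro x hx
    replace hx := m.Bsub_le_span hx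
    induction hx using Submodule.span_induction with
    | mem x h =>
      obtain ⟨y, rfl⟩ := h
      obtain ⟨c, hc⟩ := he.2 y
      exact ⟨algebraMap F (Fsep F) c, by rw [← m.map_brace, hc, m.map_smul]⟩
    | zero => exact ⟨0, by simpa using m.A.brace_smul_middle 0 (m.toFun e) 0 (m.toFun e)⟩
    | add x y _ _ h h' =>
      obtain ⟨c, hc⟩ := h
      obtain ⟨d, hd⟩ := h'
      exact ⟨c + d, by rw [ReducedAlbert.brace_add_middle, hc, hd, add_smul]⟩
    | smul a x _ h =>
      obtain ⟨c, hc⟩ := h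
      exact ⟨a * c, by rw [ReducedAlbert.brace_smul_middle, hc, mul_smul]⟩
  apply m.injective
  rw [m.map_brace, m.A.brace_eq_of_singular h2' m.γ_eq_one (m.mem_Bsub e) hs (m.mem_Bsub _),
    m.map_smul, (algebraMap F (Fsep F)).map_mul, m.algebraMap_bform hl0 hl hbB, m.map_s0_mul hl,
    ReducedAlbert.pair_smul_right, ReducedAlbert.bform_eq_pair, map_ofNat]

/-- Left multiplication by a nonzero skew element is surjective. -/
lemma exists_s0_mul_eq (h2 : (2 : F) ≠ 0) (hs0 : Br.IsSkewGen s0) (x : Br.B) :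
    ∃ z, s0 * z = x := by
  obtain ⟨m⟩ := Br.nonempty_model
  obtain ⟨l, hl0, hl⟩ := m.exists_map_skew h2 hs0
  have : FiniteDimensional F Br.B := FiniteDimensional.of_finrank_pos (by simp [Br.finrank56])
  have hinj : Function.Injective (LinearMap.mulLeft F s0) := by
    intro y z hyz
    have h := congrArg m.toFun hyz
    simp only [LinearMap.mulLeft_apply, m.map_s0_mul hl] at h
    have h' := smul_right_injective _ hl0 h
    simp only [ReducedAlbert.bmul_s0, Prod.mk.injEq, neg_inj] at h'
    exact m.injective (Prod.ext h'.1 (Prod.ext h'.2.1 (Prod.ext h'.2.2.1 h'.2.2.2)))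
  exact LinearMap.surjective_of_injective hinj x

lemma bB_add_right (hbB : Br.IsBForm s0 bB) (z u v : Br.B) (h1 : (1 : Br.B) ≠ 0) :
    bB z (u + v) = bB z u + bB z v := by
  apply smul_left_injective F h1
  simp only [add_smul, hbB _ _, map_add, mul_add, add_mul, sub_mul]
  abel

lemma braceA_add_add (u v x : Br.B) :
    Br.braceA (u + v) x (u + v) = Br.braceA u x u + Br.braceA v x v
      + (Br.braceA u x v + Br.braceA v x u) := by
  simp only [braceA, map_add, mul_add, add_mul]
  abel

end BrownAlgebra

/-- Let `B` be a Brown algebra with associated triple system `(b,t)` (for a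
spanning skew-symmetric `s₀`).  Then (i) a subspace `I ⊆ B` is an inner ideal iff
`t(I,I,B) ⊆ I`, and (ii) every nonzero element of a subspace `I` is singular iff
`t(u,v,z) = b(z,v)·u + b(z,u)·v` for all `u,v ∈ I`, `z ∈ B`. -/
theorem stmt17 {F : Type u} [Field F] (h2 : (2 : F) ≠ 0) (h3 : (3 : F) ≠ 0)
    (Br : BrownAlgebra F) (s0 : Br.B) (hs0 : Br.IsSkewGen s0)
    (bB : Br.B → Br.B → F) (hbB : Br.IsBForm s0 bB) :
    (∀ I : Submodule F Br.B,
      Br.IsInnerIdealA I ↔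
        (∀ u ∈ I, ∀ v ∈ I, ∀ z : Br.B, Br.tripleT s0 bB u v z ∈ I)) ∧
    (∀ I : Submodule F Br.B,
      (∀ e ∈ I, e ≠ 0 → Br.IsSingularA e) ↔
        (∀ u ∈ I, ∀ v ∈ I, ∀ z : Br.B,
          Br.tripleT s0 bB u v z = bB z v • u + bB z u • v)) := by
  have ht := BrownAlgebra.tripleT_eq h2 hs0 hbB
  have h1 : (1 : Br.B) ≠ 0 := fun h => hs0.1 (by rw [← mul_one s0, h, mul_zero])
  have hdiag : ∀ e z, Br.tripleT s0 bB e e z =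
      (2 : F) • Br.braceA e (s0 * z) e - (2 : F) • bB z e • e := fun e z => by
    rw [ht]; module
  refine ⟨fun I => ⟨fun hI u hu v hv z => ?_, fun hI e he x => ?_⟩,
    fun I => ⟨fun hI u hu v hv z => ?_, fun hI e he he0 => ⟨he0, fun x => ?_⟩⟩⟩
  · have h := I.sub_mem (I.sub_mem (hI _ (I.add_mem hu hv) (s0 * z)) (hI u hu (s0 * z)))
      (hI v hv (s0 * z))
    rw [BrownAlgebra.braceA_add_add] at h
    rw [ht]
    refine I.sub_mem (I.sub_mem ?_ (I.smul_mem _ hu)) (I.smul_mem _ hv)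
    convert h using 1
    abel
  · obtain ⟨z, rfl⟩ := BrownAlgebra.exists_s0_mul_eq h2 hs0 x
    have h := I.add_mem (hI e he e he z) (I.smul_mem 2 (I.smul_mem (bB z e) he))
    rw [hdiag, sub_add_cancel] at h
    exact (I.smul_mem_iff h2).mp h
  · have hU : ∀ e ∈ I, Br.braceA e (s0 * z) e = (2 * bB z e) • e := by
      intro e he
      by_cases he0 : e = 0
      · simp [he0, BrownAlgebra.braceA]
      · exact BrownAlgebra.braceA_eq_of_singular h2 hs0 hbB (hI e he he0) z
    have h := BrownAlgebra.braceA_add_add u v (s0 * z)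
    rw [hU _ (I.add_mem hu hv), hU u hu, hU v hv, BrownAlgebra.bB_add_right hbB z u v h1] at h
    rw [ht, ← sub_eq_of_eq_add' h]
    module
  · obtain ⟨z, rfl⟩ := BrownAlgebra.exists_s0_mul_eq h2 hs0 x
    have h := hI e he e he z
    rw [hdiag, sub_eq_iff_eq_add] at h
    refine ⟨2 * bB z e, smul_right_injective _ h2 ?_⟩
    show (2 : F) • _ = (2 : F) • _
    rw [h]
    module
end
end

section
/- Let F be a separably closed field of characteristic not 2 or 3, J^d the split Albert algebra over F, and B := B(J^d,F×F) with associated triple system (b,t). If I is a proper inner ideal of B containing a singular element, then there is an isometry f of (B,b,t) such that either f(I) = {(α, 0; v, 0) : α ∈ F, v ∈ V} for some totally singular subspace V ⊆ J^d, or f(I) = {(α, ξ·d; d×k, 0) : α, ξ ∈ F, k ∈ J^d} for some rank-one d ∈ J^d. In particular, either every nonzero element of I is singular and dim_F I ≤ 7, or dim_F I = 12 and I contains a nonzero element that is not singular. -/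
set_option synthInstance.maxHeartbeats 1000000
set_option maxHeartbeats 1000000

noncomputable section

open scoped TensorProduct

universe u v

namespace OctonionAlgebra

variable {F : Type u} [Field F] (O : OctonionAlgebra.{u, v} F)

/-- The polar form of the norm, as a bilinear form. -/
def bil : O.C →ₗ[F] O.C →ₗ[F] F := QuadraticMap.polarBilin O.n

lemma bil_eq (x y : O.C) : QuadraticMap.polar (⇑O.n) x y = O.bil x y := rfl

lemma n_add (x y : O.C) : O.n (x + y) = O.n x + O.n y + O.bil x y := by
  rw [← bil_eq, QuadraticMap.polar]; ring

lemma n_sub (x y : O.C) : O.n (x - y) = O.n x + O.n y - O.bil x y := by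
  rw [sub_eq_add_neg, n_add, QuadraticMap.map_neg, map_neg]; ring

lemma n_smul (a : F) (x : O.C) : O.n (a • x) = a * a * O.n x := by
  rw [QuadraticMap.map_smul, smul_eq_mul]

lemma bil_comm (x y : O.C) : O.bil x y = O.bil y x := QuadraticMap.polar_comm _ _ _

lemma bil_self (x : O.C) : O.bil x x = 2 * O.n x := by
  rw [← bil_eq, QuadraticMap.polar_self, two_smul, two_mul]

lemma conj_eq (x : O.C) : O.conj x = O.bil x 1 • (1 : O.C) - x := rfl

lemma eq_of_bil {x y : O.C} (h : ∀ z, O.bil x z = O.bil y z) : x = y := by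
  refine sub_eq_zero.1 (O.nondeg _ fun z => ?_)
  rw [bil_eq, map_sub, LinearMap.sub_apply, h z, sub_self]

lemma exists_bil_ne {x : O.C} (hx : x ≠ 0) : ∃ y, O.bil x y ≠ 0 := by
  by_contra! h
  exact hx (O.nondeg x h)

lemma bil_mul_left (x y z : O.C) : O.bil (x * y) (x * z) = O.n x * O.bil y z := by
  have h := O.n_mul x (y + z)
  rw [mul_add, n_add, n_add, O.n_mul, O.n_mul] at h
  linear_combination h

lemma bil_mul_right (x y z : O.C) : O.bil (x * z) (y * z) = O.bil x y * O.n z := by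
  have h := O.n_mul (x + y) z
  rw [add_mul, n_add, n_add, O.n_mul, O.n_mul] at h
  linear_combination h

lemma bil_mul_mul (x y z w : O.C) :
    O.bil (x * y) (z * w) + O.bil (x * w) (z * y) = O.bil x z * O.bil y w := by
  have h := O.bil_mul_left (x + z) y w
  simp only [add_mul, map_add, LinearMap.add_apply, n_add, bil_mul_left] at h
  rw [O.bil_comm (z * y)] at h
  linear_combination h

lemma bil_one_one : O.bil 1 1 = 2 := by rw [bil_self, O.n_one, mul_one]

lemma bil_mul_eq_left (x y z : O.C) : O.bil (x * y) z = O.bil y (O.conj x * z) := by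
  have h := O.bil_mul_mul x y 1 z
  rw [one_mul, one_mul] at h
  rw [conj_eq, sub_mul, map_sub, smul_mul_assoc, one_mul, map_smul, smul_eq_mul,
    O.bil_comm y (x * z)]
  linear_combination h

lemma bil_mul_eq_right (x y z : O.C) : O.bil (x * y) z = O.bil x (z * O.conj y) := by
  have h := O.bil_mul_mul x y z 1
  rw [mul_one, mul_one] at h
  rw [conj_eq, mul_sub, map_sub, mul_smul_comm, mul_one, map_smul, smul_eq_mul]
  linear_combination h

lemma bil_mul_one (x y : O.C) : O.bil (x * y) 1 = O.bil x (O.conj y) := by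
  rw [bil_mul_eq_right, one_mul]

lemma conj_one : O.conj 1 = 1 := by
  rw [conj_eq, bil_one_one]; module

lemma n_conj (x : O.C) : O.n (O.conj x) = O.n x := by
  rw [conj_eq, n_sub, n_smul, O.n_one, map_smul, LinearMap.smul_apply, O.bil_comm 1,
    smul_eq_mul]
  ring

lemma bil_conj_conj (x y : O.C) : O.bil (O.conj x) (O.conj y) = O.bil x y := by
  have h := O.n_conj (x + y)
  rw [map_add, n_add, n_add, n_conj, n_conj] at h
  linear_combination h

lemma bil_conj_left (x y : O.C) : O.bil (O.conj x) y = O.bil x (O.conj y) := by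
  rw [← bil_conj_conj, conj_conj]

lemma conj_mul (x y : O.C) : O.conj (x * y) = O.conj y * O.conj x := by
  refine O.eq_of_bil fun z => ?_
  rw [bil_conj_left, bil_mul_eq_left, ← bil_mul_eq_right, bil_mul_eq_left, O.bil_comm]

lemma conj_mul_mul (x y : O.C) : O.conj x * (x * y) = O.n x • y := by
  refine O.eq_of_bil fun z => ?_
  rw [O.bil_comm, ← bil_mul_eq_left, bil_mul_left, map_smul, LinearMap.smul_apply, smul_eq_mul,
    O.bil_comm]

lemma mul_mul_conj (x y : O.C) : (y * x) * O.conj x = O.n x • y := by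
  refine O.eq_of_bil fun z => ?_
  rw [O.bil_comm, ← bil_mul_eq_right, bil_mul_right, map_smul, LinearMap.smul_apply, smul_eq_mul,
    O.bil_comm, mul_comm]

lemma mul_conj_mul' (x y : O.C) : (y * O.conj x) * x = O.n x • y := by
  have h := O.mul_mul_conj (O.conj x) y
  rwa [conj_conj, n_conj] at h

lemma mul_conj_self (x : O.C) : x * O.conj x = O.n x • (1 : O.C) := by
  simpa using O.mul_mul_conj x 1

lemma conj_mul_self (x : O.C) : O.conj x * x = O.n x • (1 : O.C) := by
  simpa using O.mul_conj_mul' x 1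

lemma conj_mul_mul_add (x y z : O.C) :
    O.conj x * (y * z) + O.conj y * (x * z) = O.bil x y • z := by
  have h := O.conj_mul_mul (x + y) z
  simp only [map_add, add_mul, mul_add, n_add, conj_mul_mul] at h
  linear_combination (norm := module) h

/-- The middle Moufang identity. -/
lemma moufang (x y z : O.C) :
    (x * y) * (z * x) = O.bil x (O.conj (y * z)) • x - O.n x • O.conj (y * z) := by
  refine O.eq_of_bil fun w => ?_
  have h := O.bil_mul_mul z x (O.conj y * O.conj x) w
  rw [bil_mul_eq_left, conj_mul, conj_mul, map_sub, map_smul, map_smul, LinearMap.sub_apply,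
    LinearMap.smul_apply, LinearMap.smul_apply, smul_eq_mul, smul_eq_mul]
  have e1 : O.conj y * O.conj x * x = O.n x • O.conj y := O.mul_conj_mul' x _
  have e2 : O.bil z (O.conj y * O.conj x) = O.bil x (O.conj z * O.conj y) := by
    rw [O.bil_comm, bil_mul_eq_right, conj_conj, O.bil_comm x, bil_mul_eq_left, conj_conj]
  have e3 : O.bil (z * w) (O.conj y) = O.bil (O.conj z * O.conj y) w := by
    rw [bil_mul_eq_left, bil_comm]
  rw [e1, e2, map_smul, smul_eq_mul, e3] at h
  linear_combination h

end OctonionAlgebra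

/-- A symmetric function of four variables, additive in each, that vanishes on the diagonal is
zero away from characteristics 2 and 3. -/
lemma eq_zero_of_diagonal {F M V : Type*} [Field F] [AddCommGroup M] [AddCommGroup V] [Module F V]
    (h2 : (2 : F) ≠ 0) (h3 : (3 : F) ≠ 0) (G : M → M → M → M → V)
    (hadd : ∀ x x' y z w, G (x + x') y z w = G x y z w + G x' y z w)
    (h12 : ∀ x y z w, G x y z w = G y x z w) (h23 : ∀ x y z w, G x y z w = G x z y w)
    (h34 : ∀ x y z w, G x y z w = G x y w z) (h : ∀ x, G x x x x = 0) (x y z w : M) :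
    G x y z w = 0 := by
  have hadd2 : ∀ x x' y z w, G y (x + x') z w = G y x z w + G y x' z w := fun x x' y z w => by
    rw [h12, hadd, h12 x, h12 x']
  have hadd3 : ∀ x x' y z w, G y z (x + x') w = G y z x w + G y z x' w := fun x x' y z w => by
    rw [h23, hadd2, h23 y x, h23 y x']
  have hadd4 : ∀ x x' y z w, G y z w (x + x') = G y z w x + G y z w x' := fun x x' y z w => by
    rw [h34, hadd3, h34 y z x, h34 y z x']
  have hneg : ∀ x y z w, G (-x) y z w = -G x y z w := fun x y z w => by
    have h0 : G 0 y z w = 0 := by simpa using hadd 0 0 y z w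
    have := hadd x (-x) y z w
    rw [add_neg_cancel, h0] at this
    exact (neg_eq_of_add_eq_zero_right this.symm).symm
  have hneg2 : ∀ x y z w, G y (-x) z w = -G y x z w := fun x y z w => by
    rw [h12, hneg, h12]
  have hneg3 : ∀ x y z w, G y z (-x) w = -G y z x w := fun x y z w => by
    rw [h23, hneg2, h23]
  have hneg4 : ∀ x y z w, G y z w (-x) = -G y z w x := fun x y z w => by
    rw [h34, hneg3, h34]
  have key : ∀ x y, G x x y y = 0 := fun x y => by
    have e1 := h (x + y)
    have e2 := h (x + -y)
    simp only [hadd, hadd2, hadd3, hadd4, hneg, hneg2, hneg3, hneg4, h] at e1 e2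
    have a1 : G x y x y = G x x y y := h23 _ _ _ _
    have a2 : G x y y x = G x x y y := by rw [h34, a1]
    have a3 : G y x x y = G x x y y := by rw [h12, a1]
    have a4 : G y x y x = G x x y y := by rw [h12, a2]
    have a5 : G y y x x = G x x y y := by rw [h23, a4]
    rw [a1, a2, a3, a4, a5] at e1 e2
    have h12' : (12 : F) • G x x y y = 0 := by
      linear_combination (norm := module) e1 + e2
    refine (smul_eq_zero.1 h12').resolve_left ?_
    rw [show (12 : F) = 2 * 2 * 3 by norm_num]
    exact mul_ne_zero (mul_ne_zero h2 h2) h3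
  have key2 : ∀ x y z, G x x y z = 0 := fun x y z => by
    have e := key x (y + z)
    rw [hadd3, hadd4, hadd4, key, key, h34 x x z y] at e
    exact (smul_eq_zero.1 (by linear_combination (norm := module) e :
      (2 : F) • G x x y z = 0)).resolve_left h2
  have e := key2 (x + y) z w
  rw [hadd, hadd2, hadd2, key2, key2, h12 y x] at e
  exact (smul_eq_zero.1 (by linear_combination (norm := module) e :
    (2 : F) • G x y z w = 0)).resolve_left h2

/-- A cubic norm structure away from characteristics 2 and 3, given by its trace form `T` and its
cross product `cr`. -/
structure CubicNorm (F : Type u) (J : Type v) [Field F] [AddCommGroup J] [Module F J] where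
  T : J →ₗ[F] J →ₗ[F] F
  cr : J →ₗ[F] J →ₗ[F] J
  two_ne : (2 : F) ≠ 0
  three_ne : (3 : F) ≠ 0
  T_comm : ∀ x y, T x y = T y x
  cr_comm : ∀ x y, cr x y = cr y x
  T_cr : ∀ x y z, T (cr x y) z = T x (cr y z)
  adjoint_diag : ∀ x, (3 : F) • cr (cr x x) (cr x x) = (4 * T (cr x x) x) • x
  nondeg : ∀ x, (∀ y, T x y = 0) → x = 0
  exists_ne : ∃ x, T (cr x x) x ≠ 0

namespace CubicNorm

variable {F : Type u} {J : Type v} [Field F] [AddCommGroup J] [Module F J] (A : CubicNorm F J)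

omit [AddCommGroup J] [Module F J] in
lemma cancel {V : Type*} [AddCommGroup V] [Module F V] {a : F} (ha : a ≠ 0) {x y : V}
    (h : a • x = a • y) : x = y := smul_right_injective V ha h

/-- The adjoint. -/
def sharp (x : J) : J := (2 : F)⁻¹ • A.cr x x

/-- The cubic norm. -/
def N (x : J) : F := (3 : F)⁻¹ * A.T (A.sharp x) x

lemma cr_self (x : J) : A.cr x x = (2 : F) • A.sharp x := by
  rw [sharp, smul_smul, mul_inv_cancel₀ A.two_ne, one_smul]

lemma T_sharp_self (x : J) : A.T (A.sharp x) x = 3 * A.N x := by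
  rw [N, ← mul_assoc, mul_inv_cancel₀ A.three_ne, one_mul]

lemma T_self_sharp (x : J) : A.T x (A.sharp x) = 3 * A.N x := by
  rw [A.T_comm, T_sharp_self]

lemma T_cr_left (x y z : J) : A.T (A.cr x y) z = A.T y (A.cr x z) := by
  rw [A.cr_comm, A.T_cr]

lemma T_cr_swap (x y z : J) : A.T (A.cr x y) z = A.T (A.cr x z) y := by
  rw [A.T_cr, A.cr_comm y, ← A.T_cr]

lemma T_cr_self (x y : J) : A.T (A.cr x y) x = 2 * A.T (A.sharp x) y := by
  rw [A.T_cr_left, A.cr_self, map_smul, smul_eq_mul, A.T_comm]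

lemma sharp_add (x y : J) : A.sharp (x + y) = A.sharp x + A.sharp y + A.cr x y := by
  apply cancel A.two_ne
  simp only [smul_add, ← cr_self, map_add, LinearMap.add_apply, A.cr_comm y x]
  module

lemma sharp_smul (a : F) (x : J) : A.sharp (a • x) = (a * a) • A.sharp x := by
  simp only [sharp, map_smul, LinearMap.smul_apply]; module

lemma sharp_zero : A.sharp 0 = 0 := by simp [sharp]

lemma sharp_neg (x : J) : A.sharp (-x) = A.sharp x := by
  simp [sharp]

lemma N_smul (a : F) (x : J) : A.N (a • x) = a ^ 3 * A.N x := by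
  simp only [N, sharp_smul, map_smul, LinearMap.smul_apply, smul_eq_mul]; ring

lemma N_neg (x : J) : A.N (-x) = -A.N x := by
  simp [N, sharp_neg]

lemma N_add (x y : J) :
    A.N (x + y) = A.N x + A.T (A.sharp x) y + A.T (A.sharp y) x + A.N y := by
  apply mul_left_cancel₀ A.three_ne
  rw [← T_sharp_self, sharp_add]
  simp only [map_add, LinearMap.add_apply, T_sharp_self, T_cr_self]
  rw [A.cr_comm, T_cr_self]
  ring

/-- The linearized adjoint identity. -/
lemma adjoint_four (x y z w : J) :
    A.cr (A.cr x y) (A.cr z w) + A.cr (A.cr x z) (A.cr y w) + A.cr (A.cr x w) (A.cr y z)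
      = A.T (A.cr x y) z • w + A.T (A.cr x y) w • z + A.T (A.cr x z) w • y
        + A.T (A.cr y z) w • x := by
  rw [← sub_eq_zero]
  refine eq_zero_of_diagonal A.two_ne A.three_ne (fun x y z w =>
    A.cr (A.cr x y) (A.cr z w) + A.cr (A.cr x z) (A.cr y w) + A.cr (A.cr x w) (A.cr y z)
      - (A.T (A.cr x y) z • w + A.T (A.cr x y) w • z + A.T (A.cr x z) w • y
        + A.T (A.cr y z) w • x)) ?_ ?_ ?_ ?_ ?_ x y z w
  · intro x x' y z w
    simp only [map_add, LinearMap.add_apply]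
    module
  · intro x y z w
    simp only [A.cr_comm y x, A.cr_comm (A.cr y z), A.cr_comm (A.cr y w)]
    module
  · intro x y z w
    rw [A.cr_comm z y, A.T_cr_swap x z y]
    module
  · intro x y z w
    simp only [A.cr_comm w z]
    rw [A.T_cr_swap x w z, A.T_cr_swap y w z]
    module
  · intro x
    have h := A.adjoint_diag x
    linear_combination (norm := module) h

lemma sharp_cr_cr (x y z : J) :
    A.cr (A.sharp x) (A.cr y z) + A.cr (A.cr x y) (A.cr x z)
      = A.T (A.sharp x) y • z + A.T (A.sharp x) z • y + A.T (A.cr x y) z • x := by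
  have h := A.adjoint_four x x y z
  simp only [cr_self, map_smul, LinearMap.smul_apply, smul_eq_mul, A.cr_comm (A.cr x z)] at h
  apply cancel A.two_ne
  linear_combination (norm := module) h

lemma sharp_cr_self (x y : J) :
    A.cr (A.sharp x) (A.cr x y) = A.N x • y + A.T (A.sharp x) y • x := by
  have h := A.sharp_cr_cr x x y
  simp only [cr_self, map_smul, LinearMap.smul_apply, smul_eq_mul, T_sharp_self] at h
  apply cancel A.three_ne
  linear_combination (norm := module) h

lemma sharp_sharp (x : J) : A.sharp (A.sharp x) = A.N x • x := by
  have h := A.sharp_cr_self x x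
  simp only [cr_self, map_smul, T_sharp_self] at h
  apply cancel A.two_ne
  apply cancel A.two_ne
  linear_combination (norm := module) h

lemma sharp_cr (x y : J) :
    A.sharp (A.cr x y) = A.T (A.sharp x) y • y + A.T (A.sharp y) x • x
      - A.cr (A.sharp x) (A.sharp y) := by
  have h := A.sharp_cr_cr x y y
  rw [A.cr_comm x, A.T_cr_self] at h
  simp only [cr_self, map_smul] at h
  rw [A.cr_comm x]
  apply cancel A.two_ne
  linear_combination (norm := module) h

lemma N_sharp (x : J) : A.N (A.sharp x) = A.N x ^ 2 := by
  apply mul_left_cancel₀ A.three_ne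
  rw [← T_sharp_self, sharp_sharp, map_smul, LinearMap.smul_apply, T_self_sharp, smul_eq_mul]
  ring

lemma cr_cr_four (x y z w : J) :
    A.cr x (A.cr (A.cr y z) w) + A.cr y (A.cr (A.cr x z) w) + A.cr z (A.cr (A.cr x y) w)
      = A.T (A.cr x y) z • w + A.T x w • A.cr y z + A.T y w • A.cr x z
        + A.T z w • A.cr x y := by
  rw [← sub_eq_zero]
  refine A.nondeg _ fun v => ?_
  have h := congrArg (A.T w) (A.adjoint_four x y z v)
  simp only [map_add, map_smul, smul_eq_mul] at h
  simp only [map_add, map_sub, map_smul, LinearMap.add_apply, LinearMap.sub_apply,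
    LinearMap.smul_apply, smul_eq_mul]
  have e : ∀ a b c, A.T (A.cr a (A.cr b w)) c = A.T w (A.cr b (A.cr a c)) := fun a b c => by
    rw [A.T_cr_left, A.T_cr_left]
  rw [e, e, e, A.T_comm x w, A.T_comm y w, A.T_comm z w, A.cr_comm (A.cr y z)]
  rw [A.cr_comm (A.cr x z) (A.cr y v)] at h
  rw [A.cr_comm (A.cr x z) (A.cr y v)]
  linear_combination h

lemma cr_sharp_cr (x y : J) :
    A.cr x (A.cr (A.sharp x) y) = A.N x • y + A.T x y • A.sharp x := by
  have h := A.cr_cr_four x x x y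
  simp only [cr_self, map_smul, LinearMap.smul_apply, smul_eq_mul, T_sharp_self] at h
  apply cancel A.three_ne
  apply cancel A.two_ne
  linear_combination (norm := module) h

lemma cr_cr_of_sharp_eq_zero {d : J} (hd : A.sharp d = 0) (z w : J) :
    A.cr d (A.cr (A.cr d z) w) = A.T d w • A.cr d z := by
  have h := A.cr_cr_four d d z w
  simp only [cr_self, hd, smul_zero, map_zero, LinearMap.zero_apply] at h
  apply cancel A.two_ne
  linear_combination (norm := module) h

lemma N_cr (x y : J) :
    A.N (A.cr x y) = A.T (A.sharp x) y * A.T (A.sharp y) x - A.N x * A.N y := by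
  apply mul_left_cancel₀ A.three_ne
  rw [← T_sharp_self, sharp_cr]
  simp only [map_add, map_sub, map_smul, LinearMap.add_apply, LinearMap.sub_apply,
    LinearMap.smul_apply, smul_eq_mul]
  have e : A.T (A.cr (A.sharp x) (A.sharp y)) (A.cr x y)
      = 3 * (A.N x * A.N y) + A.T (A.sharp x) y * A.T (A.sharp y) x := by
    rw [A.T_cr_left, sharp_cr_self, map_add, map_smul, map_smul, T_sharp_self, smul_eq_mul,
      smul_eq_mul]
    ring
  rw [e, A.T_comm y, A.T_comm x, A.T_cr_self, A.cr_comm x, A.T_cr_self]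
  ring

end CubicNorm

namespace CubicNorm

variable {F : Type u} {J : Type v} [Field F] [AddCommGroup J] [Module F J] (A : CubicNorm F J)

lemma exists_T_ne {x : J} (hx : x ≠ 0) : ∃ y, A.T x y ≠ 0 := by
  by_contra! h
  exact hx (A.nondeg x h)

lemma exists_T_sharp_ne {d : J} (hd : d ≠ 0) : ∃ k, A.T d (A.sharp k) ≠ 0 := by
  by_contra! h
  have h1 : ∀ x y, A.T d (A.cr x y) = 0 := fun x y => by
    have := h (x + y)
    rwa [sharp_add, map_add, map_add, h, h, add_zero, zero_add] at this
  have h2 : ∀ x, A.cr d x = 0 := fun x => A.nondeg _ fun y => by rw [A.T_cr, h1]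
  have h3 : ∀ x, A.cr x d = 0 := fun x => by rw [A.cr_comm, h2]
  obtain ⟨x, hx⟩ := A.exists_ne
  have h4 := A.adjoint_four x x x d
  simp only [h3, map_zero, LinearMap.zero_apply, A.T_comm _ d, h1, zero_smul, add_zero] at h4
  exact (smul_ne_zero hx hd) h4.symm

lemma exists_linear_mul_quadratic_ne [Infinite F] (a b c d e : F) (ha : a ≠ 0 ∨ b ≠ 0)
    (he : e ≠ 0) : ∃ s, (a + s * b) * (c + s * d + s * s * e) ≠ 0 := by
  classical
  by_contra! h
  let p : Polynomial F := .C a + .C b * .X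
  let q : Polynomial F := .C e * .X ^ 2 + .C d * .X + .C c
  have hpq : p * q = 0 := Polynomial.funext fun s => by
    have := h s
    simp only [p, q, Polynomial.eval_mul, Polynomial.eval_add, Polynomial.eval_C,
      Polynomial.eval_X, Polynomial.eval_pow, Polynomial.eval_zero]
    linear_combination this
  rcases mul_eq_zero.1 hpq with h1 | h1
  · have c0 := congrArg (fun r => Polynomial.coeff r 0) h1
    have c1 := congrArg (fun r => Polynomial.coeff r 1) h1
    simp [p, Polynomial.coeff_C] at c0 c1
    tauto
  · have c2 := congrArg (fun r => Polynomial.coeff r 2) h1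
    simp [q] at c2
    exact he c2

/-- An element of norm zero whose cross products all have norm zero has rank at most one. -/
lemma sharp_eq_zero_of_N_cr [Infinite F] {j : J} (hj : A.N j = 0)
    (h : ∀ k, A.N (A.cr j k) = 0) : A.sharp j = 0 := by
  by_contra hs
  have hj0 : j ≠ 0 := by
    rintro rfl
    exact hs A.sharp_zero
  obtain ⟨k, hk⟩ := A.exists_T_ne hs
  obtain ⟨l, hl⟩ := A.exists_T_sharp_ne hj0
  obtain ⟨s, hs'⟩ := exists_linear_mul_quadratic_ne (A.T (A.sharp j) k) (A.T (A.sharp j) l)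
    (A.T j (A.sharp k)) (A.T j (A.cr k l)) (A.T j (A.sharp l)) (Or.inl hk) hl
  apply hs'
  have := h (k + s • l)
  rw [N_cr, hj, zero_mul, sub_zero, A.T_comm _ j, sharp_add, sharp_smul] at this
  simp only [map_add, map_smul, smul_eq_mul] at this
  linear_combination this

lemma mem_range_cr {d v : J} (hd0 : d ≠ 0) (hd : A.sharp d = 0)
    (h : ∀ k, ∃ c : F, A.cr v (A.cr d k) = c • d) : ∃ k, v = A.cr d k := by
  have hdd : A.cr d d = 0 := by rw [cr_self, hd, smul_zero]
  obtain ⟨k, hk⟩ := A.exists_T_sharp_ne hd0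
  have hvd : A.T v d = 0 := by
    rw [A.T_comm]
    obtain ⟨c, hc⟩ := h k
    have h1 := A.cr_cr_of_sharp_eq_zero hd k v
    rw [A.cr_comm _ v, hc, map_smul, hdd, smul_zero] at h1
    refine (smul_eq_zero.1 h1.symm).resolve_right fun h0 => hk ?_
    have h2 := A.T_cr_self k d
    rw [A.cr_comm, h0, map_zero, LinearMap.zero_apply] at h2
    rw [A.T_comm]
    exact (mul_eq_zero.1 h2.symm).resolve_left A.two_ne
  have key : ∀ y, A.cr d y = 0 → A.T v y = 0 := fun y hy => by
    have h1 := A.adjoint_four d k y k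
    rw [hy, map_zero, LinearMap.zero_apply, A.T_cr_swap d k y, hy, map_zero,
      LinearMap.zero_apply, A.T_cr_swap d k k, A.T_cr_self k y, A.cr_comm k y,
      A.cr_comm d k, A.T_cr_self k d] at h1
    obtain ⟨c, hc⟩ := h k
    have h2 := congrArg (A.T v) h1
    rw [A.cr_comm k d] at h2
    simp only [map_add, map_smul, smul_eq_mul, ← A.T_cr v, hc, LinearMap.smul_apply, hvd,
      map_zero] at h2
    rw [← A.T_cr, hy, map_zero, LinearMap.zero_apply, A.T_comm _ d] at h2
    have h3 : (2 * A.T d (A.sharp k)) * A.T v y = 0 := by linear_combination -h2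
    exact (mul_eq_zero.1 h3).resolve_left (mul_ne_zero A.two_ne hk)
  obtain ⟨f, hf⟩ := A.exists_T_ne hd0
  refine ⟨(A.T d f)⁻¹ • A.cr f v, ?_⟩
  rw [← sub_eq_zero]
  refine A.nondeg _ fun z => ?_
  have h1 := key (z - (A.T d f)⁻¹ • A.cr f (A.cr d z)) (by
    rw [map_sub, map_smul, A.cr_comm f, A.cr_cr_of_sharp_eq_zero hd, smul_smul,
      inv_mul_cancel₀ hf, one_smul, sub_self])
  rw [map_sub, map_smul] at h1
  rw [map_sub, map_smul, map_smul, LinearMap.sub_apply, LinearMap.smul_apply, A.T_cr_left,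
    A.T_cr_left, ← h1]

/-- The `U`-operator. -/
def U (x : J) : J →ₗ[F] J := (A.T x).smulRight x - A.cr (A.sharp x)

lemma U_apply (x z : J) : A.U x z = A.T x z • x - A.cr (A.sharp x) z := rfl

lemma sharp_U (x z : J) : A.sharp (A.U x z) = A.U (A.sharp x) (A.sharp z) := by
  rw [U_apply, U_apply, sub_eq_add_neg, sharp_add, sharp_neg, sharp_smul, sharp_cr, sharp_sharp]
  simp only [map_smul, map_neg, LinearMap.smul_apply, smul_eq_mul, cr_sharp_cr,
    A.T_comm _ (A.sharp x)]
  module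

lemma U_sharp_U (x z : J) : A.U (A.sharp x) (A.U x z) = (A.N x ^ 2) • z := by
  rw [U_apply, U_apply, sharp_sharp]
  simp only [map_smul, map_sub, LinearMap.smul_apply, smul_eq_mul, cr_sharp_cr, cr_self,
    T_sharp_self]
  rw [A.T_comm (A.sharp x) (A.cr _ _), A.T_cr_swap, A.cr_self, sharp_sharp, map_smul, map_smul,
    LinearMap.smul_apply, LinearMap.smul_apply, smul_eq_mul, smul_eq_mul]
  module

lemma cr_U (x y z : J) : A.cr (A.U x y) (A.U x z) = A.U (A.sharp x) (A.cr y z) := by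
  have h := A.sharp_U x (y + z)
  rw [map_add, sharp_add, sharp_add, map_add, map_add, sharp_U, sharp_U] at h
  exact add_left_cancel h

lemma T_U (x y z : J) : A.T (A.U x y) z = A.T y (A.U x z) := by
  simp only [U_apply, map_sub, map_smul, LinearMap.sub_apply, LinearMap.smul_apply, smul_eq_mul,
    A.T_cr_left, A.T_comm y x]
  ring

end CubicNorm

namespace CubicNorm

variable {F : Type u} {J : Type v} [Field F] [AddCommGroup J] [Module F J] (A : CubicNorm F J)

/-- The alternating form of the Freudenthal triple system on `F × J × J × F`. -/
def form (x y : F × J × J × F) : F :=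
  x.1 * y.2.2.2 - x.2.2.2 * y.1 + A.T x.2.1 y.2.2.1 - A.T y.2.1 x.2.2.1

/-- The triple product of the Freudenthal triple system on `F × J × J × F`. -/
def triple (x y z : F × J × J × F) : F × J × J × F :=
  (-2 * (x.1 * y.1 * z.2.2.2 + x.1 * z.1 * y.2.2.2 + y.1 * z.1 * x.2.2.2)
      + x.1 * (A.T y.2.1 z.2.2.1 + A.T z.2.1 y.2.2.1)
      + y.1 * (A.T x.2.1 z.2.2.1 + A.T z.2.1 x.2.2.1)
      + z.1 * (A.T x.2.1 y.2.2.1 + A.T y.2.1 x.2.2.1)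
      - 2 * A.T (A.cr x.2.2.1 y.2.2.1) z.2.2.1,
    (y.1 * z.2.2.2 + z.1 * y.2.2.2 - A.T y.2.1 z.2.2.1 - A.T z.2.1 y.2.2.1) • x.2.1
      + (x.1 * z.2.2.2 + z.1 * x.2.2.2 - A.T x.2.1 z.2.2.1 - A.T z.2.1 x.2.2.1) • y.2.1
      + (x.1 * y.2.2.2 + y.1 * x.2.2.2 - A.T x.2.1 y.2.2.1 - A.T y.2.1 x.2.2.1) • z.2.1
      - (2 : F) • (x.2.2.2 • A.cr y.2.2.1 z.2.2.1 + y.2.2.2 • A.cr x.2.2.1 z.2.2.1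
        + z.2.2.2 • A.cr x.2.2.1 y.2.2.1)
      + (2 : F) • (A.cr x.2.2.1 (A.cr y.2.1 z.2.1) + A.cr y.2.2.1 (A.cr x.2.1 z.2.1)
        + A.cr z.2.2.1 (A.cr x.2.1 y.2.1)),
    -((y.1 * z.2.2.2 + z.1 * y.2.2.2 - A.T y.2.1 z.2.2.1 - A.T z.2.1 y.2.2.1) • x.2.2.1
      + (x.1 * z.2.2.2 + z.1 * x.2.2.2 - A.T x.2.1 z.2.2.1 - A.T z.2.1 x.2.2.1) • y.2.2.1
      + (x.1 * y.2.2.2 + y.1 * x.2.2.2 - A.T x.2.1 y.2.2.1 - A.T y.2.1 x.2.2.1) • z.2.2.1)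
      + (2 : F) • (x.1 • A.cr y.2.1 z.2.1 + y.1 • A.cr x.2.1 z.2.1 + z.1 • A.cr x.2.1 y.2.1)
      - (2 : F) • (A.cr x.2.1 (A.cr y.2.2.1 z.2.2.1) + A.cr y.2.1 (A.cr x.2.2.1 z.2.2.1)
        + A.cr z.2.1 (A.cr x.2.2.1 y.2.2.1)),
    2 * (x.2.2.2 * y.2.2.2 * z.1 + x.2.2.2 * z.2.2.2 * y.1 + y.2.2.2 * z.2.2.2 * x.1)
      - x.2.2.2 * (A.T y.2.1 z.2.2.1 + A.T z.2.1 y.2.2.1)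
      - y.2.2.2 * (A.T x.2.1 z.2.2.1 + A.T z.2.1 x.2.2.1)
      - z.2.2.2 * (A.T x.2.1 y.2.2.1 + A.T y.2.1 x.2.2.1)
      + 2 * A.T (A.cr x.2.1 y.2.1) z.2.1)

/-- The quartic form of the Freudenthal triple system on `F × J × J × F`. -/
def quartic (x : F × J × J × F) : F :=
  (x.1 * x.2.2.2 - A.T x.2.1 x.2.2.1) ^ 2 + 4 * x.1 * A.N x.2.1 + 4 * x.2.2.2 * A.N x.2.2.1
    - 4 * A.T (A.sharp x.2.1) (A.sharp x.2.2.1)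

lemma triple_comm_left (x y z : F × J × J × F) : A.triple x y z = A.triple y x z := by
  simp only [triple, A.cr_comm y.2.1 x.2.1, A.cr_comm y.2.2.1 x.2.2.1, Prod.mk.injEq]
  refine ⟨by ring, by module, by module, by ring⟩

lemma triple_comm_right (x y z : F × J × J × F) : A.triple x y z = A.triple x z y := by
  simp only [triple, A.cr_comm z.2.1 y.2.1, A.cr_comm z.2.2.1 y.2.2.1, Prod.mk.injEq,
    A.T_cr_swap _ z.2.1 y.2.1, A.T_cr_swap _ z.2.2.1 y.2.2.1]
  refine ⟨by ring, by module, by module, by ring⟩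

lemma triple_add (x x' y z : F × J × J × F) :
    A.triple (x + x') y z = A.triple x y z + A.triple x' y z := by
  simp only [triple, Prod.fst_add, Prod.snd_add, map_add, LinearMap.add_apply, Prod.mk_add_mk,
    Prod.mk.injEq]
  refine ⟨by ring, by module, by module, by ring⟩

lemma form_add_left (x y z : F × J × J × F) :
    A.form (x + y) z = A.form x z + A.form y z := by
  simp only [form, Prod.fst_add, Prod.snd_add, map_add, LinearMap.add_apply]
  ring

lemma form_sub_right (x y z : F × J × J × F) :
    A.form x (y - z) = A.form x y - A.form x z := by
  simp only [form, Prod.fst_sub, Prod.snd_sub, map_sub, LinearMap.sub_apply]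
  ring

lemma eq_of_form {x y : F × J × J × F} (h : ∀ w, A.form w x = A.form w y) : x = y := by
  rw [← sub_eq_zero]
  have h' : ∀ w, A.form w (x - y) = 0 := fun w => by rw [form_sub_right, h, sub_self]
  generalize x - y = z at h'
  obtain ⟨α, j, k, β⟩ := z
  have hj : j = 0 := A.nondeg j fun l => by simpa [form] using h' (0, 0, l, 0)
  have hk : k = 0 := A.nondeg k fun l => by simpa [form, A.T_comm] using h' (0, l, 0, 0)
  have hβ : β = 0 := by simpa [form] using h' (1, 0, 0, 0)
  have hα : α = 0 := by simpa [form] using h' (0, 0, 0, 1)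
  simp [hj, hk, hα, hβ]

lemma form_triple_comm (w x y z : F × J × J × F) :
    A.form w (A.triple x y z) = A.form x (A.triple w y z) := by
  obtain ⟨α0, j0, k0, β0⟩ := w
  obtain ⟨α1, j1, k1, β1⟩ := x
  obtain ⟨α2, j2, k2, β2⟩ := y
  obtain ⟨α3, j3, k3, β3⟩ := z
  have e1 : ∀ a X, A.T j0 (A.cr a X) = A.T (A.cr j0 a) X := fun a X => (A.T_cr _ _ _).symm
  have e2 : ∀ X, A.T j1 (A.cr j0 X) = A.T (A.cr j0 j1) X := fun X => (A.T_cr_left _ _ _).symm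
  have e3 : ∀ X, A.T j1 (A.cr j2 X) = A.T (A.cr j1 j2) X := fun X => (A.T_cr _ _ _).symm
  have e4 : ∀ X, A.T j1 (A.cr j3 X) = A.T (A.cr j1 j3) X := fun X => (A.T_cr _ _ _).symm
  have f1 : ∀ a X, A.T (A.cr a X) k0 = A.T X (A.cr k0 a) := fun a X => by
    rw [A.T_cr_left, A.cr_comm]
  have f2 : ∀ X, A.T (A.cr k0 X) k1 = A.T X (A.cr k0 k1) := fun X => A.T_cr_left _ _ _
  have f3 : ∀ X, A.T (A.cr k2 X) k1 = A.T X (A.cr k1 k2) := fun X => by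
    rw [A.T_cr_left, A.cr_comm]
  have f4 : ∀ X, A.T (A.cr k3 X) k1 = A.T X (A.cr k1 k3) := fun X => by
    rw [A.T_cr_left, A.cr_comm]
  have f5 : A.T (A.cr k1 k2) k3 = A.T k3 (A.cr k1 k2) := A.T_comm _ _
  have f6 : A.T (A.cr k0 k2) k3 = A.T k3 (A.cr k0 k2) := A.T_comm _ _
  simp only [form, triple, map_add, map_sub, map_neg, map_smul, LinearMap.add_apply,
    LinearMap.sub_apply, LinearMap.smul_apply, smul_eq_mul, e1, e2, e3, e4, f1, f2,
    f3, f4, f5, f6]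
  ring

lemma form_triple_self (x : F × J × J × F) : A.form x (A.triple x x x) = 12 * A.quartic x := by
  obtain ⟨α, j, k, β⟩ := x
  simp only [form, triple, quartic, map_add, map_sub, map_neg, map_smul, LinearMap.add_apply,
    LinearMap.sub_apply, LinearMap.smul_apply, smul_eq_mul, cr_self, T_sharp_self, T_self_sharp]
  rw [A.T_comm j (A.cr j _), A.T_cr_self, A.T_cr_self, A.T_comm (A.sharp k)]
  ring

/-- Isometries of the Freudenthal triple system on `F × J × J × F`. -/
def IsIsometry (f : (F × J × J × F) ≃ₗ[F] (F × J × J × F)) : Prop :=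
  (∀ x y, A.form (f x) (f y) = A.form x y) ∧
    ∀ x y z, A.triple (f x) (f y) (f z) = f (A.triple x y z)

lemma IsIsometry.trans {A : CubicNorm F J} {f g : (F × J × J × F) ≃ₗ[F] (F × J × J × F)}
    (hf : A.IsIsometry f) (hg : A.IsIsometry g) : A.IsIsometry (f.trans g) :=
  ⟨fun x y => by simp [hf.1, hg.1], fun x y z => by simp [hf.2, hg.2]⟩

lemma isIsometry_of_quartic (f : (F × J × J × F) ≃ₗ[F] (F × J × J × F))
    (h : ∀ x y, A.form (f x) (f y) = A.form x y) (hq : ∀ x, A.quartic (f x) = A.quartic x) :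
    A.IsIsometry f := by
  refine ⟨h, fun x y z => A.eq_of_form fun w' => ?_⟩
  obtain ⟨w, rfl⟩ := f.surjective w'
  rw [h, ← sub_eq_zero]
  refine eq_zero_of_diagonal A.two_ne A.three_ne (fun w x y z =>
    A.form (f w) (A.triple (f x) (f y) (f z)) - A.form w (A.triple x y z)) ?_ ?_ ?_ ?_ ?_ w x y z
  · intro x x' y z w
    simp only [map_add, form_add_left]
    ring
  · intro x y z w
    simp only [A.form_triple_comm (f x), A.form_triple_comm x]
  · intro x y z w
    simp only [A.triple_comm_left (f y), A.triple_comm_left y]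
  · intro x y z w
    simp only [A.triple_comm_right _ (f z), A.triple_comm_right _ z]
  · intro x
    simp only [form_triple_self, hq, sub_self]

end CubicNorm

namespace CubicNorm

variable {F : Type u} {J : Type v} [Field F] [AddCommGroup J] [Module F J] (A : CubicNorm F J)

/-- The underlying linear map of `shift`. -/
def shiftMap (c : J) : (F × J × J × F) →ₗ[F] (F × J × J × F) where
  toFun x := (x.1 + A.T c x.2.2.1 + A.T (A.sharp c) x.2.1 + x.2.2.2 * A.N c,
    x.2.1 + x.2.2.2 • c, x.2.2.1 + A.cr c x.2.1 + x.2.2.2 • A.sharp c, x.2.2.2)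
  map_add' x y := by
    simp only [Prod.fst_add, Prod.snd_add, map_add, Prod.mk_add_mk, Prod.mk.injEq, and_true]
    refine ⟨by ring, by module, by module⟩
  map_smul' a x := by
    simp only [Prod.smul_fst, Prod.smul_snd, map_smul, smul_eq_mul, Prod.smul_mk, Prod.mk.injEq,
      and_true, RingHom.id_apply]
    refine ⟨by ring, by module, by module⟩

lemma shiftMap_neg (c : J) (x : F × J × J × F) : A.shiftMap (-c) (A.shiftMap c x) = x := by
  obtain ⟨α, j, k, β⟩ := x
  simp only [shiftMap, LinearMap.coe_mk, AddHom.coe_mk, map_add, map_neg, map_smul,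
    LinearMap.neg_apply, sharp_neg, N_neg, cr_self, T_sharp_self, T_self_sharp, smul_eq_mul,
    Prod.mk.injEq, and_true]
  refine ⟨?_, by module, by module⟩
  rw [A.T_comm c (A.cr c j), A.T_cr_self]
  ring

/-- The translation isometries of the Freudenthal triple system. -/
def shift (c : J) : (F × J × J × F) ≃ₗ[F] (F × J × J × F) :=
  LinearEquiv.ofLinearMap (A.shiftMap c) (A.shiftMap (-c))
    (LinearMap.ext fun x => by simpa using A.shiftMap_neg (-c) x)
    (LinearMap.ext fun x => A.shiftMap_neg c x)

lemma shift_apply (c : J) (α : F) (j k : J) (β : F) :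
    A.shift c (α, j, k, β) = (α + A.T c k + A.T (A.sharp c) j + β * A.N c, j + β • c,
      k + A.cr c j + β • A.sharp c, β) := rfl

lemma isIsometry_shift (c : J) : A.IsIsometry (A.shift c) := by
  refine A.isIsometry_of_quartic _ ?_ ?_
  · rintro ⟨α, j, k, β⟩ ⟨α', j', k', β'⟩
    simp only [form, shift_apply, map_add, map_smul, LinearMap.add_apply, LinearMap.smul_apply,
      smul_eq_mul, T_self_sharp]
    rw [A.T_comm c (A.cr c j), A.T_cr_self, A.T_comm c (A.cr c j'), A.T_cr_self,
      A.T_comm j (A.cr c j'), A.T_cr_swap c j' j, A.T_comm j' (A.cr c j), A.T_comm j (A.sharp c),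
      A.T_comm j' (A.sharp c)]
    ring
  · rintro ⟨α, j, k, β⟩
    have s1 : ∀ x, A.T (A.sharp j) (A.cr x (A.cr c j))
        = A.N j * A.T c x + A.T (A.sharp j) c * A.T j x := fun x => by
      rw [A.T_comm, A.T_cr, A.T_comm, A.cr_comm _ (A.sharp j), A.cr_comm c j, sharp_cr_self]
      simp
    have s2 : ∀ x, A.T (A.cr c j) (A.cr x (A.sharp c))
        = A.N c * A.T j x + A.T (A.sharp c) j * A.T c x := fun x => by
      rw [A.T_comm, A.T_cr, A.T_comm, sharp_cr_self]
      simp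
    have s3 : ∀ x y, A.T x (A.cr y x) = 2 * A.T (A.sharp x) y := fun x y => by
      rw [A.T_comm, A.cr_comm, T_cr_self]
    have s4 : A.T (A.sharp c) (A.cr k (A.cr c j)) = A.T (A.cr c j) (A.cr k (A.sharp c)) := by
      rw [A.T_comm, A.cr_comm k, A.T_cr]
    have s5 : A.T (A.sharp j) (A.cr (A.cr c j) (A.sharp c))
        = A.N j * A.T c (A.sharp c) + A.T (A.sharp j) c * A.T j (A.sharp c) := by
      rw [A.cr_comm, s1]
    have s6 : ∀ x, A.T (A.sharp (A.cr c j)) x = A.T (A.sharp c) j * A.T j x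
        + A.T (A.sharp j) c * A.T c x - A.T (A.cr (A.sharp c) (A.sharp j)) x := fun x => by
      rw [sharp_cr]
      simp
    have s7 : A.T (A.cr (A.sharp c) (A.sharp j)) (A.sharp c) = 2 * (A.N c * A.T (A.sharp j) c) := by
      rw [T_cr_self, sharp_sharp, A.T_comm _ c]
      simp
    have s8 : A.T (A.cr (A.sharp c) (A.sharp j)) (A.sharp j) = 2 * (A.N j * A.T (A.sharp c) j) := by
      rw [A.cr_comm, T_cr_self, sharp_sharp, A.T_comm _ j]
      simp
    have s9 : A.T (A.sharp j) (A.cr k (A.sharp c)) = A.T (A.cr (A.sharp c) (A.sharp j)) k := by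
      rw [A.T_comm, A.T_cr, A.T_comm]
    have s10 : A.T (A.cr k (A.cr c j)) (A.sharp c) = A.T (A.cr c j) (A.cr k (A.sharp c)) := by
      rw [A.T_comm, s4]
    have s11 : A.T (A.cr (A.sharp c) (A.sharp j)) (A.cr c j)
        = 3 * (A.N c * A.N j) + A.T (A.sharp c) j * A.T (A.sharp j) c := by
      rw [A.T_cr, A.cr_comm c j, sharp_cr_self, map_add, map_smul, map_smul, T_sharp_self]
      simp only [smul_eq_mul]
      ring
    simp only [quartic, shift_apply, sharp_add, sharp_smul, N_add, N_smul, map_add, map_smul,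
      LinearMap.add_apply, LinearMap.smul_apply, smul_eq_mul, sharp_sharp, T_self_sharp, N_sharp,
      T_sharp_self, N_cr, A.cr_comm j c, s1, s10, s4, s2, s3, s5, A.T_comm _ (A.sharp (A.cr c j)),
      s6, s7, s8, s9, A.T_comm _ (A.sharp k), A.T_comm j (A.sharp c)]
    rw [A.T_comm c (A.sharp j), s11, A.T_comm c (A.cr c j), T_cr_self]
    ring

/-- The isometry exchanging the two halves of the Freudenthal triple system. -/
def flip : (F × J × J × F) ≃ₗ[F] (F × J × J × F) where
  toFun x := (-x.2.2.2, -x.2.2.1, x.2.1, x.1)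
  map_add' x y := by
    simp only [Prod.fst_add, Prod.snd_add, Prod.mk_add_mk, neg_add]
  map_smul' a x := by
    simp only [Prod.smul_fst, Prod.smul_snd, smul_eq_mul, Prod.smul_mk, RingHom.id_apply,
      smul_neg, mul_neg]
  invFun x := (x.2.2.2, x.2.2.1, -x.2.1, -x.1)
  left_inv x := by simp
  right_inv x := by simp

lemma flip_apply (α : F) (j k : J) (β : F) :
    flip (α, j, k, β) = (-β, -k, j, α) := rfl

lemma isIsometry_flip : A.IsIsometry flip := by
  refine A.isIsometry_of_quartic _ ?_ ?_
  · rintro ⟨α, j, k, β⟩ ⟨α', j', k', β'⟩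
    simp only [form, flip_apply, map_neg, LinearMap.neg_apply]
    rw [A.T_comm j', A.T_comm k']
    ring
  · rintro ⟨α, j, k, β⟩
    simp only [quartic, flip_apply, map_neg, LinearMap.neg_apply, sharp_neg, N_neg, A.T_comm k,
      A.T_comm (A.sharp k)]
    ring

/-- An element generating a one-dimensional inner ideal can be moved to a multiple of
`(1, 0, 0, 0)`. -/
lemma exists_isometry_of_singular {e : F × J × J × F} (he0 : e ≠ 0)
    (he : ∀ y, ∃ c : F, A.triple e y e = c • e) :
    ∃ f, A.IsIsometry f ∧ ∃ c : F, c ≠ 0 ∧ f e = (c, 0, 0, 0) := by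
  have key : ∀ e : F × J × J × F, (∀ y, ∃ c : F, A.triple e y e = c • e) → e.2.2.2 ≠ 0 →
      ∃ f, A.IsIsometry f ∧ ∃ c : F, c ≠ 0 ∧ f e = (c, 0, 0, 0) := by
    rintro ⟨α, j, k, β⟩ he hβ
    simp only at hβ
    let f := A.shift (-(β⁻¹ • j))
    have hf : A.IsIsometry f := A.isIsometry_shift _
    obtain ⟨α', k', hfe⟩ : ∃ α' k', f (α, j, k, β) = (α', 0, k', β) := by
      have h := A.shift_apply (-(β⁻¹ • j)) α j k β
      rw [smul_neg, smul_smul, mul_inv_cancel₀ hβ, one_smul, add_neg_cancel] at h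
      exact ⟨_, _, h⟩
    obtain ⟨c, hc⟩ := he (f.symm (1, 0, 0, 0))
    have h := hf.2 (α, j, k, β) (f.symm (1, 0, 0, 0)) (α, j, k, β)
    rw [hc, map_smul, hfe, f.apply_symm_apply] at h
    simp only [triple, map_zero, LinearMap.zero_apply, smul_zero, Prod.smul_mk, Prod.mk.injEq,
      smul_eq_mul] at h
    obtain ⟨h1, -, h3, h4⟩ := h
    have hc' : c = 2 * β := by
      apply mul_right_cancel₀ hβ
      linear_combination -h4
    subst hc'
    have hα' : α' = 0 := by
      have : (2 * 3) * β * α' = 0 := by linear_combination -h1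
      exact (mul_eq_zero.1 this).resolve_left (mul_ne_zero (mul_ne_zero A.two_ne A.three_ne) hβ)
    have hk' : k' = 0 := by
      have : ((2 * 2) * β) • k' = 0 := by
        rw [← sub_eq_zero] at h3
        linear_combination (norm := module) -h3
      exact (smul_eq_zero.1 this).resolve_left (mul_ne_zero (mul_ne_zero A.two_ne A.two_ne) hβ)
    refine ⟨f.trans flip, hf.trans A.isIsometry_flip, -β, neg_ne_zero.2 hβ, ?_⟩
    rw [LinearEquiv.trans_apply, hfe, hα', hk', flip_apply, neg_zero]
  have transport : ∀ (g : (F × J × J × F) ≃ₗ[F] (F × J × J × F)), A.IsIsometry g →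
      ∀ e : F × J × J × F, (∀ y, ∃ c : F, A.triple e y e = c • e) →
      ∀ y, ∃ c : F, A.triple (g e) y (g e) = c • g e := fun g hg e he y => by
    obtain ⟨c, hc⟩ := he (g.symm y)
    refine ⟨c, ?_⟩
    have := hg.2 e (g.symm y) e
    rwa [hc, map_smul, g.apply_symm_apply] at this
  have key2 : ∀ e : F × J × J × F, (∀ y, ∃ c : F, A.triple e y e = c • e) → e.1 ≠ 0 →
      ∃ f, A.IsIsometry f ∧ ∃ c : F, c ≠ 0 ∧ f e = (c, 0, 0, 0) := fun e he h1 => by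
    obtain ⟨f, hf, h⟩ := key (flip e) (transport flip A.isIsometry_flip e he) h1
    exact ⟨flip.trans f, A.isIsometry_flip.trans hf, h⟩
  by_cases hβ : e.2.2.2 = 0
  swap
  · exact key e he hβ
  by_cases hα : e.1 = 0
  swap
  · exact key2 e he hα
  obtain ⟨α, j, k, β⟩ := e
  simp only at hα hβ
  subst hα hβ
  obtain ⟨c, hc⟩ : ∃ c, A.T c k + A.T (A.sharp c) j ≠ 0 := by
    by_contra! h
    have hk : k = 0 := by
      refine A.nondeg _ fun y => ?_
      have h1 := h y
      have h2 := h (-y)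
      rw [map_neg, LinearMap.neg_apply, sharp_neg] at h2
      have : (2 : F) * A.T y k = 0 := by linear_combination h1 - h2
      rw [A.T_comm]
      exact (mul_eq_zero.1 this).resolve_left A.two_ne
    have hj : j ≠ 0 := by
      rintro rfl
      exact he0 (by rw [hk]; rfl)
    obtain ⟨l, hl⟩ := A.exists_T_sharp_ne hj
    apply hl
    rw [A.T_comm, ← h l, hk, map_zero, zero_add]
  obtain ⟨f, hf, h⟩ := key2 (A.shift c (0, j, k, 0))
    (transport _ (A.isIsometry_shift c) _ he) (by simpa [shift_apply] using hc)
  exact ⟨(A.shift c).trans f, (A.isIsometry_shift c).trans hf, h⟩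

end CubicNorm

namespace CubicNorm

variable {F : Type u} {J : Type v} [Field F] [AddCommGroup J] [Module F J] (A : CubicNorm F J)

lemma triple_mem_of_inner {I : Submodule F (F × J × J × F)}
    (hI : ∀ e ∈ I, ∀ y, A.triple e y e ∈ I) {e e' : F × J × J × F} (he : e ∈ I) (he' : e' ∈ I)
    (y : F × J × J × F) : A.triple e y e' ∈ I := by
  have swap : ∀ a b c, A.triple a b c = A.triple c b a := fun a b c => by
    rw [A.triple_comm_left, A.triple_comm_right, A.triple_comm_left]
  have h := I.sub_mem (I.sub_mem (hI (e + e') (I.add_mem he he') y) (hI e he y)) (hI e' he' y)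
  have h' := I.smul_mem (2 : F)⁻¹ h
  rw [triple_add, swap e y (e + e'), swap e' y (e + e'), triple_add, triple_add, swap e' y e] at h'
  have e1 : A.triple e y e' = (2 : F)⁻¹ • (A.triple e y e + A.triple e y e'
      + (A.triple e y e' + A.triple e' y e') - A.triple e y e - A.triple e' y e') := by
    apply cancel A.two_ne
    rw [smul_smul, mul_inv_cancel₀ A.two_ne]
    module
  rwa [e1]

/-- Proper inner ideals containing `(1, 0, 0, 0)`. -/
lemma inner_ideal_cases [Infinite F] {I : Submodule F (F × J × J × F)}
    (hI : ∀ e ∈ I, ∀ y, A.triple e y e ∈ I) (hu : (1, 0, 0, 0) ∈ I) (hproper : I ≠ ⊤)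
    (hS : ∀ S : Submodule F J, (∀ s ∈ S, A.sharp s = 0) →
      (∀ s ∈ S, ∀ s' ∈ S, ∀ j k, A.cr (A.cr s j) (A.cr s' k) ∈ S) →
      ∀ d ∈ S, d ≠ 0 → ∀ x ∈ S, ∃ c : F, x = c • d) :
    (∃ V : Submodule F J, (∀ v ∈ V, A.sharp v = 0) ∧
        ∀ p, p ∈ I ↔ ∃ α : F, ∃ v ∈ V, p = (α, 0, v, 0)) ∨
      ∃ d, d ≠ 0 ∧ A.sharp d = 0 ∧
        ∀ p, p ∈ I ↔ ∃ α ξ : F, ∃ k, p = (α, ξ • d, A.cr d k, 0) := by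
  have hI2 := fun e he e' he' y => A.triple_mem_of_inner hI (e := e) (e' := e') he he' y
  have hα : ∀ α : F, ((α, 0, 0, 0) : F × J × J × F) ∈ I := fun α => by
    simpa using I.smul_mem α hu
  have drop : ∀ (α : F) (j k : J) (β : F), (α, j, k, β) ∈ I → (0, j, k, β) ∈ I :=
    fun α j k β h => by simpa using I.sub_mem h (hα α)
  have hβ : ∀ p ∈ I, p.2.2.2 = 0 := by
    rintro ⟨α, j, k, β⟩ hp
    by_contra hβ
    simp only at hβ
    have hk : ∀ x, ((0, 0, x, 0) : F × J × J × F) ∈ I := fun x => by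
      have h := hI2 _ hu _ hp (0, 0, x, 0)
      simp only [triple, map_zero, LinearMap.zero_apply, smul_zero, zero_smul, mul_zero, zero_mul,
        add_zero, zero_add, sub_zero, one_mul] at h
      have h' := I.smul_mem (-β⁻¹) (drop _ _ _ _ h)
      simpa [smul_smul, hβ] using h'
    have hj : ∀ x, ((0, x, 0, 0) : F × J × J × F) ∈ I := fun x => by
      have h := hI2 _ hu _ hp (0, x, 0, 0)
      simp only [triple, map_zero, LinearMap.zero_apply, smul_zero, zero_smul, mul_zero, zero_mul,
        add_zero, zero_add, sub_zero, one_mul] at h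
      have h' := I.smul_mem β⁻¹ (I.sub_mem (drop _ _ _ _ h) (hk ((2 : F) • A.cr x j)))
      simp only [Prod.smul_mk, Prod.mk_sub_mk, sub_zero, neg_zero, zero_add, sub_self, smul_zero,
        smul_smul, inv_mul_cancel₀ hβ, one_smul] at h'
      exact h'
    refine hproper (eq_top_iff.2 ?_)
    rintro ⟨α', j', k', β'⟩ -
    have h := I.add_mem (I.smul_mem (β' * β⁻¹) hp) (I.add_mem (hα (α' - β' * β⁻¹ * α))
      (I.add_mem (hj (j' - (β' * β⁻¹) • j)) (hk (k' - (β' * β⁻¹) • k))))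
    simpa [hβ] using h
  have hcr : ∀ (α : F) (j k : J) (β : F), (α, j, k, β) ∈ I → ∀ l, (0, 0, A.cr j l, 0) ∈ I :=
    fun α j k β h l => by
      have h0 := hβ _ h
      simp only at h0
      subst h0
      have h := hI2 _ hu _ h (0, l, 0, 0)
      simp only [triple, map_zero, LinearMap.zero_apply, smul_zero, zero_smul, mul_zero, zero_mul,
        add_zero, zero_add, sub_zero, one_mul, neg_zero, one_smul] at h
      have h' := I.smul_mem (2 : F)⁻¹ (drop _ _ _ _ h)
      rw [A.cr_comm]
      simpa [smul_smul, A.two_ne] using h'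
  have hcr2 : ∀ w w', (0, 0, w, 0) ∈ I → (0, 0, w', 0) ∈ I → (0, A.cr w w', 0, 0) ∈ I :=
    fun w w' h h' => by
      have h := hI2 _ h _ h' (0, 0, 0, 1)
      simp only [triple, map_zero, LinearMap.zero_apply, smul_zero, zero_smul, mul_zero, zero_mul,
        add_zero, zero_add, sub_zero, neg_zero, one_smul] at h
      have h' := I.smul_mem (-(2 : F)⁻¹) h
      simpa [smul_smul, A.two_ne] using h'
  have hN : ∀ p ∈ I, A.N p.2.1 = 0 := fun p hp => by
    have h0 := hβ _ hp
    have h := hβ _ (hI p hp p)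
    simp only [triple, h0, cr_self, map_smul, LinearMap.smul_apply, T_sharp_self, smul_eq_mul,
      zero_mul, mul_zero, sub_zero, add_zero, zero_add] at h
    have : (2 * 2 * 3) * A.N p.2.1 = 0 := by linear_combination h
    exact (mul_eq_zero.1 this).resolve_left
      (mul_ne_zero (mul_ne_zero A.two_ne A.two_ne) A.three_ne)
  have hsharp : ∀ p ∈ I, A.sharp p.2.1 = 0 := fun p hp => by
    refine A.sharp_eq_zero_of_N_cr (hN p hp) fun k => ?_
    have h := hcr _ _ _ _ hp k
    have h' := hN _ (hcr2 _ _ h h)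
    simp only [cr_self, N_smul, N_sharp] at h'
    exact pow_eq_zero_iff (two_ne_zero) |>.1
      ((mul_eq_zero.1 h').resolve_left (pow_ne_zero _ A.two_ne))
  by_cases h0 : ∀ p ∈ I, p.2.1 = 0
  · left
    refine ⟨I.comap (LinearMap.inr F F (J × J × F) ∘ₗ LinearMap.inr F J (J × F) ∘ₗ
      LinearMap.inl F J F), fun v hv => ?_, fun p => ⟨fun hp => ?_, ?_⟩⟩
    · have h := h0 _ (hcr2 v v hv hv)
      simp only [cr_self] at h
      exact (smul_eq_zero.1 h).resolve_left A.two_ne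
    · obtain ⟨α, j, k, β⟩ := p
      have h1 := h0 _ hp
      have h2 := hβ _ hp
      simp only at h1 h2
      subst h1 h2
      exact ⟨α, k, drop _ _ _ _ hp, rfl⟩
    · rintro ⟨α, v, hv, rfl⟩
      have h : ((0, 0, v, 0) : F × J × J × F) ∈ I := hv
      simpa using I.add_mem (hα α) h
  · right
    push Not at h0
    obtain ⟨⟨α, d, k', β⟩, hp, hd0⟩ := h0
    simp only at hd0
    have hd : A.sharp d = 0 := hsharp _ hp
    have hS' := hS (I.map (LinearMap.fst F J (J × F) ∘ₗ LinearMap.snd F F (J × J × F)))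
      (by rintro _ ⟨p, hp, rfl⟩; exact hsharp p hp)
      (by
        rintro _ ⟨p, hp, rfl⟩ _ ⟨p', hp', rfl⟩ j k
        exact ⟨_, hcr2 _ _ (hcr _ _ _ _ hp j) (hcr _ _ _ _ hp' k), rfl⟩) d ⟨_, hp, rfl⟩ hd0
    have hdI : ((0, d, 0, 0) : F × J × J × F) ∈ I := by
      obtain ⟨k, hk⟩ := A.exists_T_sharp_ne hd0
      have h := hcr _ _ _ _ hp k
      have h' := hcr2 _ _ h h
      rw [cr_self, sharp_cr, hd, map_zero, LinearMap.zero_apply, map_zero, LinearMap.zero_apply,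
        zero_smul, zero_add, sub_zero, A.T_comm, smul_smul] at h'
      have h' := I.smul_mem (2 * A.T d (A.sharp k))⁻¹ h'
      simpa only [Prod.smul_mk, smul_zero, smul_smul, one_smul,
        inv_mul_cancel₀ (mul_ne_zero A.two_ne hk)] using h'
    refine ⟨d, hd0, hd, fun p => ⟨fun hp => ?_, ?_⟩⟩
    · obtain ⟨α, j, v, β⟩ := p
      obtain ⟨ξ, hξ⟩ := hS' j ⟨_, hp, rfl⟩
      have h2 := hβ _ hp
      simp only at h2
      subst hξ h2
      have hv : ((0, 0, v, 0) : F × J × J × F) ∈ I := by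
        simpa using I.sub_mem (drop _ _ _ _ hp) (I.smul_mem ξ hdI)
      obtain ⟨k, rfl⟩ := A.mem_range_cr hd0 hd fun k =>
        hS' _ ⟨_, hcr2 _ _ hv (hcr _ _ _ _ hdI k), rfl⟩
      exact ⟨α, ξ, k, rfl⟩
    · rintro ⟨α, ξ, k, rfl⟩
      simpa using I.add_mem (hα α) (I.add_mem (I.smul_mem ξ hdI) (hcr _ _ _ _ hdI k))

end CubicNorm

namespace OctonionAlgebra

variable {F : Type u} [Field F] (O : OctonionAlgebra.{u, v} F)

lemma bil_mul_conj_cyclic (a b c : O.C) :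
    O.bil (a * b) (O.conj c) = O.bil (b * c) (O.conj a) := by
  rw [bil_mul_eq_left, O.bil_mul_eq_right b]

/-- Coordinates `(ε₁, ε₂, ε₃; a, b, c)` of hermitian matrices over `O`. -/
abbrev Herm : Type max u v := F × F × F × O.C × O.C × O.C

/-- The trace form in coordinates. -/
def hermT : O.Herm →ₗ[F] O.Herm →ₗ[F] F :=
  LinearMap.mk₂ F (fun x y => x.1 * y.1 + x.2.1 * y.2.1 + x.2.2.1 * y.2.2.1
      + O.bil x.2.2.2.1 y.2.2.2.1 + O.bil x.2.2.2.2.1 y.2.2.2.2.1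
      + O.bil x.2.2.2.2.2 y.2.2.2.2.2)
    (fun x x' y => by
      simp only [Prod.fst_add, Prod.snd_add, map_add, LinearMap.add_apply]; ring)
    (fun c x y => by
      simp only [Prod.smul_fst, Prod.smul_snd, map_smul, LinearMap.smul_apply, smul_eq_mul]; ring)
    (fun x y y' => by
      simp only [Prod.fst_add, Prod.snd_add, map_add]; ring)
    (fun c x y => by
      simp only [Prod.smul_fst, Prod.smul_snd, map_smul, smul_eq_mul]; ring)

/-- The cross product in coordinates. -/
def hermCr : O.Herm →ₗ[F] O.Herm →ₗ[F] O.Herm :=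
  LinearMap.mk₂ F (fun x y =>
      (x.2.1 * y.2.2.1 + y.2.1 * x.2.2.1 - O.bil x.2.2.2.1 y.2.2.2.1,
        x.2.2.1 * y.1 + y.2.2.1 * x.1 - O.bil x.2.2.2.2.1 y.2.2.2.2.1,
        x.1 * y.2.1 + y.1 * x.2.1 - O.bil x.2.2.2.2.2 y.2.2.2.2.2,
        O.conj (x.2.2.2.2.1 * y.2.2.2.2.2 + y.2.2.2.2.1 * x.2.2.2.2.2)
          - x.1 • y.2.2.2.1 - y.1 • x.2.2.2.1,
        O.conj (x.2.2.2.2.2 * y.2.2.2.1 + y.2.2.2.2.2 * x.2.2.2.1)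
          - x.2.1 • y.2.2.2.2.1 - y.2.1 • x.2.2.2.2.1,
        O.conj (x.2.2.2.1 * y.2.2.2.2.1 + y.2.2.2.1 * x.2.2.2.2.1)
          - x.2.2.1 • y.2.2.2.2.2 - y.2.2.1 • x.2.2.2.2.2))
    (fun x x' y => by
      simp only [Prod.fst_add, Prod.snd_add, map_add, LinearMap.add_apply, Prod.mk_add_mk,
        Prod.mk.injEq, add_mul, mul_add]
      refine ⟨by ring, by ring, by ring, by module, by module, by module⟩)
    (fun c x y => by
      simp only [Prod.smul_fst, Prod.smul_snd, map_smul, map_add, LinearMap.smul_apply,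
        smul_eq_mul, Prod.smul_mk, Prod.mk.injEq, smul_mul_assoc, mul_smul_comm]
      refine ⟨by ring, by ring, by ring, by module, by module, by module⟩)
    (fun x y y' => by
      simp only [Prod.fst_add, Prod.snd_add, map_add, Prod.mk_add_mk,
        Prod.mk.injEq, add_mul, mul_add]
      refine ⟨by ring, by ring, by ring, by module, by module, by module⟩)
    (fun c x y => by
      simp only [Prod.smul_fst, Prod.smul_snd, map_smul, map_add,
        smul_eq_mul, Prod.smul_mk, Prod.mk.injEq, smul_mul_assoc, mul_smul_comm]
      refine ⟨by ring, by ring, by ring, by module, by module, by module⟩)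

lemma hermT_mk (e1 e2 e3 : F) (a b c : O.C) (e1' e2' e3' : F) (a' b' c' : O.C) :
    O.hermT (e1, e2, e3, a, b, c) (e1', e2', e3', a', b', c') = e1 * e1' + e2 * e2' + e3 * e3'
      + O.bil a a' + O.bil b b' + O.bil c c' := rfl

lemma hermCr_mk (e1 e2 e3 : F) (a b c : O.C) (e1' e2' e3' : F) (a' b' c' : O.C) :
    O.hermCr (e1, e2, e3, a, b, c) (e1', e2', e3', a', b', c')
      = (e2 * e3' + e2' * e3 - O.bil a a', e3 * e1' + e3' * e1 - O.bil b b',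
        e1 * e2' + e1' * e2 - O.bil c c',
        O.conj (b * c' + b' * c) - e1 • a' - e1' • a,
        O.conj (c * a' + c' * a) - e2 • b' - e2' • b,
        O.conj (a * b' + a' * b) - e3 • c' - e3' • c) := rfl

/-- The adjoint in coordinates. -/
def hermAdj : O.Herm → O.Herm := fun (e1, e2, e3, a, b, c) =>
  (e2 * e3 - O.n a, e3 * e1 - O.n b, e1 * e2 - O.n c, O.conj (b * c) - e1 • a,
    O.conj (c * a) - e2 • b, O.conj (a * b) - e3 • c)

/-- The cubic norm in coordinates. -/
def hermN : O.Herm → F := fun (e1, e2, e3, a, b, c) =>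
  e1 * e2 * e3 - e1 * O.n a - e2 * O.n b - e3 * O.n c + O.bil (a * b) (O.conj c)

lemma hermCr_self (x : O.Herm) : O.hermCr x x = (2 : F) • O.hermAdj x := by
  obtain ⟨e1, e2, e3, a, b, c⟩ := x
  simp only [hermCr_mk, hermAdj, bil_self, map_add, Prod.smul_mk, smul_eq_mul, Prod.mk.injEq]
  refine ⟨by ring, by ring, by ring, by module, by module, by module⟩

lemma bil_conj_mul (a b c : O.C) : O.bil (O.conj (a * b)) c = O.bil (a * b) (O.conj c) :=
  O.bil_conj_left _ _

lemma hermT_hermAdj (x : O.Herm) : O.hermT (O.hermAdj x) x = 3 * O.hermN x := by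
  obtain ⟨e1, e2, e3, a, b, c⟩ := x
  simp only [hermT_mk, hermAdj, hermN, map_sub, map_smul, LinearMap.sub_apply,
    LinearMap.smul_apply, bil_self, smul_eq_mul, bil_conj_mul, O.bil_mul_conj_cyclic a b c,
    O.bil_mul_conj_cyclic c a b]
  ring

lemma hermAdj_hermAdj_diag (e1 e2 e3 : F) (a b c : O.C) :
    (e3 * e1 - O.n b) * (e1 * e2 - O.n c) - O.n (O.conj (b * c) - e1 • a)
      = O.hermN (e1, e2, e3, a, b, c) * e1 := by
  rw [n_sub, n_conj, O.n_mul, n_smul, map_smul, smul_eq_mul, bil_conj_mul,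
    ← O.bil_mul_conj_cyclic]
  simp only [hermN]
  ring

lemma hermAdj_hermAdj_offdiag (e1 e2 e3 : F) (a b c : O.C) :
    O.conj ((O.conj (c * a) - e2 • b) * (O.conj (a * b) - e3 • c))
        - (e2 * e3 - O.n a) • (O.conj (b * c) - e1 • a)
      = O.hermN (e1, e2, e3, a, b, c) • a := by
  rw [conj_mul, map_sub, map_sub, conj_conj, conj_conj, map_smul, map_smul, sub_mul, mul_sub,
    mul_sub, smul_mul_assoc, smul_mul_assoc, mul_smul_comm, mul_smul_comm, mul_mul_conj,
    conj_mul_mul, moufang, ← conj_mul, O.bil_comm a, bil_conj_mul, ← O.bil_mul_conj_cyclic]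
  simp only [hermN]
  module

lemma hermN_cyclic (e1 e2 e3 : F) (a b c : O.C) :
    O.hermN (e2, e3, e1, b, c, a) = O.hermN (e1, e2, e3, a, b, c) := by
  simp only [hermN, O.bil_mul_conj_cyclic a b c]
  ring

lemma hermAdj_hermAdj (x : O.Herm) : O.hermAdj (O.hermAdj x) = O.hermN x • x := by
  obtain ⟨e1, e2, e3, a, b, c⟩ := x
  have h := O.hermN_cyclic
  refine Prod.ext ?_ (Prod.ext ?_ (Prod.ext ?_ (Prod.ext ?_ (Prod.ext ?_ ?_))))
  · exact O.hermAdj_hermAdj_diag e1 e2 e3 a b c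
  · exact (O.hermAdj_hermAdj_diag e2 e3 e1 b c a).trans (by rw [h]; rfl)
  · exact (O.hermAdj_hermAdj_diag e3 e1 e2 c a b).trans (by rw [h, h]; rfl)
  · exact O.hermAdj_hermAdj_offdiag e1 e2 e3 a b c
  · exact (O.hermAdj_hermAdj_offdiag e2 e3 e1 b c a).trans (by rw [h]; rfl)
  · exact (O.hermAdj_hermAdj_offdiag e3 e1 e2 c a b).trans (by rw [h, h]; rfl)

/-- The cubic norm structure of hermitian `3 × 3` matrices over an octonion algebra. -/
def herm (h2 : (2 : F) ≠ 0) (h3 : (3 : F) ≠ 0) : CubicNorm F O.Herm where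
  T := O.hermT
  cr := O.hermCr
  two_ne := h2
  three_ne := h3
  T_comm := by
    rintro ⟨e1, e2, e3, a, b, c⟩ ⟨e1', e2', e3', a', b', c'⟩
    simp only [hermT_mk, O.bil_comm a, O.bil_comm b, O.bil_comm c]
    ring
  cr_comm := by
    rintro ⟨e1, e2, e3, a, b, c⟩ ⟨e1', e2', e3', a', b', c'⟩
    simp only [hermCr_mk, O.bil_comm a, O.bil_comm b, O.bil_comm c, map_add, Prod.mk.injEq]
    refine ⟨by ring, by ring, by ring, by module, by module, by module⟩
  T_cr := by
    rintro ⟨e1, e2, e3, a, b, c⟩ ⟨e1', e2', e3', a', b', c'⟩ ⟨e1'', e2'', e3'', a'', b'', c''⟩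
    have h : ∀ x y z, O.bil (O.conj (x * y)) z = O.bil (y * z) (O.conj x) := fun x y z => by
      rw [bil_conj_left, bil_mul_conj_cyclic]
    have h' : ∀ x y z, O.bil z (O.conj (x * y)) = O.bil (x * y) (O.conj z) := fun x y z => by
      rw [bil_comm, bil_conj_left]
    simp only [hermT_mk, hermCr_mk, map_add, map_sub, map_smul, LinearMap.add_apply,
      LinearMap.sub_apply, LinearMap.smul_apply, smul_eq_mul, h, h', O.bil_comm a', O.bil_comm b',
      O.bil_comm c', O.bil_mul_conj_cyclic b c'' a', O.bil_mul_conj_cyclic c a'' b',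
      O.bil_mul_conj_cyclic a b'' c']
    ring
  adjoint_diag := by
    intro x
    have hx := O.hermAdj_hermAdj x
    have ht := O.hermT_hermAdj x
    simp only [O.hermCr_self x, map_smul, LinearMap.smul_apply, O.hermCr_self (O.hermAdj x),
      hx, ht, smul_eq_mul]
    module
  nondeg := by
    rintro ⟨e1, e2, e3, a, b, c⟩ h
    have h1 := h (1, 0, 0, 0, 0, 0)
    have h2 := h (0, 1, 0, 0, 0, 0)
    have h3 := h (0, 0, 1, 0, 0, 0)
    have h4 := fun y => h (0, 0, 0, y, 0, 0)
    have h5 := fun y => h (0, 0, 0, 0, y, 0)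
    have h6 := fun y => h (0, 0, 0, 0, 0, y)
    simp only [hermT_mk, mul_zero, mul_one, map_zero, add_zero, zero_add] at h1 h2 h3 h4 h5 h6
    rw [h1, h2, h3, O.nondeg a h4, O.nondeg b h5, O.nondeg c h6]
    rfl
  exists_ne := by
    refine ⟨(1, 1, 1, 0, 0, 0), ?_⟩
    simp only [hermT_mk, hermCr_mk, map_zero, mul_one, mul_zero, add_zero,
      smul_zero, sub_zero]
    rw [show (1 : F) + 1 + (1 + 1) + (1 + 1) = 2 * 3 by norm_num]
    exact mul_ne_zero h2 h3

end OctonionAlgebra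

namespace CubicNorm

variable {F : Type u} {J : Type v} [Field F] [AddCommGroup J] [Module F J] (A : CubicNorm F J)

lemma U_smul (a : F) (x z : J) : A.U (a • x) z = (a * a) • A.U x z := by
  simp only [U_apply, sharp_smul, map_smul, LinearMap.smul_apply, smul_eq_mul]
  module

lemma U_U_sharp {x : J} (hx : A.N x ≠ 0) (z : J) : A.U x (A.U (A.sharp x) z) = (A.N x ^ 2) • z := by
  have h := A.U_sharp_U (A.sharp x) z
  rw [sharp_sharp, U_smul, N_sharp] at h
  apply cancel (mul_ne_zero hx hx)
  rw [h, smul_smul]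
  ring_nf

/-- The quadratic operator of an invertible element. -/
def UEquiv (x : J) (hx : A.N x ≠ 0) : J ≃ₗ[F] J :=
  LinearEquiv.ofLinearMap (A.U x) ((A.N x ^ 2)⁻¹ • A.U (A.sharp x))
    (LinearMap.ext fun z => by
      simp [U_U_sharp A hx, smul_smul, inv_mul_cancel₀ (pow_ne_zero 2 hx)])
    (LinearMap.ext fun z => by
      simp [U_sharp_U, smul_smul, inv_mul_cancel₀ (pow_ne_zero 2 hx)])

lemma UEquiv_apply (x : J) (hx : A.N x ≠ 0) (z : J) : A.UEquiv x hx z = A.U x z := rfl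

/-- A pair of bijections preserving the cross product up to a nonzero factor. -/
def IsSimilarity (g g' : J ≃ₗ[F] J) (c : F) : Prop :=
  c ≠ 0 ∧ (∀ x y, A.cr (g x) (g y) = g' (A.cr x y)) ∧
    ∀ x y, A.cr (g' x) (g' y) = c • g (A.cr x y)

lemma IsSimilarity.trans {A : CubicNorm F J} {g g' h h' : J ≃ₗ[F] J} {c c' : F}
    (hg : A.IsSimilarity g g' c) (hh : A.IsSimilarity h h' c') :
    A.IsSimilarity (g.trans h) (g'.trans h') (c' * c) :=
  ⟨mul_ne_zero hh.1 hg.1, fun x y => by simp [hg.2.1, hh.2.1],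
    fun x y => by simp [hg.2.2, hh.2.2, smul_smul]⟩

lemma isSimilarity_UEquiv (x : J) (hx : A.N x ≠ 0) :
    A.IsSimilarity (A.UEquiv x hx)
      (A.UEquiv (A.sharp x) (by rw [N_sharp]; exact pow_ne_zero 2 hx)) (A.N x ^ 2) := by
  refine ⟨pow_ne_zero 2 hx, fun y z => A.cr_U x y z, fun y z => ?_⟩
  rw [UEquiv_apply, UEquiv_apply, UEquiv_apply, cr_U, sharp_sharp, U_smul, sq]

lemma IsSimilarity.sharp {A : CubicNorm F J} {g g' : J ≃ₗ[F] J} {c : F}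
    (hg : A.IsSimilarity g g' c) (x : J) : A.sharp (g x) = g' (A.sharp x) := by
  rw [CubicNorm.sharp, hg.2.1, CubicNorm.sharp, map_smul]

end CubicNorm

namespace OctonionAlgebra

variable {F : Type u} [Field F] (O : OctonionAlgebra.{u, v} F) (h2 : (2 : F) ≠ 0)
  (h3 : (3 : F) ≠ 0)

lemma herm_T (x y : O.Herm) : (O.herm h2 h3).T x y = O.hermT x y := rfl

lemma herm_cr (x y : O.Herm) : (O.herm h2 h3).cr x y = O.hermCr x y := rfl

lemma herm_sharp (x : O.Herm) : (O.herm h2 h3).sharp x = O.hermAdj x := by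
  rw [CubicNorm.sharp, herm_cr, hermCr_self, smul_smul, inv_mul_cancel₀ h2, one_smul]

lemma herm_N (x : O.Herm) : (O.herm h2 h3).N x = O.hermN x := by
  rw [CubicNorm.N, herm_sharp, herm_T, hermT_hermAdj, ← mul_assoc, inv_mul_cancel₀ h3, one_mul]

lemma hermAdj_mk (e1 e2 e3 : F) (a b c : O.C) :
    O.hermAdj (e1, e2, e3, a, b, c) = (e2 * e3 - O.n a, e3 * e1 - O.n b, e1 * e2 - O.n c,
      O.conj (b * c) - e1 • a, O.conj (c * a) - e2 • b, O.conj (a * b) - e3 • c) := rfl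

lemma hermN_mk (e1 e2 e3 : F) (a b c : O.C) :
    O.hermN (e1, e2, e3, a, b, c) =
      e1 * e2 * e3 - e1 * O.n a - e2 * O.n b - e3 * O.n c + O.bil (a * b) (O.conj c) := rfl

/-- The first diagonal idempotent. -/
def hermE : O.Herm := (1, 0, 0, 0, 0, 0)

lemma exists_isSimilarity_of_fst {d : O.Herm} (hd : O.hermAdj d = 0) (h1 : d.1 = 1) :
    ∃ g g' c, (O.herm h2 h3).IsSimilarity g g' c ∧ g d = O.hermE := by
  obtain ⟨e1, e2, e3, a, b, c⟩ := d
  obtain rfl : e1 = 1 := h1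
  simp only [hermAdj_mk, one_smul, one_mul, mul_one, Prod.mk_eq_zero, sub_eq_zero] at hd
  obtain ⟨hna, rfl, rfl, ha, hb, hc⟩ := hd
  have hN : O.hermN (1 + O.n b + O.n c, 1, 1, 0, -b, -c) = 1 := by
    simp only [hermN_mk, zero_mul, map_zero, LinearMap.zero_apply, QuadraticMap.map_neg]
    ring
  refine ⟨_, _, _, (O.herm h2 h3).isSimilarity_UEquiv (1 + O.n b + O.n c, 1, 1, 0, -b, -c)
    (by rw [herm_N, hN]; exact one_ne_zero), ?_⟩
  rw [CubicNorm.UEquiv_apply, CubicNorm.U_apply, herm_sharp, herm_T, herm_cr, hermAdj_mk,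
    hermCr_mk, hermT_mk, hermE]
  simp only [map_neg, map_zero, map_add, neg_mul, mul_neg, neg_neg, zero_mul, mul_zero, one_mul,
    mul_one, smul_zero, QuadraticMap.map_neg, LinearMap.neg_apply,
    LinearMap.zero_apply, one_smul, ha, hb, hc, bil_self, smul_eq_mul, sub_zero, zero_sub,
    neg_zero, Prod.smul_mk, Prod.mk_sub_mk, Prod.mk.injEq]
  refine ⟨?_, by ring, by ring, by module, by module, by module⟩
  linear_combination -2 * hna

lemma exists_isSimilarity_fst_ne {d : O.Herm} (hd : d ≠ 0) :
    ∃ g g' c, (O.herm h2 h3).IsSimilarity g g' c ∧ (g d).1 ≠ 0 := by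
  obtain ⟨e1, e2, e3, a, b, c⟩ := d
  have key (s : F) (b' c' : O.C) : s - O.n b' - O.n c' ≠ 0 →
      s * s * e1 + O.n c' * e2 + O.n b' * e3 + O.bil a (O.conj (b' * c')) + s * O.bil b b'
        + s * O.bil c c' ≠ 0 →
      ∃ g g' r, (O.herm h2 h3).IsSimilarity g g' r ∧ (g (e1, e2, e3, a, b, c)).1 ≠ 0 := by
    intro hN h
    refine ⟨_, _, _, (O.herm h2 h3).isSimilarity_UEquiv (s, 1, 1, 0, b', c') ?_, ?_⟩
    · rw [herm_N, hermN_mk]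
      simpa using hN
    · rw [CubicNorm.UEquiv_apply]
      have hT : ∀ z : O.Herm, z.1 = (O.herm h2 h3).T z O.hermE := fun ⟨_, _, _, _, _, _⟩ => by
        simp [herm_T, hermT_mk, hermE]
      rw [hT, CubicNorm.T_U, CubicNorm.U_apply, herm_sharp]
      simp only [herm_T, herm_cr, hermE, hermT_mk, hermAdj_mk, hermCr_mk, map_zero, map_neg,
        smul_zero, zero_smul, mul_zero, zero_mul, add_zero, mul_one, one_mul, zero_add, sub_zero,
        zero_sub, one_smul, Prod.smul_mk, Prod.mk_sub_mk, sub_neg_eq_add, smul_eq_mul, map_smul]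
      convert h using 1
      ring
  by_cases h1 : e1 = 0
  swap
  · refine ⟨.refl F _, .refl F _, 1, ⟨one_ne_zero, fun x y => rfl, fun x y => ?_⟩, h1⟩
    rw [one_smul]
    rfl
  subst h1
  by_cases he2 : e2 = 0
  swap
  · exact key 0 0 1 (by simp [O.n_one]) (by simpa [O.n_one] using he2)
  by_cases he3 : e3 = 0
  swap
  · exact key 0 1 0 (by simp [O.n_one]) (by simpa [O.n_one] using he3)
  subst he2 he3
  have hs (r : F) : ∃ s : F, s ≠ 0 ∧ s - r ≠ 0 := by
    by_cases hr : r = 1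
    · exact ⟨2, h2, by rw [hr]; norm_num⟩
    · exact ⟨1, one_ne_zero, sub_ne_zero.2 (Ne.symm hr)⟩
  by_cases hb : b = 0
  swap
  · obtain ⟨y, hy⟩ := O.exists_bil_ne hb
    obtain ⟨s, hs0, hs1⟩ := hs (O.n y)
    exact key s y 0 (by simpa using hs1) (by simpa [hs0] using hy)
  by_cases hc : c = 0
  swap
  · obtain ⟨y, hy⟩ := O.exists_bil_ne hc
    obtain ⟨s, hs0, hs1⟩ := hs (O.n y)
    exact key s 0 y (by simpa using hs1) (by simpa [hs0] using hy)
  have ha : a ≠ 0 := by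
    rintro rfl
    exact hd (by rw [hb, hc]; rfl)
  obtain ⟨y, hy⟩ := O.exists_bil_ne ha
  refine key (O.n y + 2) (O.conj y) 1 ?_ ?_
  · rw [n_conj, O.n_one]
    ring_nf
    exact one_ne_zero
  · simpa [hb, hc, conj_conj] using hy

/-- Rank one elements form a single orbit under similarities, up to scalars. -/
lemma exists_isSimilarity_smul {d : O.Herm} (hd : d ≠ 0) (hd' : (O.herm h2 h3).sharp d = 0) :
    ∃ g g' r, (O.herm h2 h3).IsSimilarity g g' r ∧ ∃ ε : F, ε ≠ 0 ∧ g d = ε • O.hermE := by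
  obtain ⟨g, g', r, hg, h1⟩ := O.exists_isSimilarity_fst_ne h2 h3 hd
  obtain ⟨f, f', s, hf, h⟩ := O.exists_isSimilarity_of_fst h2 h3 (d := (g d).1⁻¹ • g d)
    (by rw [← O.herm_sharp h2 h3, CubicNorm.sharp_smul, hg.sharp, hd', map_zero, smul_zero])
    (inv_mul_cancel₀ h1)
  refine ⟨_, _, _, hg.trans hf, _, h1, ?_⟩
  rw [← h, map_smul, smul_smul, mul_inv_cancel₀ h1, one_smul, LinearEquiv.trans_apply]

end OctonionAlgebra

namespace OctonionAlgebra

variable {F : Type u} [Field F] (O : OctonionAlgebra.{u, v} F)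

instance : FiniteDimensional F O.C :=
  FiniteDimensional.of_finrank_pos (by rw [O.finrank_eq]; norm_num)

lemma bil_eq_zero_of_isotropic {R : Submodule F O.C} (hR : ∀ r ∈ R, O.n r = 0) {r s : O.C}
    (hr : r ∈ R) (hs : s ∈ R) : O.bil r s = 0 := by
  have h := O.n_add r s
  rw [hR _ (R.add_mem hr hs), hR r hr, hR s hs] at h
  linear_combination -h

lemma bil_nondegenerate : LinearMap.BilinForm.Nondegenerate O.bil :=
  ⟨O.nondeg, fun x h => O.nondeg x fun y => by rw [bil_eq, O.bil_comm, h]⟩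

lemma finrank_le_four {R : Submodule F O.C} (hR : ∀ r ∈ R, O.n r = 0) :
    Module.finrank F R ≤ 4 := by
  have h := LinearMap.BilinForm.finrank_orthogonal O.bil_nondegenerate R
  have h' : R ≤ LinearMap.BilinForm.orthogonal O.bil R := fun r hr s hs =>
    O.bil_eq_zero_of_isotropic hR hs hr
  have := Submodule.finrank_mono h'
  have := R.finrank_le
  rw [O.finrank_eq] at *
  omega

lemma exists_orthogonal_n_ne (b b' : O.C) :
    ∃ x, O.bil b x = 0 ∧ O.bil b' x = 0 ∧ O.n x ≠ 0 := by
  by_contra! h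
  have h1 := LinearMap.BilinForm.finrank_orthogonal O.bil_nondegenerate (Submodule.span F {b, b'})
  have h2 := O.finrank_le_four
    (R := LinearMap.BilinForm.orthogonal O.bil (Submodule.span F {b, b'}))
    fun x hx => h x (hx b (Submodule.subset_span (by simp)))
      (hx b' (Submodule.subset_span (by simp)))
  classical
  have h3 := (finrank_span_finset_le_card (R := F) ({b, b'} : Finset O.C)).trans
    Finset.card_le_two
  rw [Finset.coe_pair, Set.finrank] at h3
  rw [O.finrank_eq] at h1
  omega

lemma n_eq_zero_of_mul_eq_zero {b c : O.C} (hb : b ≠ 0) (h : b * c = 0) : O.n c = 0 := by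
  have := O.mul_mul_conj c b
  rw [h, zero_mul] at this
  exact (smul_eq_zero.1 this.symm).resolve_right hb

lemma mul_conj_mul_add (x y z : O.C) :
    x * (O.conj y * z) + y * (O.conj x * z) = O.bil x y • z := by
  simpa [conj_conj, bil_conj_conj] using O.conj_mul_mul_add (O.conj x) (O.conj y) z

lemma exists_bil_eq_zero_ne {b b' : O.C} (hb : b ≠ 0) (h : ∀ c : F, b' ≠ c • b) :
    ∃ y, O.bil b y = 0 ∧ O.bil b' y ≠ 0 := by
  by_contra! hy
  obtain ⟨z, hz⟩ := O.exists_bil_ne hb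
  refine h (O.bil b' z / O.bil b z) (O.eq_of_bil fun w => ?_)
  have := hy (w - (O.bil b w / O.bil b z) • z) (by
    rw [map_sub, map_smul, smul_eq_mul, div_mul_cancel₀ _ hz, sub_self])
  rw [map_sub, map_smul, smul_eq_mul, sub_eq_zero] at this
  rw [this, map_smul, LinearMap.smul_apply, smul_eq_mul]
  ring

lemma finrank_le_two_of_mul_eq_zero {R S : Submodule F O.C} (hR2 : 2 ≤ Module.finrank F R)
    (h : ∀ r ∈ R, ∀ s ∈ S, r * s = 0) : Module.finrank F S ≤ 2 := by
  obtain ⟨b, hbR, b', hb'R, hb, hbb'⟩ : ∃ b ∈ R, ∃ b' ∈ R, b ≠ 0 ∧ ∀ c : F, b' ≠ c • b := by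
    by_contra! H
    have : Module.finrank F R ≤ 1 := by
      by_cases hR0 : R = ⊥
      · rw [hR0, finrank_bot]; exact zero_le_one
      obtain ⟨b, hbR, hb⟩ := R.exists_mem_ne_zero_of_ne_bot hR0
      refine finrank_le_one (⟨b, hbR⟩ : R) fun w => ?_
      obtain ⟨c, hc⟩ := H b hbR w w.2 hb
      exact ⟨c, Subtype.ext hc.symm⟩
    omega
  obtain ⟨x, hxb, hxb', hx⟩ := O.exists_orthogonal_n_ne b b'
  obtain ⟨y, hyb, hyb'⟩ := O.exists_bil_eq_zero_ne hb hbb'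
  have hS : ∀ b ∈ R, O.bil b x = 0 → ∀ s ∈ S, O.conj b * (x * s) = 0 := fun b hb hbx s hs => by
    have := O.conj_mul_mul_add b x s
    rwa [h b hb s hs, mul_zero, add_zero, hbx, zero_smul] at this
  let f : S × S →ₗ[F] O.C := ((LinearMap.mulLeft F (O.conj y)).comp
    ((LinearMap.mulLeft F x).comp S.subtype)).coprod S.subtype
  have hf : ∀ s t, f (s, t) = O.conj y * (x * s) + t := fun s t => rfl
  have hf0 : Function.Injective f := by
    rw [← LinearMap.ker_eq_bot, LinearMap.ker_eq_bot']
    rintro ⟨s, t⟩ hst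
    rw [hf] at hst
    have h1 := congrArg (b' * ·) hst
    have h2 := O.mul_conj_mul_add b' y (x * s)
    rw [hS b' hb'R hxb' s s.2, mul_zero, add_zero] at h2
    simp only [mul_add, mul_zero, h b' hb'R t t.2, h2, add_zero] at h1
    have h3 := (smul_eq_zero.1 h1).resolve_left hyb'
    have h4 := O.conj_mul_mul x s
    rw [h3, mul_zero] at h4
    have h5 := (smul_eq_zero.1 h4.symm).resolve_left hx
    rw [h5, mul_zero, mul_zero, zero_add] at hst
    exact Prod.ext (Subtype.ext h5) (Subtype.ext hst)
  have hrange : LinearMap.range f ≤ LinearMap.ker (LinearMap.mulLeft F b) := by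
    rintro _ ⟨⟨s, t⟩, rfl⟩
    have h2 := O.mul_conj_mul_add b y (x * s)
    rw [hS b hbR hxb s s.2, mul_zero, add_zero, hyb, zero_smul] at h2
    rw [LinearMap.mem_ker, LinearMap.mulLeft_apply, hf, mul_add, h2, h b hbR t t.2, add_zero]
  have h1 := Submodule.finrank_mono hrange
  have h2 := O.finrank_le_four (R := LinearMap.ker (LinearMap.mulLeft F b))
    fun c hc => O.n_eq_zero_of_mul_eq_zero hb hc
  rw [LinearMap.finrank_range_of_inj hf0, Module.finrank_prod] at h1
  omega

lemma finrank_map_conj (R : Submodule F O.C) :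
    Module.finrank F (R.map O.conj) = Module.finrank F R :=
  (Submodule.equivMapOfInjective _ (Function.LeftInverse.injective O.conj_conj) R).finrank_eq.symm

lemma four_le_finrank_range {r : O.C} (hr : r ≠ 0) :
    4 ≤ Module.finrank F (LinearMap.range (LinearMap.mulLeft F r)) := by
  have h1 := LinearMap.finrank_range_add_finrank_ker (LinearMap.mulLeft F r)
  have h2 := O.finrank_le_four (R := LinearMap.ker (LinearMap.mulLeft F r))
    fun c hc => O.n_eq_zero_of_mul_eq_zero hr hc
  rw [O.finrank_eq] at h1
  omega

/-- An isotropic right ideal is zero. -/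
lemma eq_zero_of_mem_rightIdeal {R : Submodule F O.C} (hR : ∀ r ∈ R, O.n r = 0)
    (hmul : ∀ r ∈ R, ∀ y, r * y ∈ R) : ∀ r ∈ R, r = 0 := by
  by_contra! H
  obtain ⟨r, hr, hr0⟩ := H
  have h4 := (O.four_le_finrank_range hr0).trans (Submodule.finrank_mono (t := R) (by
    rintro _ ⟨y, rfl⟩
    exact hmul r hr y))
  have h2 := O.finrank_le_two_of_mul_eq_zero (R := R.map O.conj) (S := R)
    (by rw [finrank_map_conj]; omega) (by
      rintro _ ⟨r, hr, rfl⟩ s hs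
      refine O.eq_of_bil fun y => ?_
      rw [O.bil_comm, ← bil_mul_eq_left, O.bil_eq_zero_of_isotropic hR (hmul r hr y) hs, map_zero,
        LinearMap.zero_apply])
  omega

end OctonionAlgebra

lemma Submodule.finrank_map_add_finrank_inf_ker {K V W : Type*} [Field K] [AddCommGroup V]
    [AddCommGroup W] [Module K V] [Module K W] [FiniteDimensional K V] (S : Submodule K V)
    (p : V →ₗ[K] W) :
    Module.finrank K (S.map p) + Module.finrank K (S ⊓ LinearMap.ker p : Submodule K V)
      = Module.finrank K S := by
  rw [← LinearMap.finrank_range_add_finrank_ker (p.domRestrict S), LinearMap.range_domRestrict,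
    LinearMap.ker_domRestrict, ← Submodule.map_comap_subtype, Submodule.finrank_map_subtype_eq]

namespace OctonionAlgebra

variable {F : Type u} [Field F] (O : OctonionAlgebra.{u, v} F) (h2 : (2 : F) ≠ 0)
  (h3 : (3 : F) ≠ 0)

lemma finrank_add_finrank_le_five {R S : Submodule F O.C} (hR : ∀ r ∈ R, O.n r = 0)
    (hS : ∀ s ∈ S, O.n s = 0) (h : ∀ r ∈ R, ∀ s ∈ S, r * s = 0) :
    Module.finrank F R + Module.finrank F S ≤ 5 := by
  have h1 := O.finrank_le_four hR
  have h2 := O.finrank_le_four hS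
  have h3 := O.finrank_le_two_of_mul_eq_zero (R := R) (S := S)
  have h4 := O.finrank_le_two_of_mul_eq_zero (R := S.map O.conj) (S := R.map O.conj)
  rw [finrank_map_conj, finrank_map_conj] at h4
  by_cases hR2 : 2 ≤ Module.finrank F R
  · have := h3 hR2 h
    by_cases hS2 : 2 ≤ Module.finrank F S
    · have := h4 hS2 (by
        rintro _ ⟨s, hs, rfl⟩ _ ⟨r, hr, rfl⟩
        rw [← conj_mul, h r hr s hs, map_zero])
      omega
    · omega
  · omega

lemma hermCr_hermE (e1 e2 e3 : F) (a b c : O.C) :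
    O.hermCr O.hermE (e1, e2, e3, a, b, c) = (0, e3, e2, -a, 0, 0) := by
  simp [hermE, hermCr_mk]

/-- Rank one elements orthogonal to the first diagonal idempotent. -/
lemma of_hermCr_hermE {v : O.Herm} (hv : O.hermAdj v = 0) (h : O.hermCr O.hermE v = 0) :
    ∃ ε b c, v = (ε, 0, 0, 0, b, c) ∧ O.n b = 0 ∧ O.n c = 0 ∧ b * c = 0 := by
  obtain ⟨ε, e2, e3, a, b, c⟩ := v
  simp only [hermCr_hermE, Prod.mk_eq_zero, true_and, neg_eq_zero, and_true] at h
  obtain ⟨rfl, rfl, rfl⟩ := h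
  simp only [hermAdj_mk, Prod.mk_eq_zero, zero_mul, mul_zero, zero_sub, neg_eq_zero, smul_zero,
    sub_zero] at hv
  obtain ⟨-, hb, hc, hbc, -⟩ := hv
  refine ⟨ε, b, c, rfl, hb, hc, ?_⟩
  rw [← O.conj_conj (b * c), hbc, map_zero]

include h2 h3 in
lemma hermCr_eq_zero {V : Submodule F O.Herm} (hV : ∀ v ∈ V, O.hermAdj v = 0) {v w : O.Herm}
    (hv : v ∈ V) (hw : w ∈ V) : O.hermCr v w = 0 := by
  have h := (O.herm h2 h3).sharp_add v w
  rw [herm_sharp, herm_sharp, herm_sharp, hV _ (V.add_mem hv hw), hV v hv, hV w hw, zero_add,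
    zero_add] at h
  exact h.symm

include h2 h3 in
lemma finrank_le_six_of_mem {V : Submodule F O.Herm} (hV : ∀ v ∈ V, O.hermAdj v = 0)
    (h1 : O.hermE ∈ V) : Module.finrank F V ≤ 6 := by
  have hform : ∀ v ∈ V, ∃ ε b c, v = (ε, 0, 0, 0, b, c) ∧ O.n b = 0 ∧ O.n c = 0 ∧ b * c = 0 :=
    fun v hv => O.of_hermCr_hermE (hV v hv) (O.hermCr_eq_zero h2 h3 hV h1 hv)
  let p : O.Herm →ₗ[F] O.C := LinearMap.fst F _ _ ∘ₗ LinearMap.snd F _ _ ∘ₗ LinearMap.snd F _ _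
    ∘ₗ LinearMap.snd F _ _ ∘ₗ LinearMap.snd F _ _
  let q : O.Herm →ₗ[F] O.C := LinearMap.snd F _ _ ∘ₗ LinearMap.snd F _ _ ∘ₗ LinearMap.snd F _ _
    ∘ₗ LinearMap.snd F _ _ ∘ₗ LinearMap.snd F _ _
  let K := V ⊓ LinearMap.ker p
  have hK : Module.finrank F (K ⊓ LinearMap.ker q : Submodule F O.Herm) ≤ 1 := by
    rw [← finrank_span_singleton (K := F) (v := O.hermE) fun h => one_ne_zero (congrArg Prod.fst h)]
    refine Submodule.finrank_mono ?_
    rintro v ⟨⟨hv, hp⟩, hq⟩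
    obtain ⟨ε, b, c, rfl, -⟩ := hform v hv
    obtain rfl : b = 0 := hp
    obtain rfl : c = 0 := hq
    exact Submodule.mem_span_singleton.2 ⟨ε, by simp [hermE]⟩
  have hsum := O.finrank_add_finrank_le_five (R := V.map p) (S := K.map q)
    (by
      rintro _ ⟨v, hv, rfl⟩
      obtain ⟨ε, b, c, rfl, h, -⟩ := hform v hv
      exact h)
    (by
      rintro _ ⟨v, ⟨hv, -⟩, rfl⟩
      obtain ⟨ε, b, c, rfl, -, h, -⟩ := hform v hv
      exact h)
    (by
      rintro _ ⟨v, hv, rfl⟩ _ ⟨w, ⟨hw, hf⟩, rfl⟩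
      obtain ⟨ε, b, c, hvw, -, -, h⟩ := hform _ (V.add_mem hv hw)
      obtain ⟨ε, b, c, rfl, -, -, h'⟩ := hform v hv
      obtain ⟨ε', b', c', rfl, -⟩ := hform w hw
      obtain rfl : b' = 0 := hf
      simp only [Prod.mk_add_mk, add_zero, Prod.mk.injEq] at hvw
      obtain ⟨-, -, -, -, rfl, rfl⟩ := hvw
      rw [mul_add, h', zero_add] at h
      exact h)
  have e1 : Module.finrank F (V.map p) + Module.finrank F K = Module.finrank F V :=
    V.finrank_map_add_finrank_inf_ker p
  have e2 : Module.finrank F (K.map q) + Module.finrank F (K ⊓ LinearMap.ker q : Submodule F O.Herm)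
      = Module.finrank F K := K.finrank_map_add_finrank_inf_ker q
  omega

/-- Totally singular subspaces have dimension at most 6. -/
lemma finrank_le_six {V : Submodule F O.Herm} (hV : ∀ v ∈ V, (O.herm h2 h3).sharp v = 0) :
    Module.finrank F V ≤ 6 := by
  by_cases h0 : V = ⊥
  · rw [h0, finrank_bot]
    exact Nat.zero_le 6
  obtain ⟨d, hd, hd0⟩ := V.exists_mem_ne_zero_of_ne_bot h0
  obtain ⟨g, g', r, hg, ε, hε, hgd⟩ := O.exists_isSimilarity_smul h2 h3 hd0 (hV d hd)
  rw [← g.finrank_map_eq V]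
  refine O.finrank_le_six_of_mem h2 h3 ?_ ?_
  · rintro _ ⟨v, hv, rfl⟩
    rw [← O.herm_sharp h2 h3]
    exact (hg.sharp v).trans (by rw [hV v hv, map_zero])
  · rw [← inv_smul_smul₀ hε O.hermE, ← hgd]
    exact Submodule.smul_mem _ _ (Submodule.mem_map_of_mem hd)

include h2 h3 in
lemma eq_zero_of_cr_cr_mem {S : Submodule F O.Herm} (hS : ∀ s ∈ S, O.hermAdj s = 0)
    (hcr : ∀ s ∈ S, ∀ s' ∈ S, ∀ j k, O.hermCr (O.hermCr s j) (O.hermCr s' k) ∈ S)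
    (h1 : O.hermE ∈ S) : ∀ s ∈ S, s = s.1 • O.hermE := by
  let R : Submodule F O.C := S.comap (LinearMap.inr F _ _ ∘ₗ LinearMap.inr F _ _ ∘ₗ
    LinearMap.inr F _ _ ∘ₗ LinearMap.inr F _ _ ∘ₗ LinearMap.inr F _ _)
  have hmem : ∀ r, r ∈ R ↔ (0, 0, 0, 0, 0, r) ∈ S := fun r => Iff.rfl
  have hb : ∀ ε b c, (ε, 0, 0, 0, b, c) ∈ S → ∀ y, O.conj (y * b) ∈ R := fun ε b c h y => by
    have := hcr _ h _ h1 (0, 1, 0, 0, 0, 0) (0, 0, 0, y, 0, 0)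
    rw [hermCr_hermE, hermCr_mk, hermCr_mk] at this
    simpa [hmem] using this
  have hc : ∀ ε b c, (ε, 0, 0, 0, b, c) ∈ S → ∀ y, (0, 0, 0, 0, O.conj (c * y), 0) ∈ S :=
    fun ε b c h y => by
    have := hcr _ h _ h1 (0, 0, 1, 0, 0, 0) (0, 0, 0, y, 0, 0)
    rw [hermCr_hermE, hermCr_mk, hermCr_mk] at this
    simpa using this
  have hR := O.eq_zero_of_mem_rightIdeal (R := R)
    (fun r hr => by
      have := hS _ ((hmem r).1 hr)
      simp only [hermAdj_mk, Prod.mk_eq_zero, mul_zero, zero_sub, neg_eq_zero] at this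
      exact this.2.2.1)
    (fun r hr y => by
      have := hb _ _ _ (hc _ _ _ ((hmem r).1 hr) y) 1
      rwa [one_mul, conj_conj] at this)
  intro s hs
  obtain ⟨ε, b, c, rfl, -⟩ := O.of_hermCr_hermE (hS s hs) (O.hermCr_eq_zero h2 h3 hS h1 hs)
  have hb0 := hR _ (hb _ _ _ hs 1)
  have hc0 := hR _ (hb _ _ _ (hc _ _ _ hs 1) 1)
  rw [one_mul] at hb0 hc0
  rw [conj_conj, mul_one] at hc0
  rw [← O.conj_conj b, hb0, hc0, map_zero, hermE]
  simp

/-- A totally singular subspace closed under `s × j × (s' × k)` is at most one-dimensional. -/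
lemma eq_smul_of_cr_cr_mem {S : Submodule F O.Herm}
    (hS : ∀ s ∈ S, (O.herm h2 h3).sharp s = 0)
    (hcr : ∀ s ∈ S, ∀ s' ∈ S, ∀ j k, (O.herm h2 h3).cr ((O.herm h2 h3).cr s j)
      ((O.herm h2 h3).cr s' k) ∈ S) {d : O.Herm} (hd : d ∈ S) (hd0 : d ≠ 0) {x : O.Herm}
    (hx : x ∈ S) : ∃ c : F, x = c • d := by
  obtain ⟨g, g', r, hg, ε, hε, hgd⟩ := O.exists_isSimilarity_smul h2 h3 hd0 (hS d hd)
  have h := O.eq_zero_of_cr_cr_mem h2 h3 (S := S.map (g : O.Herm →ₗ[F] O.Herm))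
    (by
      rintro _ ⟨v, hv, rfl⟩
      rw [← O.herm_sharp h2 h3]
      exact (hg.sharp v).trans (by rw [hS v hv, map_zero]))
    (by
      rintro _ ⟨s, hs, rfl⟩ _ ⟨s', hs', rfl⟩ j k
      obtain ⟨j, rfl⟩ := g.surjective j
      obtain ⟨k, rfl⟩ := g.surjective k
      refine ⟨r • _, S.smul_mem r (hcr s hs s' hs' j k), ?_⟩
      simp only [LinearEquiv.coe_coe, ← herm_cr O h2 h3, hg.2.1, hg.2.2, map_smul])
    (by
      rw [← inv_smul_smul₀ hε O.hermE, ← hgd]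
      exact Submodule.smul_mem _ _ (Submodule.mem_map_of_mem hd))
    _ (Submodule.mem_map_of_mem hx)
  refine ⟨(g x).1 / ε, g.injective ?_⟩
  rw [map_smul, hgd, smul_smul, div_mul_cancel₀ _ hε]
  exact h

lemma finrank_range_hermCr_hermE : Module.finrank F (LinearMap.range (O.hermCr O.hermE)) = 10 := by
  let f : F × F × O.C →ₗ[F] O.Herm := O.hermCr O.hermE ∘ₗ LinearMap.inr F _ _ ∘ₗ
    LinearMap.prodMap LinearMap.id (LinearMap.prodMap LinearMap.id (LinearMap.inl F _ _))
  have hf : ∀ e2 e3 a, f (e2, e3, a) = (0, e3, e2, -a, 0, 0) := fun e2 e3 a =>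
    O.hermCr_hermE 0 e2 e3 a 0 0
  have hrange : LinearMap.range (O.hermCr O.hermE) = LinearMap.range f := by
    refine le_antisymm ?_ (LinearMap.range_comp_le_range _ _)
    rintro _ ⟨⟨e1, e2, e3, a, b, c⟩, rfl⟩
    exact ⟨(e2, e3, a), by rw [hf, hermCr_hermE]⟩
  rw [hrange, LinearMap.finrank_range_of_inj, Module.finrank_prod, Module.finrank_prod,
    Module.finrank_self, O.finrank_eq]
  rintro ⟨e2, e3, a⟩ ⟨e2', e3', a'⟩ h
  simp only [hf, Prod.mk.injEq, neg_inj] at h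
  rw [h.2.1, h.2.2.1, h.2.2.2.1]

lemma finrank_range_cr {d : O.Herm} (hd0 : d ≠ 0) (hd : (O.herm h2 h3).sharp d = 0) :
    Module.finrank F (LinearMap.range ((O.herm h2 h3).cr d)) = 10 := by
  obtain ⟨g, g', r, hg, ε, hε, hgd⟩ := O.exists_isSimilarity_smul h2 h3 hd0 hd
  rw [← g'.finrank_map_eq, ← LinearMap.range_comp, ← O.finrank_range_hermCr_hermE]
  have : (g' : O.Herm →ₗ[F] O.Herm) ∘ₗ (O.herm h2 h3).cr d =
      (ε • O.hermCr O.hermE) ∘ₗ (g : O.Herm →ₗ[F] O.Herm) := LinearMap.ext fun x => by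
    have := hg.2.1 d x
    rw [hgd, map_smul, herm_cr] at this
    exact this.symm
  rw [this, LinearMap.range_comp_of_range_eq_top _ g.range, LinearMap.range_smul _ _ hε]

end OctonionAlgebra

namespace CubicNorm

variable {F : Type u} {J : Type v} [Field F] [AddCommGroup J] [Module F J] (A : CubicNorm F J)

/-- The multiplication of the Brown algebra. -/
def brownMul (x y : F × J × J × F) : F × J × J × F :=
  (x.1 * y.1 + A.T x.2.1 y.2.2.1,
    x.1 • y.2.1 + y.2.2.2 • x.2.1 + A.cr x.2.2.1 y.2.2.1,
    y.1 • x.2.2.1 + x.2.2.2 • y.2.2.1 + A.cr x.2.1 y.2.1,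
    x.2.2.2 * y.2.2.2 + A.T y.2.1 x.2.2.1)

/-- The involution of the Brown algebra. -/
def brownInv (x : F × J × J × F) : F × J × J × F := (x.2.2.2, x.2.1, x.2.2.1, x.1)

/-- The ternary product of the Brown algebra. -/
def brownBrace (x y z : F × J × J × F) : F × J × J × F :=
  A.brownMul (A.brownMul x (brownInv y)) z + A.brownMul (A.brownMul z (brownInv y)) x
    - A.brownMul (A.brownMul z (brownInv x)) y

lemma brownMul_form (x y : F × J × J × F) :
    (A.brownMul (A.brownMul x (brownInv y) - A.brownMul y (brownInv x)) (1, 0, 0, -1)).1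
      = A.form x y := by
  simp only [brownMul, brownInv, form, Prod.fst_sub, map_zero]
  ring

lemma brownBrace_triple (x y z : F × J × J × F) :
    (2 : F) • A.brownBrace x (A.brownMul (1, 0, 0, -1) y) z - A.form y z • x - A.form y x • z
      - A.form x z • y = A.triple x y z := by
  obtain ⟨α, j, k, β⟩ := x
  obtain ⟨α', j', k', β'⟩ := y
  obtain ⟨α'', j'', k'', β''⟩ := z
  simp only [brownBrace, brownMul, brownInv, form, triple, map_add, map_zero, map_smul,
    LinearMap.add_apply, LinearMap.smul_apply, LinearMap.zero_apply,
    smul_eq_mul, Prod.mk_add_mk, Prod.mk_sub_mk, Prod.smul_mk, Prod.mk.injEq]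
  refine ⟨?_, ?_, ?_, ?_⟩
  · simp only [A.T_cr_swap k'' k' k, A.T_cr_swap k k'' k', A.cr_comm k'' k]
    ring
  · simp only [A.cr_comm (A.cr _ _), A.cr_comm j'' j, A.cr_comm j'' j', A.cr_comm k' k,
      A.cr_comm k'' k, A.cr_comm k'' k']
    module
  · simp only [A.cr_comm (A.cr _ _), A.cr_comm j' j, A.cr_comm j'' j, A.cr_comm j'' j',
      A.cr_comm k'' k, A.cr_comm k'' k']
    module
  · simp only [A.T_comm _ (A.cr _ _), A.T_cr_swap j'' j' j, A.T_cr_swap j j'' j',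
      A.cr_comm j'' j]
    ring

lemma brownMul_skew (x : F × J × J × F) :
    A.brownMul (1, 0, 0, -1) x = (x.1, x.2.1, -x.2.2.1, -x.2.2.2) := by
  simp [brownMul]

lemma form_self (x : F × J × J × F) : A.form x x = 0 := by
  rw [form]
  ring

lemma two_smul_brownBrace_self (e x : F × J × J × F) :
    (2 : F) • A.brownBrace e (A.brownMul (1, 0, 0, -1) x) e
      = A.triple e x e + (2 * A.form x e) • e := by
  have h := A.brownBrace_triple e x e
  rw [form_self] at h
  linear_combination (norm := module) h

lemma exists_brownMul_skew_eq (x : F × J × J × F) : ∃ y, x = A.brownMul (1, 0, 0, -1) y :=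
  ⟨(x.1, x.2.1, -x.2.2.1, -x.2.2.2), by simp [brownMul_skew]⟩

lemma forall_brownBrace_eq_smul_iff (e : F × J × J × F) :
    (∀ x, ∃ c : F, A.brownBrace e x e = c • e) ↔ ∀ x, ∃ c : F, A.triple e x e = c • e := by
  constructor
  · intro h x
    obtain ⟨c, hc⟩ := h (A.brownMul (1, 0, 0, -1) x)
    refine ⟨2 * c - 2 * A.form x e, ?_⟩
    have h' := A.two_smul_brownBrace_self e x
    rw [hc] at h'
    linear_combination (norm := module) -h'
  · intro h x
    obtain ⟨y, rfl⟩ := A.exists_brownMul_skew_eq x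
    obtain ⟨c, hc⟩ := h y
    refine ⟨2⁻¹ * (c + 2 * A.form y e), cancel A.two_ne ?_⟩
    rw [two_smul_brownBrace_self, hc, smul_smul, mul_inv_cancel_left₀ A.two_ne]
    module

lemma triple_mem_of_brownBrace_mem {I : Submodule F (F × J × J × F)} {e : F × J × J × F}
    (he : e ∈ I) (h : ∀ x, A.brownBrace e x e ∈ I) (x : F × J × J × F) : A.triple e x e ∈ I := by
  rw [eq_sub_of_add_eq (A.two_smul_brownBrace_self e x).symm]
  exact I.sub_mem (I.smul_mem _ (h _)) (I.smul_mem _ he)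

lemma triple_of_sharp_eq_zero {v : J} (hv : A.sharp v = 0) (α : F) (x : F × J × J × F) :
    ∃ c : F, A.triple (α, 0, v, 0) x (α, 0, v, 0) = c • ((α, 0, v, 0) : F × J × J × F) := by
  refine ⟨2 * A.T x.2.1 v - 2 * (α * x.2.2.2), ?_⟩
  simp only [triple, map_zero, LinearMap.zero_apply, A.T_cr_self, hv, A.cr_self, Prod.smul_mk,
    smul_zero, smul_eq_mul, Prod.mk.injEq]
  refine ⟨by ring, by simp, by module, by ring⟩

lemma sharp_eq_zero_of_triple {v : J}
    (h : ∀ x, ∃ c : F, A.triple (0, 0, v, 0) x (0, 0, v, 0) = c • ((0, 0, v, 0) : F × J × J × F)) :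
    A.sharp v = 0 := by
  refine A.nondeg _ fun y => ?_
  obtain ⟨c, hc⟩ := h (0, 0, y, 0)
  have h1 := congrArg Prod.fst hc
  simp only [triple, map_zero, LinearMap.zero_apply, A.T_cr_self, Prod.smul_mk, smul_zero] at h1
  have h4 : (2 * 2 : F) * A.T (A.sharp v) y = 0 := by linear_combination -h1
  exact (mul_eq_zero.1 h4).resolve_left (mul_ne_zero A.two_ne A.two_ne)

lemma IsIsometry.forall_triple_iff {A : CubicNorm F J}
    {f : (F × J × J × F) ≃ₗ[F] (F × J × J × F)} (hf : A.IsIsometry f) (e : F × J × J × F) :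
    (∀ x, ∃ c : F, A.triple (f e) x (f e) = c • f e) ↔ ∀ x, ∃ c : F, A.triple e x e = c • e := by
  refine f.surjective.forall.trans (forall_congr' fun x => exists_congr fun c => ?_)
  rw [hf.2, ← map_smul, f.injective.eq_iff]

end CubicNorm

namespace OctonionAlgebra

variable {F : Type u} [Field F] (O : OctonionAlgebra.{u, v} F) (h2 : (2 : F) ≠ 0)
  (h3 : (3 : F) ≠ 0)

theorem exists_isometry_inner_ideal [Infinite F] {I : Submodule F (F × O.Herm × O.Herm × F)}
    (hI : ∀ e ∈ I, ∀ x, (O.herm h2 h3).triple e x e ∈ I) (hproper : I ≠ ⊤)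
    {e : F × O.Herm × O.Herm × F} (heI : e ∈ I) (he0 : e ≠ 0)
    (he : ∀ x, ∃ c : F, (O.herm h2 h3).triple e x e = c • e) :
    ∃ f : (F × O.Herm × O.Herm × F) ≃ₗ[F] (F × O.Herm × O.Herm × F),
      (O.herm h2 h3).IsIsometry f ∧
      ((∃ V : Submodule F O.Herm, (∀ v ∈ V, (O.herm h2 h3).sharp v = 0) ∧
          ∀ p, p ∈ I.map f.toLinearMap ↔ ∃ α, ∃ v ∈ V, p = (α, 0, v, 0)) ∨
        ∃ d, d ≠ 0 ∧ (O.herm h2 h3).sharp d = 0 ∧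
          ∀ p, p ∈ I.map f.toLinearMap ↔
            ∃ (α ξ : F) (k : _), p = (α, ξ • d, (O.herm h2 h3).cr d k, 0)) := by
  obtain ⟨f, hf, c, hc, hfe⟩ := (O.herm h2 h3).exists_isometry_of_singular he0 he
  refine ⟨f, hf, (O.herm h2 h3).inner_ideal_cases ?_ ?_ ?_ ?_⟩
  · rintro _ ⟨p, hp, rfl⟩ y
    obtain ⟨x, rfl⟩ := f.surjective y
    exact ⟨_, hI p hp x, (hf.2 p x p).symm⟩
  · have := Submodule.smul_mem _ c⁻¹ (Submodule.mem_map_of_mem (f := f.toLinearMap) heI)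
    rw [LinearEquiv.coe_coe, hfe] at this
    simpa [inv_mul_cancel₀ hc] using this
  · intro h
    refine hproper (Submodule.map_injective_of_injective f.injective ?_)
    rw [h, Submodule.map_top, f.range]
  · intro S hS hcr d hd hd0 x hx
    exact O.eq_smul_of_cr_cr_mem h2 h3 hS hcr hd hd0 hx

lemma finrank_le_seven {I : Submodule F (F × O.Herm × O.Herm × F)} {V : Submodule F O.Herm}
    (hV : ∀ v ∈ V, (O.herm h2 h3).sharp v = 0)
    (hI : ∀ p, p ∈ I ↔ ∃ α, ∃ v ∈ V, p = (α, 0, v, 0)) : Module.finrank F I ≤ 7 := by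
  let f : F × V →ₗ[F] F × O.Herm × O.Herm × F := LinearMap.prodMap LinearMap.id
    (LinearMap.inr F _ _ ∘ₗ LinearMap.inl F _ _ ∘ₗ V.subtype)
  have hIf : I ≤ LinearMap.range f := fun p hp => by
    obtain ⟨α, v, hv, rfl⟩ := (hI p).1 hp
    exact ⟨(α, ⟨v, hv⟩), rfl⟩
  have hI' := Submodule.finrank_mono hIf
  have hf := LinearMap.finrank_range_le f
  rw [Module.finrank_prod, Module.finrank_self] at hf
  have hV' := O.finrank_le_six h2 h3 hV
  omega

lemma finrank_eq_twelve {I : Submodule F (F × O.Herm × O.Herm × F)} {d : O.Herm} (hd0 : d ≠ 0)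
    (hd : (O.herm h2 h3).sharp d = 0)
    (hI : ∀ p, p ∈ I ↔ ∃ (α ξ : F) (k : _), p = (α, ξ • d, (O.herm h2 h3).cr d k, 0)) :
    Module.finrank F I = 12 := by
  let f : F × F × LinearMap.range ((O.herm h2 h3).cr d) →ₗ[F] F × O.Herm × O.Herm × F :=
    LinearMap.prodMap LinearMap.id (LinearMap.prodMap (LinearMap.toSpanSingleton F _ d)
      (LinearMap.inl F _ _ ∘ₗ (LinearMap.range ((O.herm h2 h3).cr d)).subtype))
  have hf : ∀ α ξ v, f (α, ξ, v) = (α, ξ • d, v.1, 0) := fun _ _ _ => rfl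
  have hIf : I = LinearMap.range f := by
    ext p
    rw [hI]
    constructor
    · rintro ⟨α, ξ, k, rfl⟩
      exact ⟨(α, ξ, ⟨_, k, rfl⟩), rfl⟩
    · rintro ⟨⟨α, ξ, _, k, rfl⟩, rfl⟩
      exact ⟨α, ξ, k, rfl⟩
  rw [hIf, LinearMap.finrank_range_of_inj, Module.finrank_prod, Module.finrank_prod,
    Module.finrank_self, O.finrank_range_cr h2 h3 hd0 hd]
  rintro ⟨α, ξ, v⟩ ⟨α', ξ', v'⟩ h
  simp only [hf, Prod.mk.injEq, and_true] at h
  rw [h.1, smul_left_injective F hd0 h.2.1, Subtype.ext h.2.2]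

theorem inner_ideal_dichotomy {I : Submodule F (F × O.Herm × O.Herm × F)}
    {f : (F × O.Herm × O.Herm × F) ≃ₗ[F] (F × O.Herm × O.Herm × F)}
    (hf : (O.herm h2 h3).IsIsometry f)
    (h : (∃ V : Submodule F O.Herm, (∀ v ∈ V, (O.herm h2 h3).sharp v = 0) ∧
          ∀ p, p ∈ I.map f.toLinearMap ↔ ∃ α, ∃ v ∈ V, p = (α, 0, v, 0)) ∨
        ∃ d, d ≠ 0 ∧ (O.herm h2 h3).sharp d = 0 ∧
          ∀ p, p ∈ I.map f.toLinearMap ↔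
            ∃ (α ξ : F) (k : _), p = (α, ξ • d, (O.herm h2 h3).cr d k, 0)) :
    ((∀ e ∈ I, ∀ x, ∃ c : F, (O.herm h2 h3).triple e x e = c • e) ∧ Module.finrank F I ≤ 7) ∨
      (Module.finrank F I = 12 ∧
        ∃ e ∈ I, e ≠ 0 ∧ ¬ ∀ x, ∃ c : F, (O.herm h2 h3).triple e x e = c • e) := by
  rw [← f.finrank_map_eq I]
  obtain ⟨V, hV, hI⟩ | ⟨d, hd0, hd, hI⟩ := h
  · refine .inl ⟨fun e he => ?_, O.finrank_le_seven h2 h3 hV hI⟩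
    rw [← hf.forall_triple_iff]
    obtain ⟨α, v, hv, h⟩ := (hI (f e)).1 (Submodule.mem_map_of_mem he)
    rw [h]
    exact (O.herm h2 h3).triple_of_sharp_eq_zero (hV v hv) α
  · refine .inr ⟨O.finrank_eq_twelve h2 h3 hd0 hd hI, ?_⟩
    obtain ⟨k, hk⟩ := (O.herm h2 h3).exists_T_sharp_ne hd0
    obtain ⟨e, he, hfe⟩ := (hI (0, 0, (O.herm h2 h3).cr d k, 0)).2 ⟨0, 0, k, by rw [zero_smul]⟩
    have hns : ¬ ∀ x, ∃ c : F, (O.herm h2 h3).triple e x e = c • e := by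
      rw [← hf.forall_triple_iff, ← LinearEquiv.coe_coe, hfe]
      intro hs
      have := (O.herm h2 h3).sharp_eq_zero_of_triple hs
      rw [CubicNorm.sharp_cr, hd, map_zero, LinearMap.zero_apply, map_zero, LinearMap.zero_apply,
        zero_smul, zero_add, sub_zero, smul_eq_zero, CubicNorm.T_comm] at this
      exact this.elim hk hd0
    refine ⟨e, he, ?_, hns⟩
    rintro rfl
    exact hns fun x => ⟨0, by simp [CubicNorm.triple]⟩

end OctonionAlgebra

namespace ReducedAlbert

variable {F : Type u} [Field F] (A : ReducedAlbert.{u, v} F)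

/-- The hermitian matrix with given coordinates. -/
def ofHerm : A.O.Herm →ₗ[F] A.M where
  toFun x := Matrix.of ![![x.1 • 1, x.2.2.2.2.2, A.O.conj x.2.2.2.2.1],
    ![A.O.conj x.2.2.2.2.2, x.2.1 • 1, x.2.2.2.1],
    ![x.2.2.2.2.1, A.O.conj x.2.2.2.1, x.2.2.1 • 1]]
  map_add' x y := by
    ext i j
    fin_cases i <;> fin_cases j <;> simp [add_smul]
  map_smul' c x := by
    ext i j
    fin_cases i <;> fin_cases j <;> simp [mul_smul]

lemma ofHerm_mk (e1 e2 e3 : F) (a b c : A.O.C) :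
    A.ofHerm (e1, e2, e3, a, b, c) = Matrix.of ![![e1 • 1, c, A.O.conj b],
      ![A.O.conj c, e2 • 1, a], ![b, A.O.conj a, e3 • 1]] := rfl

/-- The coordinates of a hermitian matrix. -/
def toHerm : A.M →ₗ[F] A.O.Herm where
  toFun m := (2⁻¹ * A.O.bil (m 0 0) 1, 2⁻¹ * A.O.bil (m 1 1) 1, 2⁻¹ * A.O.bil (m 2 2) 1,
    m 1 2, m 2 0, m 0 1)
  map_add' x y := by simp [mul_add]
  map_smul' c x := by simp [mul_left_comm]

variable {A} (h2 : (2 : F) ≠ 0) (hγ : ∀ i, A.γ i = 1)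

include h2 in
lemma toHerm_ofHerm (x : A.O.Herm) : A.toHerm (A.ofHerm x) = x := by
  obtain ⟨e1, e2, e3, a, b, c⟩ := x
  simp [toHerm, ofHerm_mk, OctonionAlgebra.bil_one_one, mul_comm _ (2 : F), h2]

include hγ in
lemma ofHerm_mem (x : A.O.Herm) : A.ofHerm x ∈ A.J := by
  obtain ⟨e1, e2, e3, a, b, c⟩ := x
  intro i j
  fin_cases i <;> fin_cases j <;>
    simp [ofHerm_mk, hγ, OctonionAlgebra.conj_conj, OctonionAlgebra.conj_one]

lemma smul_one_of_conj_eq (h2 : (2 : F) ≠ 0) {O : OctonionAlgebra.{u, v} F} {x : O.C}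
    (hx : x = O.conj x) : (2⁻¹ * O.bil x 1) • (1 : O.C) = x := by
  rw [OctonionAlgebra.conj_eq, eq_sub_iff_add_eq, ← two_smul F x] at hx
  rw [mul_smul, ← hx, inv_smul_smul₀ h2]

include h2 hγ in
lemma ofHerm_toHerm {m : A.M} (hm : m ∈ A.J) : A.ofHerm (A.toHerm m) = m := by
  have hm' : ∀ i j, m i j = A.O.conj (m j i) := fun i j => by simpa [hγ] using hm i j
  ext i j
  fin_cases i <;> fin_cases j <;>
    simp [ofHerm, toHerm, smul_one_of_conj_eq h2 (hm' _ _), ← hm']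

include h2 in
lemma trace_ofHerm (x : A.O.Herm) : A.trace (A.ofHerm x) = x.1 + x.2.1 + x.2.2.1 := by
  obtain ⟨e1, e2, e3, a, b, c⟩ := x
  have h : ∀ x, QuadraticMap.polar (⇑A.O.n) x 1 = A.O.bil x 1 := fun _ => rfl
  simp only [trace, h, Fin.sum_univ_three, ofHerm_mk]
  simp [OctonionAlgebra.bil_one_one]
  field_simp

include h2 in
lemma tb_ofHerm (x y : A.O.Herm) : A.tb (A.ofHerm x) (A.ofHerm y) = A.O.hermT x y := by
  obtain ⟨e1, e2, e3, a, b, c⟩ := x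
  obtain ⟨e1', e2', e3', a', b', c'⟩ := y
  have h : ∀ x, QuadraticMap.polar (⇑A.O.n) x 1 = A.O.bil x 1 := fun _ => rfl
  simp only [tb, jmul, trace, h, Fin.sum_univ_three, ofHerm_mk, OctonionAlgebra.hermT_mk,
    Matrix.add_apply, Matrix.smul_apply, Matrix.mul_apply]
  simp [OctonionAlgebra.bil_one_one, OctonionAlgebra.bil_mul_one, OctonionAlgebra.bil_conj_conj,
    OctonionAlgebra.conj_conj]
  simp only [A.O.bil_comm a', A.O.bil_comm b', A.O.bil_comm c']
  field_simp
  ring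

lemma ofHerm_mul_self (e1 e2 e3 : F) (a b c : A.O.C) :
    A.ofHerm (e1, e2, e3, a, b, c) * A.ofHerm (e1, e2, e3, a, b, c)
      = A.ofHerm (e1 * e1 + A.O.n b + A.O.n c, e2 * e2 + A.O.n c + A.O.n a,
          e3 * e3 + A.O.n a + A.O.n b, (e2 + e3) • a + A.O.conj (b * c),
          (e3 + e1) • b + A.O.conj (c * a), (e1 + e2) • c + A.O.conj (a * b)) := by
  ext i j
  fin_cases i <;> fin_cases j <;>
    simp [Matrix.mul_apply, Fin.sum_univ_three, ofHerm_mk, OctonionAlgebra.mul_conj_self,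
      OctonionAlgebra.conj_mul_self, ← OctonionAlgebra.conj_mul, OctonionAlgebra.conj_conj] <;>
    module

lemma ofHerm_one : A.ofHerm (1, 1, 1, 0, 0, 0) = 1 := by
  ext i j
  fin_cases i <;> fin_cases j <;> simp [ofHerm_mk]

include h2 in
lemma sharp_ofHerm (x : A.O.Herm) : A.sharp (A.ofHerm x) = A.ofHerm (A.O.hermAdj x) := by
  rw [sharp, tb_ofHerm h2, trace_ofHerm h2, jmul, ← two_smul F (_ * _), inv_smul_smul₀ h2,
    ← ofHerm_one]
  obtain ⟨e1, e2, e3, a, b, c⟩ := x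
  rw [ofHerm_mul_self, ← map_smul, ← map_smul, ← map_sub, ← map_add]
  congr 1
  simp only [OctonionAlgebra.hermAdj_mk, OctonionAlgebra.hermT_mk, OctonionAlgebra.bil_self,
    Prod.smul_mk, Prod.mk_sub_mk, Prod.mk_add_mk, smul_eq_mul, Prod.mk.injEq, smul_zero]
  refine ⟨?_, ?_, ?_, by module, by module, by module⟩ <;> field_simp <;> ring

include h2 in
lemma cross_ofHerm (x y : A.O.Herm) :
    A.cross (A.ofHerm x) (A.ofHerm y) = A.ofHerm (A.O.hermCr x y) := by
  rw [cross, ← map_add, sharp_ofHerm h2, sharp_ofHerm h2, sharp_ofHerm h2, ← map_sub, ← map_sub]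
  congr 1
  obtain ⟨e1, e2, e3, a, b, c⟩ := x
  obtain ⟨e1', e2', e3', a', b', c'⟩ := y
  simp only [OctonionAlgebra.hermAdj_mk, OctonionAlgebra.hermCr_mk, OctonionAlgebra.n_add,
    map_add, add_mul, mul_add, Prod.mk_sub_mk, Prod.mk_add_mk, Prod.mk.injEq]
  refine ⟨by ring, by ring, by ring, by module, by module, by module⟩

/-! ### The Brown algebra in coordinates -/

variable (A)

/-- The element of the Brown algebra with given coordinates. -/
def ofBrown : (F × A.O.Herm × A.O.Herm × F) →ₗ[F] A.Bam :=
  LinearMap.prodMap LinearMap.id (LinearMap.prodMap A.ofHerm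
    (LinearMap.prodMap A.ofHerm LinearMap.id))

/-- The coordinates of an element of the Brown algebra. -/
def toBrown : A.Bam →ₗ[F] F × A.O.Herm × A.O.Herm × F :=
  LinearMap.prodMap LinearMap.id (LinearMap.prodMap A.toHerm
    (LinearMap.prodMap A.toHerm LinearMap.id))

lemma ofBrown_mk (α : F) (j k : A.O.Herm) (β : F) :
    A.ofBrown (α, j, k, β) = (α, A.ofHerm j, A.ofHerm k, β) := rfl

lemma toBrown_mk (α : F) (j k : A.M) (β : F) :
    A.toBrown (α, j, k, β) = (α, A.toHerm j, A.toHerm k, β) := rfl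

variable {A}

include h2 in
lemma toBrown_ofBrown (x : F × A.O.Herm × A.O.Herm × F) : A.toBrown (A.ofBrown x) = x := by
  obtain ⟨α, j, k, β⟩ := x
  rw [ofBrown_mk, toBrown_mk, toHerm_ofHerm h2, toHerm_ofHerm h2]

include h2 in
lemma ofBrown_injective : Function.Injective A.ofBrown :=
  Function.LeftInverse.injective (toBrown_ofBrown h2)

include hγ in
lemma ofBrown_mem (x : F × A.O.Herm × A.O.Herm × F) : A.ofBrown x ∈ A.Bsub :=
  ⟨ofHerm_mem hγ _, ofHerm_mem hγ _⟩

include h2 hγ in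
lemma exists_ofBrown_eq {p : A.Bam} (hp : p ∈ A.Bsub) : ∃ x, A.ofBrown x = p := by
  obtain ⟨α, j, k, β⟩ := p
  exact ⟨A.toBrown (α, j, k, β), by
    rw [toBrown_mk, ofBrown_mk, ofHerm_toHerm h2 hγ hp.1, ofHerm_toHerm h2 hγ hp.2]⟩

variable (h3 : (3 : F) ≠ 0)

lemma bmul_ofBrown (x y : F × A.O.Herm × A.O.Herm × F) :
    A.bmul 1 (A.ofBrown x) (A.ofBrown y) = A.ofBrown ((A.O.herm h2 h3).brownMul x y) := by
  obtain ⟨α, j, k, β⟩ := x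
  obtain ⟨α', j', k', β'⟩ := y
  simp only [bmul, CubicNorm.brownMul, ofBrown_mk, tb_ofHerm h2, cross_ofHerm h2, one_mul,
    one_smul, map_add, map_smul, OctonionAlgebra.herm_T, OctonionAlgebra.herm_cr]

lemma binv_ofBrown (x : F × A.O.Herm × A.O.Herm × F) :
    A.binv (A.ofBrown x) = A.ofBrown (CubicNorm.brownInv x) := rfl

lemma s0_eq : A.s0 = A.ofBrown (1, 0, 0, -1) := by
  rw [ofBrown_mk, map_zero, s0]

lemma brace_ofBrown (x y z : F × A.O.Herm × A.O.Herm × F) :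
    A.brace 1 (A.ofBrown x) (A.ofBrown y) (A.ofBrown z)
      = A.ofBrown ((A.O.herm h2 h3).brownBrace x y z) := by
  simp only [brace, CubicNorm.brownBrace, binv_ofBrown, bmul_ofBrown h2 h3, map_sub, map_add]

lemma bform_ofBrown (x y : F × A.O.Herm × A.O.Herm × F) :
    A.bform 1 (A.ofBrown x) (A.ofBrown y) = (A.O.herm h2 h3).form x y := by
  rw [← CubicNorm.brownMul_form]
  simp only [bform, bformS, s0_eq, binv_ofBrown, bmul_ofBrown h2 h3, ← map_sub]
  rfl

lemma tform_ofBrown (x y z : F × A.O.Herm × A.O.Herm × F) :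
    A.tform 1 (A.ofBrown x) (A.ofBrown y) (A.ofBrown z)
      = A.ofBrown ((A.O.herm h2 h3).triple x y z) := by
  have h : ∀ p q, A.bformS 1 A.s0 p q = A.bform 1 p q := fun _ _ => rfl
  rw [← CubicNorm.brownBrace_triple]
  simp only [tform, tformS, h, bform_ofBrown h2 h3]
  simp only [s0_eq, bmul_ofBrown h2 h3, brace_ofBrown h2 h3, map_sub, map_smul]

include hγ in
lemma isSingular_ofBrown_iff (e : F × A.O.Herm × A.O.Herm × F) :
    A.IsSingular 1 (A.ofBrown e)
      ↔ e ≠ 0 ∧ ∀ x, ∃ c : F, (A.O.herm h2 h3).triple e x e = c • e := by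
  rw [IsSingular, ← CubicNorm.forall_brownBrace_eq_smul_iff,
    map_ne_zero_iff _ (ofBrown_injective h2)]
  refine and_congr_right fun _ => ⟨fun h x => ?_, fun h p hp => ?_⟩
  · obtain ⟨c, hc⟩ := h _ (ofBrown_mem hγ x)
    rw [brace_ofBrown h2 h3, ← map_smul] at hc
    exact ⟨c, ofBrown_injective h2 hc⟩
  · obtain ⟨x, rfl⟩ := exists_ofBrown_eq h2 hγ hp
    obtain ⟨c, hc⟩ := h x
    exact ⟨c, by rw [brace_ofBrown h2 h3, hc, map_smul]⟩

end ReducedAlbert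

lemma IsSepClosed.infinite (F : Type u) [Field F] [IsSepClosed F] : Infinite F := by
  by_contra h
  rw [not_infinite_iff_finite] at h
  have : IsAlgClosed F := inferInstance
  exact not_finite F

/-- Over a separably closed field, if `I` is a proper inner ideal of
`B = B(Jᵈ, F×F)` containing a singular element, then some isometry `f` of the associated
triple system `(B,b,t)` carries `I` to `{(α,0;v,0)}` for a totally singular `V ⊆ Jᵈ` or to
`{(α, ξd; d×k, 0)}` for a rank-one `d`.  In particular either every nonzero element of `I`
is singular and `dim I ≤ 7`, or `dim I = 12` and `I` has a nonzero nonsingular element. -/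
theorem stmt18 {F : Type u} [Field F] [IsSepClosed F] (h2 : (2 : F) ≠ 0) (h3 : (3 : F) ≠ 0)
    (A : ReducedAlbert.{u, v} F) (hA : A.IsSplitAlbert)
    (I : Submodule F A.Bam) (hI : A.IsInnerIdeal 1 I) (hproper : I ≠ A.Bsub)
    (hsing : ∃ e ∈ I, A.IsSingular 1 e) :
    (∃ f : A.Bam →ₗ[F] A.Bam,
      Set.BijOn f (A.Bsub : Set A.Bam) (A.Bsub : Set A.Bam) ∧
      (∀ x ∈ A.Bsub, ∀ y ∈ A.Bsub, A.bform 1 (f x) (f y) = A.bform 1 x y) ∧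
      (∀ x ∈ A.Bsub, ∀ y ∈ A.Bsub, ∀ z ∈ A.Bsub,
        A.tform 1 (f x) (f y) (f z) = f (A.tform 1 x y z)) ∧
      ((∃ V : Submodule F A.M, V ≤ A.J ∧ (∀ v ∈ V, A.sharp v = 0) ∧
          f '' (I : Set A.Bam) = {p : A.Bam | ∃ α : F, ∃ v ∈ V, p = (α, 0, v, 0)}) ∨
        (∃ d ∈ A.J, d ≠ 0 ∧ A.sharp d = 0 ∧
          f '' (I : Set A.Bam)
            = {p : A.Bam | ∃ α ξ : F, ∃ k ∈ A.J, p = (α, ξ • d, A.cross d k, 0)}))) ∧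
    (((∀ e ∈ I, e ≠ 0 → A.IsSingular 1 e) ∧ Module.finrank F I ≤ 7) ∨
      (Module.finrank F I = 12 ∧ ∃ e ∈ I, e ≠ 0 ∧ ¬ A.IsSingular 1 e)) := by
  have := IsSepClosed.infinite F
  obtain ⟨I, rfl⟩ : ∃ I₀, I = Submodule.map A.ofBrown I₀ := by
    refine ⟨I.comap A.ofBrown, (Submodule.map_comap_eq_self fun p hp => ?_).symm⟩
    exact ReducedAlbert.exists_ofBrown_eq h2 hA.2 (hI.1 hp)
  obtain ⟨_, ⟨e, heI, rfl⟩, he⟩ := hsing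
  rw [ReducedAlbert.isSingular_ofBrown_iff h2 hA.2 h3] at he
  have hinj := ReducedAlbert.ofBrown_injective (A := A) h2
  obtain ⟨f, hf, h⟩ := A.O.exists_isometry_inner_ideal h2 h3 (I := I) (fun p hp x => by
    refine (A.O.herm h2 h3).triple_mem_of_brownBrace_mem hp (fun y => ?_) x
    have := hI.2 _ (Submodule.mem_map_of_mem hp) _ (ReducedAlbert.ofBrown_mem hA.2 y)
    rw [ReducedAlbert.brace_ofBrown h2 h3] at this
    exact (hinj.mem_set_image (s := I)).1 this) (by
    rintro rfl
    refine hproper (le_antisymm hI.1 fun p hp => ?_)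
    obtain ⟨x, rfl⟩ := ReducedAlbert.exists_ofBrown_eq h2 hA.2 hp
    exact Submodule.mem_map_of_mem trivial) heI he.1 he.2
  refine ⟨⟨A.ofBrown ∘ₗ f.toLinearMap ∘ₗ A.toBrown, ?_⟩, ?_⟩
  · have hF : ∀ x, (A.ofBrown ∘ₗ f.toLinearMap ∘ₗ A.toBrown) (A.ofBrown x) = A.ofBrown (f x) :=
      fun x => by simp [ReducedAlbert.toBrown_ofBrown h2]
    have hB : ∀ p ∈ A.Bsub, ∃ x, A.ofBrown x = p :=
      fun p hp => ReducedAlbert.exists_ofBrown_eq h2 hA.2 hp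
    have himage : ∀ p, p ∈ (A.ofBrown ∘ₗ f.toLinearMap ∘ₗ A.toBrown) ''
        (I.map A.ofBrown : Set A.Bam) ↔ ∃ x, x ∈ I.map f.toLinearMap ∧ A.ofBrown x = p := by
      intro p
      constructor
      · rintro ⟨_, ⟨x, hx, rfl⟩, rfl⟩
        exact ⟨f x, Submodule.mem_map_of_mem hx, (hF x).symm⟩
      · rintro ⟨_, ⟨x, hx, rfl⟩, rfl⟩
        exact ⟨_, ⟨x, hx, rfl⟩, hF x⟩
    generalize A.ofBrown ∘ₗ f.toLinearMap ∘ₗ A.toBrown = g at hF himage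
    refine ⟨⟨?_, ?_, ?_⟩, ?_, ?_, ?_⟩
    · intro p hp
      obtain ⟨x, rfl⟩ := hB p hp
      rw [hF]
      exact ReducedAlbert.ofBrown_mem hA.2 _
    · intro p hp q hq hpq
      obtain ⟨x, rfl⟩ := hB p hp
      obtain ⟨y, rfl⟩ := hB q hq
      rw [hF, hF] at hpq
      rw [f.injective (hinj hpq)]
    · intro p hp
      obtain ⟨x, rfl⟩ := hB p hp
      exact ⟨_, ReducedAlbert.ofBrown_mem hA.2 (f.symm x), by rw [hF, f.apply_symm_apply]⟩
    · intro p hp q hq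
      obtain ⟨x, rfl⟩ := hB p hp
      obtain ⟨y, rfl⟩ := hB q hq
      rw [hF, hF, ReducedAlbert.bform_ofBrown h2 h3, ReducedAlbert.bform_ofBrown h2 h3, hf.1]
    · intro p hp q hq r hr
      obtain ⟨x, rfl⟩ := hB p hp
      obtain ⟨y, rfl⟩ := hB q hq
      obtain ⟨z, rfl⟩ := hB r hr
      rw [hF, hF, hF, ReducedAlbert.tform_ofBrown h2 h3, ReducedAlbert.tform_ofBrown h2 h3, hF,
        hf.2]
    · obtain ⟨V, hV, hI'⟩ | ⟨d, hd0, hd, hI'⟩ := h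
      · refine .inl ⟨V.map A.ofHerm, ?_, ?_, Set.ext fun p => (himage p).trans ?_⟩
        · rintro _ ⟨v, -, rfl⟩
          exact ReducedAlbert.ofHerm_mem hA.2 v
        · rintro _ ⟨v, hv, rfl⟩
          rw [ReducedAlbert.sharp_ofHerm h2, ← A.O.herm_sharp h2 h3, hV v hv, map_zero]
        · constructor
          · rintro ⟨x, hx, rfl⟩
            obtain ⟨α, v, hv, rfl⟩ := (hI' x).1 hx
            exact ⟨α, _, Submodule.mem_map_of_mem hv, by rw [ReducedAlbert.ofBrown_mk, map_zero]⟩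
          · rintro ⟨α, _, ⟨v, hv, rfl⟩, rfl⟩
            exact ⟨_, (hI' _).2 ⟨α, v, hv, rfl⟩, by rw [ReducedAlbert.ofBrown_mk, map_zero]⟩
      · refine .inr ⟨A.ofHerm d, ReducedAlbert.ofHerm_mem hA.2 d, fun h0 => hd0 ?_, ?_,
          Set.ext fun p => (himage p).trans ?_⟩
        · rw [← ReducedAlbert.toHerm_ofHerm h2 d, h0, map_zero]
        · rw [ReducedAlbert.sharp_ofHerm h2, ← A.O.herm_sharp h2 h3, hd, map_zero]
        · constructor
          · rintro ⟨x, hx, rfl⟩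
            obtain ⟨α, ξ, k, rfl⟩ := (hI' x).1 hx
            exact ⟨α, ξ, _, ReducedAlbert.ofHerm_mem hA.2 k, by
              rw [ReducedAlbert.ofBrown_mk, map_smul, ReducedAlbert.cross_ofHerm h2,
                A.O.herm_cr]⟩
          · rintro ⟨α, ξ, m, hm, rfl⟩
            refine ⟨_, (hI' _).2 ⟨α, ξ, A.toHerm m, rfl⟩, ?_⟩
            rw [ReducedAlbert.ofBrown_mk, map_smul, A.O.herm_cr, ← ReducedAlbert.cross_ofHerm h2,
              ReducedAlbert.ofHerm_toHerm h2 hA.2 hm]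
  · rw [← (Submodule.equivMapOfInjective A.ofBrown hinj I).finrank_eq]
    refine (A.O.inner_ideal_dichotomy h2 h3 hf h).imp (fun h => ⟨?_, h.2⟩) fun h => ⟨h.1, ?_⟩
    · rintro _ ⟨e, he, rfl⟩ he0
      rw [ReducedAlbert.isSingular_ofBrown_iff h2 hA.2 h3]
      exact ⟨(map_ne_zero_iff _ hinj).1 he0, h.1 e he⟩
    · obtain ⟨e, he, he0, hs⟩ := h.2
      refine ⟨_, Submodule.mem_map_of_mem he, (map_ne_zero_iff _ hinj).2 he0, ?_⟩
      rw [ReducedAlbert.isSingular_ofBrown_iff h2 hA.2 h3]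
      exact fun h => hs h.2
end
end
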